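/- The Sklyanin determinant factorizes as sdet S(u) = γ_N(u) · qdet T(u) · qdet T̄(q^{2N−2} u⁻¹), where γ_N(u) = ∏_{1≤i<j≤N} (q^{2i−2}u⁻¹ − q^{−2j+2}u) in the orthogonal case (G = identity), and γ_N(u) = ∏_{1≤i<j≤N} (q^{2i−2}u⁻¹ − q^{−2j+2}u) · (q^{n−2} − qⁿu²)/(q^{2n−2} − q^{−2n}u²) in the symplectic case (N = 2n, G the standard skew matrix). -/

import Mathlib

noncomputable section

open scoped TensorProduct

abbrev FF : Type := RatFunc ℂ

def qq : FF := RatFunc.X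

/-! Constant R-matrices acting in `ℂ^N ⊗ ℂ^N`, written as matrices indexed by pairs. -/

def Rc (F : Type) [Field F] (q : F) (N : ℕ) :
    Matrix (Fin N × Fin N) (Fin N × Fin N) F := Matrix.of fun p r =>
  (if p = r then (if p.1 = p.2 then q else 1) else 0)
  + (if p.1 = r.2 ∧ p.2 = r.1 ∧ p.1 < p.2 then q - q⁻¹ else 0)

/-- `R` transposed in the first tensor factor. -/
def Rct (F : Type) [Field F] (q : F) (N : ℕ) :
    Matrix (Fin N × Fin N) (Fin N × Fin N) F :=
  Matrix.of fun p r => Rc F q N (r.1, p.2) (p.1, r.2)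

def Rtil (F : Type) [Field F] (q : F) (N : ℕ) :
    Matrix (Fin N × Fin N) (Fin N × Fin N) F := Matrix.of fun p r =>
  (if p = r then (if p.1 = p.2 then q⁻¹ else 1) else 0)
  + (if p.1 = r.2 ∧ p.2 = r.1 ∧ p.2 < p.1 then q⁻¹ - q else 0)

def Rtilt (F : Type) [Field F] (q : F) (N : ℕ) :
    Matrix (Fin N × Fin N) (Fin N × Fin N) F :=
  Matrix.of fun p r => Rtil F q N (r.1, p.2) (p.1, r.2)

/-- `S ↦ S ⊗ 1` (action in the first copy of `End ℂ^N`). -/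
def amp1 {A : Type} [Ring A] {N : ℕ} (M : Matrix (Fin N) (Fin N) A) :
    Matrix (Fin N × Fin N) (Fin N × Fin N) A :=
  Matrix.of fun p r => if p.2 = r.2 then M p.1 r.1 else 0

/-- `S ↦ 1 ⊗ S` (action in the second copy of `End ℂ^N`). -/
def amp2 {A : Type} [Ring A] {N : ℕ} (M : Matrix (Fin N) (Fin N) A) :
    Matrix (Fin N × Fin N) (Fin N × Fin N) A :=
  Matrix.of fun p r => if p.1 = r.1 then M p.2 r.2 else 0

/-- A scalar matrix viewed as a matrix over an `F`-algebra `A`. -/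
def liftF (F : Type) [Field F] {A : Type} [Ring A] [Algebra F A] {m : Type}
    (M : Matrix m m F) : Matrix m m A := M.map (algebraMap F A)

/-- Left hand side `R S₁ Rᵗ S₂` of the reflection equation. -/
def reflLHS (F : Type) [Field F] (q : F) {N : ℕ} {A : Type} [Ring A] [Algebra F A]
    (S : Matrix (Fin N) (Fin N) A) : Matrix (Fin N × Fin N) (Fin N × Fin N) A :=
  liftF F (Rc F q N) * amp1 S * liftF F (Rct F q N) * amp2 S

/-- Right hand side `S₂ Rᵗ S₁ R` of the reflection equation. -/
def reflRHS (F : Type) [Field F] (q : F) {N : ℕ} {A : Type} [Ring A] [Algebra F A]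
    (S : Matrix (Fin N) (Fin N) A) : Matrix (Fin N × Fin N) (Fin N × Fin N) A :=
  amp2 S * liftF F (Rct F q N) * amp1 S * liftF F (Rc F q N)

/-- The list of index pairs `(i,j)` in lexicographic order. -/
def lexPairs (N : ℕ) : List (Fin N × Fin N) :=
  (List.finRange N).flatMap fun i => (List.finRange N).map fun j => (i, j)

/-! The generic matrix of generators. -/

def Sfree (F : Type) [Field F] (N : ℕ) :
    Matrix (Fin N) (Fin N) (FreeAlgebra F (Fin N × Fin N)) :=
  Matrix.of fun i j => FreeAlgebra.ι F (i, j)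

/-- Defining relations: only the reflection equation. -/
inductive Rel0 (F : Type) [Field F] (q : F) (N : ℕ) :
    FreeAlgebra F (Fin N × Fin N) → FreeAlgebra F (Fin N × Fin N) → Prop
  | refl (p r : Fin N × Fin N) :
      Rel0 F q N (reflLHS F q (Sfree F N) p r) (reflRHS F q (Sfree F N) p r)

/-- The algebra with generators `s_ij` and the reflection equation as defining relations. -/
abbrev Alg0 (F : Type) [Field F] (q : F) (N : ℕ) := RingQuot (Rel0 F q N)

def s0 (F : Type) [Field F] (q : F) (N : ℕ) (i j : Fin N) : Alg0 F q N :=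
  RingQuot.mkAlgHom F (Rel0 F q N) (FreeAlgebra.ι F (i, j))

/-- Defining relations of the presented algebra `𝒮` of the orthogonal case. -/
inductive OSRel (F : Type) [Field F] (q : F) (N : ℕ) :
    FreeAlgebra F (Fin N × Fin N) → FreeAlgebra F (Fin N × Fin N) → Prop
  | tri (i j : Fin N) (h : i < j) : OSRel F q N (FreeAlgebra.ι F (i, j)) 0
  | diag (i : Fin N) : OSRel F q N (FreeAlgebra.ι F (i, i)) 1
  | refl (p r : Fin N × Fin N) :
      OSRel F q N (reflLHS F q (Sfree F N) p r) (reflRHS F q (Sfree F N) p r)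

abbrev AlgOS (F : Type) [Field F] (q : F) (N : ℕ) := RingQuot (OSRel F q N)

def sOS (F : Type) [Field F] (q : F) (N : ℕ) (i j : Fin N) : AlgOS F q N :=
  RingQuot.mkAlgHom F (OSRel F q N) (FreeAlgebra.ι F (i, j))

/-! The quantized enveloping algebra `U_q(gl_N)` by its RTT presentation. -/

abbrev GlGen (N : ℕ) := (Fin N × Fin N) ⊕ (Fin N × Fin N)

def Tfree (F : Type) [Field F] (N : ℕ) :
    Matrix (Fin N) (Fin N) (FreeAlgebra F (GlGen N)) :=
  Matrix.of fun i j => FreeAlgebra.ι F (Sum.inl (i, j))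

def Tbfree (F : Type) [Field F] (N : ℕ) :
    Matrix (Fin N) (Fin N) (FreeAlgebra F (GlGen N)) :=
  Matrix.of fun i j => FreeAlgebra.ι F (Sum.inr (i, j))

/-- `R X₁ Y₂` -/
def rttLHS (F : Type) [Field F] (q : F) {N : ℕ} {A : Type} [Ring A] [Algebra F A]
    (X Y : Matrix (Fin N) (Fin N) A) : Matrix (Fin N × Fin N) (Fin N × Fin N) A :=
  liftF F (Rc F q N) * amp1 X * amp2 Y

/-- `Y₂ X₁ R` -/
def rttRHS (F : Type) [Field F] (q : F) {N : ℕ} {A : Type} [Ring A] [Algebra F A]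
    (X Y : Matrix (Fin N) (Fin N) A) : Matrix (Fin N × Fin N) (Fin N × Fin N) A :=
  amp2 Y * amp1 X * liftF F (Rc F q N)

inductive GlRel (F : Type) [Field F] (q : F) (N : ℕ) :
    FreeAlgebra F (GlGen N) → FreeAlgebra F (GlGen N) → Prop
  | t_zero (i j : Fin N) (h : i < j) : GlRel F q N (Tfree F N i j) 0
  | tb_zero (i j : Fin N) (h : j < i) : GlRel F q N (Tbfree F N i j) 0
  | t_tb (i : Fin N) : GlRel F q N (Tfree F N i i * Tbfree F N i i) 1
  | tb_t (i : Fin N) : GlRel F q N (Tbfree F N i i * Tfree F N i i) 1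
  | rtt (p r : Fin N × Fin N) :
      GlRel F q N (rttLHS F q (Tfree F N) (Tfree F N) p r)
        (rttRHS F q (Tfree F N) (Tfree F N) p r)
  | rtbtb (p r : Fin N × Fin N) :
      GlRel F q N (rttLHS F q (Tbfree F N) (Tbfree F N) p r)
        (rttRHS F q (Tbfree F N) (Tbfree F N) p r)
  | rtbt (p r : Fin N × Fin N) :
      GlRel F q N (rttLHS F q (Tbfree F N) (Tfree F N) p r)
        (rttRHS F q (Tbfree F N) (Tfree F N) p r)

/-- The quantized enveloping algebra `U_q(gl_N)`. -/
abbrev UqGl (F : Type) [Field F] (q : F) (N : ℕ) := RingQuot (GlRel F q N)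

def tE (F : Type) [Field F] (q : F) (N : ℕ) (i j : Fin N) : UqGl F q N :=
  RingQuot.mkAlgHom F (GlRel F q N) (FreeAlgebra.ι F (Sum.inl (i, j)))

def tbE (F : Type) [Field F] (q : F) (N : ℕ) (i j : Fin N) : UqGl F q N :=
  RingQuot.mkAlgHom F (GlRel F q N) (FreeAlgebra.ι F (Sum.inr (i, j)))

/-- The entries `s_ij = Σ_a t_ia t̄_ja` of `S = T T̄ᵗ`. -/
def sE (F : Type) [Field F] (q : F) (N : ℕ) (i j : Fin N) : UqGl F q N :=
  ∑ a : Fin N, tE F q N i a * tbE F q N j a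

/-- The twisted quantized enveloping algebra `U^tw_q(o_N)` as a subalgebra of `U_q(gl_N)`. -/
def UtwO (F : Type) [Field F] (q : F) (N : ℕ) : Subalgebra F (UqGl F q N) :=
  Algebra.adjoin F {x | ∃ i j, x = sE F q N i j}

/-! Symplectic (finite) case. -/

/-- `2k` as an element of `Fin (2n)` (the 0-based version of the odd index `2k-1`). -/
def fe (n : ℕ) (k : Fin n) : Fin (2 * n) := ⟨2 * k.val, by have := k.isLt; omega⟩

/-- `2k+1` as an element of `Fin (2n)` (the 0-based version of the even index `2k`). -/
def fo (n : ℕ) (k : Fin n) : Fin (2 * n) := ⟨2 * k.val + 1, by have := k.isLt; omega⟩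

/-- The entries `s_ij` of `S = T G T̄ᵗ` in `U_q(gl_2n)`. -/
def sSp (F : Type) [Field F] (q : F) (n : ℕ) (i j : Fin (2 * n)) : UqGl F q (2 * n) :=
  algebraMap F _ q * ∑ a : Fin n, tE F q (2 * n) i (fe n a) * tbE F q (2 * n) j (fo n a)
    - ∑ a : Fin n, tE F q (2 * n) i (fo n a) * tbE F q (2 * n) j (fe n a)

abbrev SpGen (n : ℕ) := (Fin (2 * n) × Fin (2 * n)) ⊕ Fin n

def SpFreeS (F : Type) [Field F] (n : ℕ) :
    Matrix (Fin (2 * n)) (Fin (2 * n)) (FreeAlgebra F (SpGen n)) :=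
  Matrix.of fun i j => FreeAlgebra.ι F (Sum.inl (i, j))

/-- Defining relations of the presented algebra `𝒮` of the symplectic case. -/
inductive SpRel (F : Type) [Field F] (q : F) (n : ℕ) :
    FreeAlgebra F (SpGen n) → FreeAlgebra F (SpGen n) → Prop
  | tri (i j : Fin (2 * n)) (h : i < j) (h' : ¬(i.val % 2 = 0 ∧ j.val = i.val + 1)) :
      SpRel F q n (FreeAlgebra.ι F (Sum.inl (i, j))) 0
  | quad (k : Fin n) :
      SpRel F q n
        (FreeAlgebra.ι F (Sum.inl (fo n k, fo n k)) * FreeAlgebra.ι F (Sum.inl (fe n k, fe n k)))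
        (algebraMap F _ (q ^ 2) *
            (FreeAlgebra.ι F (Sum.inl (fo n k, fe n k)) *
              FreeAlgebra.ι F (Sum.inl (fe n k, fo n k)))
          + algebraMap F _ (q ^ 3))
  | invR (k : Fin n) :
      SpRel F q n
        (FreeAlgebra.ι F (Sum.inl (fe n k, fo n k)) * FreeAlgebra.ι F (Sum.inr k)) 1
  | invL (k : Fin n) :
      SpRel F q n
        (FreeAlgebra.ι F (Sum.inr k) * FreeAlgebra.ι F (Sum.inl (fe n k, fo n k))) 1
  | refl (p r : Fin (2 * n) × Fin (2 * n)) :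
      SpRel F q n (reflLHS F q (SpFreeS F n) p r) (reflRHS F q (SpFreeS F n) p r)

abbrev AlgSp (F : Type) [Field F] (q : F) (n : ℕ) := RingQuot (SpRel F q n)

def sSpP (F : Type) [Field F] (q : F) (n : ℕ) (i j : Fin (2 * n)) : AlgSp F q n :=
  RingQuot.mkAlgHom F (SpRel F q n) (FreeAlgebra.ι F (Sum.inl (i, j)))

def sInvP (F : Type) [Field F] (q : F) (n : ℕ) (k : Fin n) : AlgSp F q n :=
  RingQuot.mkAlgHom F (SpRel F q n) (FreeAlgebra.ι F (Sum.inr k))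

/-- row `i = 2k` of the symplectic ordered monomial: positions `(i,0),…,(i,2k)`. -/
def rowA (n : ℕ) (k : Fin n) : List (Fin (2 * n) × Fin (2 * n)) :=
  ((List.finRange (2 * n)).filter fun j => j.val ≤ 2 * k.val).map fun j => (fe n k, j)

/-- row `i' = 2k+1` of the symplectic ordered monomial: positions `(i',0),…,(i',2k-1)`. -/
def rowB (n : ℕ) (k : Fin n) : List (Fin (2 * n) × Fin (2 * n)) :=
  ((List.finRange (2 * n)).filter fun j => j.val + 2 ≤ 2 * k.val + 1).map fun j => (fo n k, j)

/-- The ordered monomials of the symplectic case, with an arbitrary integer exponent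
on each `s_{i i'}` and nonnegative exponents elsewhere. -/
def monomSp {A : Type} [Ring A] (n : ℕ) (s : Fin (2 * n) × Fin (2 * n) → A) (sI : Fin n → A)
    (kN : Fin (2 * n) × Fin (2 * n) → ℕ) (kZ : Fin n → ℤ) : A :=
  ((List.finRange n).map fun k =>
    ((rowA n k).map fun p => s p ^ kN p).prod *
      (if 0 ≤ kZ k then s (fe n k, fo n k) ^ (kZ k).toNat else sI k ^ (-(kZ k)).toNat) *
      s (fo n k, fo n k) ^ kN (fo n k, fo n k) *
      ((rowB n k).map fun p => s p ^ kN p).prod).prod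

/-! Affine (twisted q-Yangian) machinery.  Series are treated coefficientwise. -/

/-- `z1 S r` is the coefficient matrix (in the first copy) of a series indexed by
nonnegative integers, extended by zero to `ℤ`. -/
def z1 {A : Type} [Ring A] {N : ℕ} (S : ℕ → Matrix (Fin N) (Fin N) A) (r : ℤ) :
    Matrix (Fin N × Fin N) (Fin N × Fin N) A :=
  if 0 ≤ r then amp1 (S r.toNat) else 0

def z2 {A : Type} [Ring A] {N : ℕ} (S : ℕ → Matrix (Fin N) (Fin N) A) (r : ℤ) :
    Matrix (Fin N × Fin N) (Fin N × Fin N) A :=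
  if 0 ≤ r then amp2 (S r.toNat) else 0

/-- Coefficient of `u^a v^b` in `R(u,v) S₁(u) Rᵗ(u⁻¹,v) S₂(v)`,
using `R(u,v) = u R̃ - v R` and `Rᵗ(u⁻¹,v) = u⁻¹ R̃ᵗ - v Rᵗ`. -/
def affLHS (F : Type) [Field F] (q : F) {N : ℕ} {A : Type} [Ring A] [Algebra F A]
    (S : ℕ → Matrix (Fin N) (Fin N) A) (a b : ℤ) :
    Matrix (Fin N × Fin N) (Fin N × Fin N) A :=
  liftF F (Rtil F q N) * z1 S (-a) * liftF F (Rtilt F q N) * z2 S (-b)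
    - liftF F (Rtil F q N) * z1 S (1 - a) * liftF F (Rct F q N) * z2 S (1 - b)
    - liftF F (Rc F q N) * z1 S (-1 - a) * liftF F (Rtilt F q N) * z2 S (1 - b)
    + liftF F (Rc F q N) * z1 S (-a) * liftF F (Rct F q N) * z2 S (2 - b)

/-- Coefficient of `u^a v^b` in `S₂(v) Rᵗ(u⁻¹,v) S₁(u) R(u,v)`. -/
def affRHS (F : Type) [Field F] (q : F) {N : ℕ} {A : Type} [Ring A] [Algebra F A]
    (S : ℕ → Matrix (Fin N) (Fin N) A) (a b : ℤ) :
    Matrix (Fin N × Fin N) (Fin N × Fin N) A :=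
  z2 S (-b) * liftF F (Rtilt F q N) * z1 S (-a) * liftF F (Rtil F q N)
    - z2 S (1 - b) * liftF F (Rtilt F q N) * z1 S (-1 - a) * liftF F (Rc F q N)
    - z2 S (1 - b) * liftF F (Rct F q N) * z1 S (1 - a) * liftF F (Rtil F q N)
    + z2 S (2 - b) * liftF F (Rct F q N) * z1 S (-a) * liftF F (Rc F q N)

def SfreeA (F : Type) [Field F] (N : ℕ) (r : ℕ) :
    Matrix (Fin N) (Fin N) (FreeAlgebra F (ℕ × Fin N × Fin N)) :=
  Matrix.of fun i j => FreeAlgebra.ι F (r, i, j)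

/-- Defining relations: only the affine reflection equation (coefficientwise). -/
inductive Rel9 (F : Type) [Field F] (q : F) (N : ℕ) :
    FreeAlgebra F (ℕ × Fin N × Fin N) → FreeAlgebra F (ℕ × Fin N × Fin N) → Prop
  | refl (a b : ℤ) (p r : Fin N × Fin N) :
      Rel9 F q N (affLHS F q (SfreeA F N) a b p r) (affRHS F q (SfreeA F N) a b p r)

abbrev Alg9 (F : Type) [Field F] (q : F) (N : ℕ) := RingQuot (Rel9 F q N)

def s9 (F : Type) [Field F] (q : F) (N : ℕ) (r : ℕ) (i j : Fin N) : Alg9 F q N :=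
  RingQuot.mkAlgHom F (Rel9 F q N) (FreeAlgebra.ι F (r, i, j))

/-- Defining relations of the presented twisted q-Yangian (orthogonal case). -/
inductive AORel (F : Type) [Field F] (q : F) (N : ℕ) :
    FreeAlgebra F (ℕ × Fin N × Fin N) → FreeAlgebra F (ℕ × Fin N × Fin N) → Prop
  | tri (i j : Fin N) (h : i < j) : AORel F q N (FreeAlgebra.ι F (0, i, j)) 0
  | diag (i : Fin N) : AORel F q N (FreeAlgebra.ι F (0, i, i)) 1
  | refl (a b : ℤ) (p r : Fin N × Fin N) :
      AORel F q N (affLHS F q (SfreeA F N) a b p r) (affRHS F q (SfreeA F N) a b p r)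

abbrev AlgAO (F : Type) [Field F] (q : F) (N : ℕ) := RingQuot (AORel F q N)

def sAO (F : Type) [Field F] (q : F) (N : ℕ) (r : ℕ) (i j : Fin N) : AlgAO F q N :=
  RingQuot.mkAlgHom F (AORel F q N) (FreeAlgebra.ι F (r, i, j))

/-- Lexicographic (non-strict) comparison of triples. -/
def tripLe (x y : ℕ × ℕ × ℕ) : Prop :=
  x.1 < y.1 ∨ (x.1 = y.1 ∧ (x.2.1 < y.2.1 ∨ (x.2.1 = y.2.1 ∧ x.2.2 ≤ y.2.2)))

/-- A list of generator indices `(r,i,j)` is ordered if it is weakly increasing with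
respect to the lexicographic order on `(r,i,j)`. -/
def sortedGens {N : ℕ} (l : List (ℕ × Fin N × Fin N)) : Prop :=
  l.Chain' fun x y => tripLe (x.1, x.2.1.val, x.2.2.val) (y.1, y.2.1.val, y.2.2.val)

/-! The quantum affine algebra `U_q(ĝl_N)` by its RTT presentation, coefficientwise. -/

abbrev AffGen (N : ℕ) := (ℕ × Fin N × Fin N) ⊕ (ℕ × Fin N × Fin N)

def TfA (F : Type) [Field F] (N : ℕ) (r : ℕ) :
    Matrix (Fin N) (Fin N) (FreeAlgebra F (AffGen N)) :=
  Matrix.of fun i j => FreeAlgebra.ι F (Sum.inl (r, i, j))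

def TbfA (F : Type) [Field F] (N : ℕ) (r : ℕ) :
    Matrix (Fin N) (Fin N) (FreeAlgebra F (AffGen N)) :=
  Matrix.of fun i j => FreeAlgebra.ι F (Sum.inr (r, i, j))

/-- Coefficient of `u^a v^b` in `R(u,v) X₁ Y₂` with prescribed coefficient extractions. -/
def affRttL (F : Type) [Field F] (q : F) {N : ℕ} {A : Type} [Ring A] [Algebra F A]
    (X Y : ℕ → Matrix (Fin N) (Fin N) A) (a b a' b' : ℤ) :
    Matrix (Fin N × Fin N) (Fin N × Fin N) A :=
  liftF F (Rtil F q N) * z1 X a * z2 Y b - liftF F (Rc F q N) * z1 X a' * z2 Y b'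

def affRttR (F : Type) [Field F] (q : F) {N : ℕ} {A : Type} [Ring A] [Algebra F A]
    (X Y : ℕ → Matrix (Fin N) (Fin N) A) (a b a' b' : ℤ) :
    Matrix (Fin N × Fin N) (Fin N × Fin N) A :=
  z2 Y b * z1 X a * liftF F (Rtil F q N) - z2 Y b' * z1 X a' * liftF F (Rc F q N)

inductive AffGlRel (F : Type) [Field F] (q : F) (N : ℕ) :
    FreeAlgebra F (AffGen N) → FreeAlgebra F (AffGen N) → Prop
  | t0_tri (i j : Fin N) (h : i < j) : AffGlRel F q N (TfA F N 0 i j) 0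
  | tb0_tri (i j : Fin N) (h : j < i) : AffGlRel F q N (TbfA F N 0 i j) 0
  | t_tb (i : Fin N) : AffGlRel F q N (TfA F N 0 i i * TbfA F N 0 i i) 1
  | tb_t (i : Fin N) : AffGlRel F q N (TbfA F N 0 i i * TfA F N 0 i i) 1
  | rtt (a b : ℤ) (p r : Fin N × Fin N) :
      AffGlRel F q N
        (affRttL F q (TfA F N) (TfA F N) (1 - a) (-b) (-a) (1 - b) p r)
        (affRttR F q (TfA F N) (TfA F N) (1 - a) (-b) (-a) (1 - b) p r)
  | rtbtb (a b : ℤ) (p r : Fin N × Fin N) :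
      AffGlRel F q N
        (affRttL F q (TbfA F N) (TbfA F N) (a - 1) b a (b - 1) p r)
        (affRttR F q (TbfA F N) (TbfA F N) (a - 1) b a (b - 1) p r)
  | rtbt (a b : ℤ) (p r : Fin N × Fin N) :
      AffGlRel F q N
        (affRttL F q (TbfA F N) (TfA F N) (a - 1) (-b) a (1 - b) p r)
        (affRttR F q (TbfA F N) (TfA F N) (a - 1) (-b) a (1 - b) p r)

/-- The quantum affine algebra `U_q(ĝl_N)`. -/
abbrev UqAff (F : Type) [Field F] (q : F) (N : ℕ) := RingQuot (AffGlRel F q N)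

def tA (F : Type) [Field F] (q : F) (N : ℕ) (r : ℕ) (i j : Fin N) : UqAff F q N :=
  RingQuot.mkAlgHom F (AffGlRel F q N) (FreeAlgebra.ι F (Sum.inl (r, i, j)))

def tbA (F : Type) [Field F] (q : F) (N : ℕ) (r : ℕ) (i j : Fin N) : UqAff F q N :=
  RingQuot.mkAlgHom F (AffGlRel F q N) (FreeAlgebra.ι F (Sum.inr (r, i, j)))

/-- Coefficient of `u^{-r}` in `s_ij(u) = Σ_a t_ia(u) t̄_ja(u⁻¹)`. -/
def Scoef (F : Type) [Field F] (q : F) (N : ℕ) (r : ℕ) (i j : Fin N) : UqAff F q N :=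
  ∑ a : Fin N, ∑ p ∈ Finset.range (r + 1), tA F q N p i a * tbA F q N (r - p) j a

/-- The twisted q-Yangian `Y^tw_q(o_N)` as a subalgebra of `U_q(ĝl_N)`. -/
def YtwO (F : Type) [Field F] (q : F) (N : ℕ) : Subalgebra F (UqAff F q N) :=
  Algebra.adjoin F {x | ∃ r i j, x = Scoef F q N r i j}

/-- Coefficient of `u^{-r}` in `s_ij(u)`, the `(i,j)` entry of `S(u) = T(u) G T̄(u⁻¹)ᵗ`
in the symplectic case. -/
def ScoefSp (F : Type) [Field F] (q : F) (n : ℕ) (r : ℕ) (i j : Fin (2 * n)) :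
    UqAff F q (2 * n) :=
  ∑ a : Fin n, ∑ p ∈ Finset.range (r + 1),
    (algebraMap F _ q * (tA F q (2 * n) p i (fe n a) * tbA F q (2 * n) (r - p) j (fo n a))
      - tA F q (2 * n) p i (fo n a) * tbA F q (2 * n) (r - p) j (fe n a))

/-- The twisted q-Yangian `Y^tw_q(sp_2n)` as a subalgebra of `U_q(ĝl_2n)`,
with a prescribed family of inverses of `s^{(0)}_{ii'}`. -/
def YtwSp (F : Type) [Field F] (q : F) (n : ℕ) (inv : Fin n → UqAff F q (2 * n)) :
    Subalgebra F (UqAff F q (2 * n)) :=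
  Algebra.adjoin F ({x | ∃ r i j, x = ScoefSp F q n r i j} ∪ Set.range inv)

abbrev ASpGen (n : ℕ) := (ℕ × Fin (2 * n) × Fin (2 * n)) ⊕ Fin n

def SfreeASp (F : Type) [Field F] (n : ℕ) (r : ℕ) :
    Matrix (Fin (2 * n)) (Fin (2 * n)) (FreeAlgebra F (ASpGen n)) :=
  Matrix.of fun i j => FreeAlgebra.ι F (Sum.inl (r, i, j))

/-- Defining relations of the presented twisted q-Yangian (symplectic case). -/
inductive ASpRel (F : Type) [Field F] (q : F) (n : ℕ) :
    FreeAlgebra F (ASpGen n) → FreeAlgebra F (ASpGen n) → Prop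
  | tri (i j : Fin (2 * n)) (h : i < j) (h' : ¬(i.val % 2 = 0 ∧ j.val = i.val + 1)) :
      ASpRel F q n (FreeAlgebra.ι F (Sum.inl (0, i, j))) 0
  | quad (k : Fin n) :
      ASpRel F q n
        (FreeAlgebra.ι F (Sum.inl (0, fo n k, fo n k)) *
          FreeAlgebra.ι F (Sum.inl (0, fe n k, fe n k)))
        (algebraMap F _ (q ^ 2) *
            (FreeAlgebra.ι F (Sum.inl (0, fo n k, fe n k)) *
              FreeAlgebra.ι F (Sum.inl (0, fe n k, fo n k)))
          + algebraMap F _ (q ^ 3))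
  | invR (k : Fin n) :
      ASpRel F q n
        (FreeAlgebra.ι F (Sum.inl (0, fe n k, fo n k)) * FreeAlgebra.ι F (Sum.inr k)) 1
  | invL (k : Fin n) :
      ASpRel F q n
        (FreeAlgebra.ι F (Sum.inr k) * FreeAlgebra.ι F (Sum.inl (0, fe n k, fo n k))) 1
  | refl (a b : ℤ) (p r : Fin (2 * n) × Fin (2 * n)) :
      ASpRel F q n (affLHS F q (SfreeASp F n) a b p r) (affRHS F q (SfreeASp F n) a b p r)

abbrev AlgASp (F : Type) [Field F] (q : F) (n : ℕ) := RingQuot (ASpRel F q n)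

def sASp (F : Type) [Field F] (q : F) (n : ℕ) (r : ℕ) (i j : Fin (2 * n)) : AlgASp F q n :=
  RingQuot.mkAlgHom F (ASpRel F q n) (FreeAlgebra.ι F (Sum.inl (r, i, j)))

def sInvASp (F : Type) [Field F] (q : F) (n : ℕ) (k : Fin n) : AlgASp F q n :=
  RingQuot.mkAlgHom F (ASpRel F q n) (FreeAlgebra.ι F (Sum.inr k))

/-! q-antisymmetrizer and Sklyanin/quantum determinant machinery. -/

/-- The trigonometric R-matrix `R(u,v)`. -/
def Rtrig (F : Type) [Field F] (q : F) (N : ℕ) (u v : F) :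
    Matrix (Fin N × Fin N) (Fin N × Fin N) F := Matrix.of fun p r =>
  (if p = r then (if p.1 = p.2 then q⁻¹ * u - q * v else u - v) else 0)
  + (if p.1 = r.2 ∧ p.2 = r.1 ∧ p.1 ≠ p.2 then
      (q⁻¹ - q) * (if p.2 < p.1 then u else v) else 0)

/-- An operator on `ℂ^N ⊗ ℂ^N` acting in the `i`-th and `j`-th factors of `(ℂ^N)^{⊗ r}`. -/
def big2 (F : Type) [Field F] {N r : ℕ} (i j : Fin r)
    (M : Matrix (Fin N × Fin N) (Fin N × Fin N) F) :
    Matrix (Fin r → Fin N) (Fin r → Fin N) F :=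
  Matrix.of fun f g =>
    if ∀ k, k ≠ i → k ≠ j → f k = g k then M (f i, f j) (g i, g j) else 0

/-- The list of the pairs `(i,j)`, `i < j`, in lexicographic order. -/
def pairsLex (r : ℕ) : List (Fin r × Fin r) :=
  (List.finRange r).flatMap fun i =>
    ((List.finRange r).filter fun j => i < j).map fun j => (i, j)

/-- The number of inversions (the Coxeter length) of a permutation. -/
def invCount {r : ℕ} (σ : Equiv.Perm (Fin r)) : ℕ :=
  (Finset.univ.filter fun p : Fin r × Fin r => p.1 < p.2 ∧ σ p.2 < σ p.1).card

/-- The q-permutation operator `P^q` on `ℂ^N ⊗ ℂ^N`. -/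
def PqSmall (F : Type) [Field F] (q : F) (N : ℕ) :
    Matrix (Fin N × Fin N) (Fin N × Fin N) F := Matrix.of fun p r =>
  if r.1 = p.2 ∧ r.2 = p.1 then (if p.1 = p.2 then 1 else if p.2 < p.1 then q else q⁻¹)
  else 0

/-- The hypothesis that `Pq` is the extension of the q-permutation operators along
reduced decompositions: `P^q_{σ s_i} = P^q_σ P^q_{s_i}` whenever the length grows. -/
def PqExt (F : Type) [Field F] (q : F) (N r : ℕ)
    (Pq : Equiv.Perm (Fin r) → Matrix (Fin r → Fin N) (Fin r → Fin N) F) : Prop :=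
  Pq 1 = 1 ∧
    ∀ (σ : Equiv.Perm (Fin r)) (i : ℕ) (h : i + 1 < r),
      invCount (σ * Equiv.swap ⟨i, Nat.lt_of_succ_lt h⟩ ⟨i + 1, h⟩) = invCount σ + 1 →
        Pq (σ * Equiv.swap ⟨i, Nat.lt_of_succ_lt h⟩ ⟨i + 1, h⟩) =
          Pq σ * big2 F ⟨i, Nat.lt_of_succ_lt h⟩ ⟨i + 1, h⟩ (PqSmall F q N)

/-- The q-antisymmetrizer `A^q_r = Σ_σ sgn(σ) P^q_σ`. -/
def AqM (F : Type) [Field F] {N r : ℕ}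
    (Pq : Equiv.Perm (Fin r) → Matrix (Fin r → Fin N) (Fin r → Fin N) F) :
    Matrix (Fin r → Fin N) (Fin r → Fin N) F :=
  ∑ σ : Equiv.Perm (Fin r), ((Equiv.Perm.sign σ : ℤ) : F) • Pq σ

/-- A matrix acting in the `k`-th factor of `(ℂ^N)^{⊗ N}`, with entries in `A`. -/
def ampAt {A : Type} [Ring A] {N : ℕ} (k : Fin N) (M : Matrix (Fin N) (Fin N) A) :
    Matrix (Fin N → Fin N) (Fin N → Fin N) A :=
  Matrix.of fun f g => if ∀ l, l ≠ k → f l = g l then M (f k) (g k) else 0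

/-- A scalar two-site operator viewed over `A`, acting at sites `i`, `j`. -/
def big2A (F : Type) [Field F] {A : Type} [Ring A] [Algebra F A] {N : ℕ} (i j : Fin N)
    (M : Matrix (Fin N × Fin N) (Fin N × Fin N) F) :
    Matrix (Fin N → Fin N) (Fin N → Fin N) A :=
  (big2 F i j M).map (algebraMap F A)

/-- Coefficient of `u^m` in a product of formal series, each of which is supported in
degrees `≤ 1`; the series are given by their coefficient functions `ℤ → M`. -/
def seriesProdCoeff {M : Type} [Ring M] : List (ℤ → M) → ℤ → M
  | [], m => if m = 0 then 1 else 0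
  | c :: t, m => ∑ k ∈ Finset.Icc (m - t.length) 1, c k * seriesProdCoeff t (m - k)

/-! Series factors entering the Sklyanin determinant. -/

/-- The matrix `S^{(r)}` of the coefficients of `S(u)` (orthogonal case). -/
def SmatA (F : Type) [Field F] (q : F) (N : ℕ) (r : ℕ) :
    Matrix (Fin N) (Fin N) (UqAff F q N) :=
  Matrix.of fun i j => Scoef F q N r i j

/-- The series `S_k(q^{-2k+2} u)` acting at site `k` (0-based `k`), coefficientwise. -/
def SfacO (F : Type) [Field F] (q : F) (N : ℕ) (k : Fin N) (m : ℤ) :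
    Matrix (Fin N → Fin N) (Fin N → Fin N) (UqAff F q N) :=
  if m ≤ 0 then q ^ (2 * (k.val : ℤ) * (-m)) • ampAt k (SmatA F q N (-m).toNat) else 0

/-- The series `R_{ij}ᵗ((q^{-2i+2}u)⁻¹, q^{-2j+2}u)` (0-based `i`, `j`), coefficientwise. -/
def RtfacO (F : Type) [Field F] (q : F) (N : ℕ) (i j : Fin N) (m : ℤ) :
    Matrix (Fin N → Fin N) (Fin N → Fin N) (UqAff F q N) :=
  if m = -1 then q ^ (2 * (i.val : ℤ)) • big2A F i j (Rtilt F q N)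
  else if m = 1 then (-(q ^ (-2 * (j.val : ℤ)))) • big2A F i j (Rct F q N)
  else 0

/-- The ordered list of factors `S₁(u) R₁₂ᵗ ⋯ R₁Nᵗ S₂(q⁻²u) ⋯ S_N(q^{-2N+2}u)`. -/
def sdetFacsO (F : Type) [Field F] (q : F) (N : ℕ) :
    List (ℤ → Matrix (Fin N → Fin N) (Fin N → Fin N) (UqAff F q N)) :=
  (List.finRange N).flatMap fun i =>
    SfacO F q N i :: (((List.finRange N).filter fun j => i < j).map fun j => RtfacO F q N i j)

/-- The matrix `S^{(r)}` of the coefficients of `S(u)` (symplectic case). -/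
def SmatASp (F : Type) [Field F] (q : F) (n : ℕ) (r : ℕ) :
    Matrix (Fin (2 * n)) (Fin (2 * n)) (UqAff F q (2 * n)) :=
  Matrix.of fun i j => ScoefSp F q n r i j

def SfacSp (F : Type) [Field F] (q : F) (n : ℕ) (k : Fin (2 * n)) (m : ℤ) :
    Matrix (Fin (2 * n) → Fin (2 * n)) (Fin (2 * n) → Fin (2 * n)) (UqAff F q (2 * n)) :=
  if m ≤ 0 then q ^ (2 * (k.val : ℤ) * (-m)) • ampAt k (SmatASp F q n (-m).toNat) else 0

def sdetFacsSp (F : Type) [Field F] (q : F) (n : ℕ) :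
    List (ℤ → Matrix (Fin (2 * n) → Fin (2 * n)) (Fin (2 * n) → Fin (2 * n))
      (UqAff F q (2 * n))) :=
  (List.finRange (2 * n)).flatMap fun i =>
    SfacSp F q n i ::
      (((List.finRange (2 * n)).filter fun j => i < j).map fun j => RtfacO F q (2 * n) i j)

/-- Coefficientwise quantum determinant `qdet T(u)`:
the coefficient of `u^m` (nonzero only for `m ≤ 0`). -/
def qdetTc (F : Type) [Field F] (q : F) (N : ℕ) (m : ℤ) : UqAff F q N :=
  if m ≤ 0 then
    ∑ σ : Equiv.Perm (Fin N), ∑ rv ∈ Finset.Nat.antidiagonalTuple N (-m).toNat,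
      (((-q)⁻¹ ^ invCount σ) * ∏ k : Fin N, q ^ (2 * (k.val : ℤ) * (rv k : ℤ))) •
        ((List.finRange N).map fun k => tA F q N (rv k) (σ k) k).prod
  else 0

/-- Coefficientwise quantum determinant `qdet T̄(q^{2N-2} u⁻¹)`:
the coefficient of `u^m` (nonzero only for `m ≤ 0`). -/
def qdetTbc (F : Type) [Field F] (q : F) (N : ℕ) (m : ℤ) : UqAff F q N :=
  if m ≤ 0 then
    ∑ σ : Equiv.Perm (Fin N), ∑ rv ∈ Finset.Nat.antidiagonalTuple N (-m).toNat,
      (((-q)⁻¹ ^ invCount σ) *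
          ∏ k : Fin N, q ^ ((2 * (N : ℤ) - 2 - 2 * (k.val : ℤ)) * (rv k : ℤ))) •
        ((List.finRange N).map fun k => tbA F q N (rv k) (σ k) k).prod
  else 0

/-- The linear factor `q^{2i-2}u⁻¹ - q^{-2j+2}u` of `γ_N(u)` (0-based `i`, `j`),
viewed as an `A`-valued series. -/
def gamFac (F : Type) [Field F] (q : F) (N : ℕ) (p : Fin N × Fin N) (m : ℤ) : UqAff F q N :=
  if m = -1 then algebraMap F _ (q ^ (2 * (p.1.val : ℤ)))
  else if m = 1 then algebraMap F _ (-(q ^ (-2 * (p.2.val : ℤ)))) else 0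

/-- The list of series whose product is `γ_N(u) qdet T(u) qdet T̄(q^{2N-2}u⁻¹)`
in the orthogonal case. -/
def rhsO (F : Type) [Field F] (q : F) (N : ℕ) : List (ℤ → UqAff F q N) :=
  ((pairsLex N).map fun p => gamFac F q N p) ++ [qdetTc F q N, qdetTbc F q N]

/-! ### One- and two-site operators -/

section SiteOperators

open Matrix Function

variable {A : Type} [Ring A] {N : ℕ}

lemma matrix_ext_vecMul {m : Type} [Fintype m] [DecidableEq m] {M M' : Matrix m m A}
    (h : ∀ φ : m → A, φ ᵥ* M = φ ᵥ* M') : M = M' := by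
  ext i j
  have := congrFun (h (Pi.single i 1)) j
  simpa using this

/-- An operator with entries in a ring acting in the `i`-th and `j`-th tensor factors. -/
def twoSite (i j : Fin N) (M : Matrix (Fin N × Fin N) (Fin N × Fin N) A) :
    Matrix (Fin N → Fin N) (Fin N → Fin N) A :=
  Matrix.of fun f g =>
    if ∀ k, k ≠ i → k ≠ j → f k = g k then M (f i, f j) (g i, g j) else 0

lemma map_twoSite {B : Type} [Ring B] (g : A →+* B) (i j : Fin N)
    (M : Matrix (Fin N × Fin N) (Fin N × Fin N) A) :
    (twoSite i j M).map g = twoSite i j (M.map g) := by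
  ext f h
  simp only [twoSite, Matrix.map_apply, Matrix.of_apply]
  split_ifs <;> simp

lemma map_ampAt {B : Type} [Ring B] (g : A →+* B) (i : Fin N)
    (M : Matrix (Fin N) (Fin N) A) :
    (ampAt i M).map g = ampAt i (M.map g) := by
  ext f h
  simp only [ampAt, Matrix.map_apply, Matrix.of_apply]
  split_ifs <;> simp

lemma sum_agree_off_one (k : Fin N) (h : Fin N → Fin N) (Φ : (Fin N → Fin N) → A) :
    (∑ f, if ∀ l, l ≠ k → f l = h l then Φ f else 0) = ∑ a, Φ (update h k a) := by
  rw [← Finset.sum_filter]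
  refine Finset.sum_nbij' (fun f => f k) (fun a => update h k a) ?_ ?_ ?_ ?_ ?_
  · simp
  · intro a _
    simp +contextual [update_of_ne]
  · intro f hf
    simp only [Finset.mem_filter, Finset.mem_univ, true_and] at hf
    ext l
    by_cases hl : l = k
    · subst hl; simp
    · simp [hl, hf l hl]
  · simp
  · intro f hf
    simp only [Finset.mem_filter, Finset.mem_univ, true_and] at hf
    congr 1
    ext l
    by_cases hl : l = k
    · subst hl; simp
    · simp [hl, hf l hl]

lemma sum_agree_off_two {i j : Fin N} (hij : i ≠ j) (h : Fin N → Fin N)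
    (Φ : (Fin N → Fin N) → A) :
    (∑ f, if ∀ k, k ≠ i → k ≠ j → f k = h k then Φ f else 0) =
      ∑ a, ∑ b, Φ (update (update h i a) j b) := by
  rw [← Finset.sum_filter, ← Fintype.sum_prod_type']
  have key : ∀ f : Fin N → Fin N, (∀ k, k ≠ i → k ≠ j → f k = h k) →
      update (update h i (f i)) j (f j) = f := by
    intro f hf
    ext l
    by_cases hl : l = j
    · subst hl; simp
    · by_cases hl' : l = i
      · subst hl'; simp [hl]
      · simp [hl, hl', hf l hl' hl]
  refine Finset.sum_nbij' (fun f => (f i, f j)) (fun p => update (update h i p.1) j p.2)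
    ?_ ?_ ?_ ?_ ?_
  · simp
  · intro a _
    simp +contextual [update_of_ne]
  · intro f hf
    simp only [Finset.mem_filter, Finset.mem_univ, true_and] at hf
    exact key f hf
  · rintro ⟨a, b⟩ _
    simp [hij]
  · intro f hf
    simp only [Finset.mem_filter, Finset.mem_univ, true_and] at hf
    rw [key f hf]

lemma vecMul_ampAt (φ : (Fin N → Fin N) → A) (k : Fin N) (X : Matrix (Fin N) (Fin N) A)
    (h : Fin N → Fin N) :
    (φ ᵥ* ampAt k X) h = ∑ a, φ (update h k a) * X a (h k) := by
  simp only [vecMul, dotProduct, ampAt, Matrix.of_apply, mul_ite, mul_zero]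
  rw [sum_agree_off_one k h fun f => φ f * X (f k) (h k)]
  simp

lemma vecMul_twoSite (φ : (Fin N → Fin N) → A) {i j : Fin N} (hij : i ≠ j)
    (M : Matrix (Fin N × Fin N) (Fin N × Fin N) A) (h : Fin N → Fin N) :
    (φ ᵥ* twoSite i j M) h =
      ∑ a, ∑ b, φ (update (update h i a) j b) * M (a, b) (h i, h j) := by
  simp only [vecMul, dotProduct, twoSite, Matrix.of_apply, mul_ite, mul_zero]
  rw [sum_agree_off_two hij h fun f => φ f * M (f i, f j) (h i, h j)]
  simp [hij]

lemma twoSite_mul {i j : Fin N} (hij : i ≠ j)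
    (M M' : Matrix (Fin N × Fin N) (Fin N × Fin N) A) :
    twoSite i j (M * M') = twoSite i j M * twoSite i j M' := by
  refine matrix_ext_vecMul fun φ => ?_
  ext h
  rw [← vecMul_vecMul, vecMul_twoSite _ hij, vecMul_twoSite _ hij]
  simp only [vecMul_twoSite _ hij]
  simp only [Matrix.mul_apply, Finset.mul_sum, Finset.sum_mul, Fintype.sum_prod_type]
  have e : ∀ a b c d : Fin N, update (update (update (update h i a) j b) i c) j d =
      update (update h i c) j d := by
    intro a b c d
    rw [update_comm hij.symm, update_idem, update_idem]
  simp only [e, ne_eq, hij, not_false_eq_true, update_of_ne, update_self, mul_assoc]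
  calc _ = ∑ a, ∑ c, ∑ b, ∑ d, φ (update (update h i a) j b) * (M (a, b) (c, d) *
          M' (c, d) (h i, h j)) := by
        refine Finset.sum_congr rfl fun a _ => ?_
        rw [Finset.sum_comm]
    _ = ∑ c, ∑ a, ∑ d, ∑ b, φ (update (update h i a) j b) * (M (a, b) (c, d) *
          M' (c, d) (h i, h j)) := by
        rw [Finset.sum_comm]
        refine Finset.sum_congr rfl fun c _ => Finset.sum_congr rfl fun a _ => ?_
        rw [Finset.sum_comm]
    _ = _ := by
        refine Finset.sum_congr rfl fun c _ => ?_
        rw [Finset.sum_comm]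

lemma ampAt_eq_twoSite_left {i j : Fin N} (hij : i ≠ j) (X : Matrix (Fin N) (Fin N) A) :
    ampAt i X = twoSite i j (amp1 X) := by
  refine matrix_ext_vecMul fun φ => ?_
  ext h
  rw [vecMul_ampAt, vecMul_twoSite _ hij]
  simp only [amp1, Matrix.of_apply, mul_ite, mul_zero, Finset.sum_ite_eq', Finset.mem_univ,
    if_true]
  refine Finset.sum_congr rfl fun a _ => ?_
  congr 2
  rw [update_comm hij, update_eq_self]

lemma ampAt_eq_twoSite_right {i j : Fin N} (hij : i ≠ j) (Y : Matrix (Fin N) (Fin N) A) :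
    ampAt j Y = twoSite i j (amp2 Y) := by
  refine matrix_ext_vecMul fun φ => ?_
  ext h
  rw [vecMul_ampAt, vecMul_twoSite _ hij]
  simp only [amp2, Matrix.of_apply, mul_ite, mul_zero]
  rw [Finset.sum_comm]
  simp only [Finset.sum_ite_eq', Finset.mem_univ, if_true, update_eq_self]

lemma ampAt_commute_twoSite {i j k : Fin N} (hij : i ≠ j) (hki : k ≠ i) (hkj : k ≠ j)
    (Y : Matrix (Fin N) (Fin N) A) (M : Matrix (Fin N × Fin N) (Fin N × Fin N) A)
    (hc : ∀ a b p r, Commute (Y a b) (M p r)) :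
    Commute (ampAt k Y) (twoSite i j M) := by
  refine matrix_ext_vecMul fun φ => ?_
  ext h
  rw [← vecMul_vecMul, ← vecMul_vecMul, vecMul_twoSite _ hij, vecMul_ampAt]
  simp only [vecMul_twoSite _ hij, vecMul_ampAt]
  simp only [ne_eq, hki, hkj, hki.symm, hkj.symm, not_false_eq_true, update_of_ne,
    Finset.sum_mul]
  rw [Finset.sum_congr rfl fun a _ => Finset.sum_comm, Finset.sum_comm]
  refine Finset.sum_congr rfl fun c _ => Finset.sum_congr rfl fun a _ =>
    Finset.sum_congr rfl fun b _ => ?_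
  rw [mul_assoc, mul_assoc, (hc _ _ _ _).eq]
  rw [update_comm hkj.symm, update_comm hki.symm]

lemma ampAt_commute_ampAt {k l : Fin N} (hkl : k ≠ l)
    (Y Z : Matrix (Fin N) (Fin N) A) (hc : ∀ a b c d, Commute (Y a b) (Z c d)) :
    Commute (ampAt k Y) (ampAt l Z) := by
  refine matrix_ext_vecMul fun φ => ?_
  ext h
  rw [← vecMul_vecMul, ← vecMul_vecMul]
  simp only [vecMul_ampAt, ne_eq, hkl, hkl.symm, not_false_eq_true, update_of_ne,
    Finset.sum_mul]
  rw [Finset.sum_comm]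
  refine Finset.sum_congr rfl fun a _ => Finset.sum_congr rfl fun b _ => ?_
  rw [mul_assoc, mul_assoc, (hc _ _ _ _).eq, update_comm hkl]

lemma twoSite_commute_twoSite {i j k l : Fin N} (hij : i ≠ j) (hkl : k ≠ l) (hik : i ≠ k)
    (hil : i ≠ l) (hjk : j ≠ k) (hjl : j ≠ l)
    (M M' : Matrix (Fin N × Fin N) (Fin N × Fin N) A)
    (hc : ∀ a b c d, Commute (M a b) (M' c d)) :
    Commute (twoSite i j M) (twoSite k l M') := by
  refine matrix_ext_vecMul fun φ => ?_
  ext h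
  rw [← vecMul_vecMul, ← vecMul_vecMul]
  simp only [vecMul_twoSite _ hij, vecMul_twoSite _ hkl, ne_eq, hik, hil, hjk, hjl,
    hik.symm, hil.symm, hjk.symm, hjl.symm, not_false_eq_true, update_of_ne,
    Finset.sum_mul]
  have e (Φ : Fin N → Fin N → Fin N → Fin N → A) :
      ∑ a, ∑ b, ∑ c, ∑ d, Φ a b c d = ∑ c, ∑ d, ∑ a, ∑ b, Φ a b c d := by
    calc _ = ∑ a, ∑ c, ∑ b, ∑ d, Φ a b c d :=
          Finset.sum_congr rfl fun a _ => Finset.sum_comm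
      _ = ∑ c, ∑ a, ∑ b, ∑ d, Φ a b c d := Finset.sum_comm
      _ = ∑ c, ∑ a, ∑ d, ∑ b, Φ a b c d :=
          Finset.sum_congr rfl fun c _ => Finset.sum_congr rfl fun a _ => Finset.sum_comm
      _ = _ := Finset.sum_congr rfl fun c _ => Finset.sum_comm
  rw [e]
  refine Finset.sum_congr rfl fun c _ => Finset.sum_congr rfl fun d _ =>
    Finset.sum_congr rfl fun a _ => Finset.sum_congr rfl fun b _ => ?_
  rw [mul_assoc, mul_assoc, (hc _ _ _ _).eq]
  rw [update_comm hil.symm, update_comm hik.symm, update_comm hjl.symm, update_comm hjk.symm]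

end SiteOperators

/-! ### Words and `q`-alternating functions -/

section Words

open Function

variable {N : ℕ}

/-- The number of inversions of a word. -/
def wordInv (f : Fin N → Fin N) : ℕ :=
  (Finset.univ.filter fun p : Fin N × Fin N => p.1 < p.2 ∧ f p.2 < f p.1).card

lemma invCount_eq_wordInv (σ : Equiv.Perm (Fin N)) : invCount σ = wordInv σ := rfl

lemma wordInv_comp_swap {i j : Fin N} (hij : i.val + 1 = j.val) {f : Fin N → Fin N}
    (hf : f i < f j) : wordInv (f ∘ Equiv.swap i j) = wordInv f + 1 := by
  have hne : i ≠ j := by rintro rfl; omega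
  have hs : Injective (Prod.map (Equiv.swap i j) (Equiv.swap i j)) :=
    (Equiv.injective _).prodMap (Equiv.injective _)
  unfold wordInv
  rw [← Finset.card_image_of_injective (Finset.univ.filter fun p : Fin N × Fin N =>
    p.1 < p.2 ∧ f p.2 < f p.1) hs, ← Finset.card_insert_of_notMem (a := (i, j))]
  · congr 1
    ext ⟨a, b⟩
    simp only [Finset.mem_filter, Finset.mem_univ, true_and, comp_apply, Finset.mem_insert,
      Finset.mem_image, Prod.map_apply, Prod.mk.injEq, Prod.exists]
    constructor
    · rintro ⟨h1, h2⟩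
      by_cases hab : a = i ∧ b = j
      · exact Or.inl hab
      · refine Or.inr ⟨Equiv.swap i j a, Equiv.swap i j b, ⟨?_, h2⟩, by simp, by simp⟩
        rw [Equiv.swap_apply_def, Equiv.swap_apply_def]
        simp only [Fin.ext_iff, Fin.lt_def] at *
        split_ifs <;> omega
    · rintro (⟨rfl, rfl⟩ | ⟨a', b', ⟨h1, h2⟩, rfl, rfl⟩)
      · refine ⟨by simp only [Fin.lt_def]; omega, by simpa using hf⟩
      · refine ⟨?_, by simpa using h2⟩
        by_cases hab : a' = i ∧ b' = j
        · obtain ⟨rfl, rfl⟩ := hab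
          exact absurd h2 (not_lt.2 hf.le)
        · rw [Equiv.swap_apply_def, Equiv.swap_apply_def]
          simp only [Fin.ext_iff, Fin.lt_def] at *
          split_ifs <;> omega
  · simp only [Finset.mem_image, Finset.mem_filter, Finset.mem_univ, true_and, Prod.exists,
      Prod.map_apply, Prod.mk.injEq, not_exists, not_and]
    rintro a b ⟨h1, h2⟩ h3 h4
    have ha : a = j := by rw [← Equiv.swap_apply_self i j a, h3]; simp
    have hb : b = i := by rw [← Equiv.swap_apply_self i j b, h4]; simp
    subst ha hb
    simp only [Fin.lt_def] at h1
    omega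

lemma wordInv_id : wordInv (id : Fin N → Fin N) = 0 := by
  unfold wordInv
  rw [Finset.card_eq_zero, Finset.filter_eq_empty_iff]
  rintro ⟨a, b⟩ - ⟨h1, h2⟩
  exact lt_asymm h1 h2

lemma comp_swap_comp_swap (i j : Fin N) (h : Fin N → Fin N) :
    (h ∘ Equiv.swap i j) ∘ Equiv.swap i j = h := by
  ext; simp

lemma eq_id_of_forall_adjacent_lt {h : Fin N → Fin N}
    (H : ∀ i j : Fin N, i.val + 1 = j.val → h i < h j) : h = id := by
  have hm : StrictMono h := by
    have : ∀ d : ℕ, ∀ i j : Fin N, i.val + 1 + d = j.val → h i < h j := by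
      intro d
      induction d with
      | zero => exact fun i j hij => H i j hij
      | succ d ih =>
        intro i j hij
        have := j.isLt
        exact (ih i ⟨i.val + 1 + d, by omega⟩ rfl).trans (H _ _ (by simp only; omega))
    intro i j hij
    exact this (j.val - (i.val + 1)) i j (by simp only [Fin.lt_def] at hij; omega)
  refine (hm.range_inj strictMono_id).1 ?_
  rw [(Finite.surjective_of_injective hm.injective).range_eq, Set.range_id]

variable {F V : Type} [Field F] [AddCommGroup V] [Module F V]

/-- `φ` is `q`-alternating in the letters at the sites `i` and `j`. -/
def QAlt (q : F) (i j : Fin N) (φ : (Fin N → Fin N) → V) : Prop :=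
  ∀ h, (h i = h j → φ h = 0) ∧ (h i < h j → φ (h ∘ Equiv.swap i j) = (-q)⁻¹ • φ h)

/-- The `q`-sign of a word: zero if it has a repeated letter. -/
def qSign (q : F) (h : Fin N → Fin N) : F :=
  open Classical in if Injective h then (-q)⁻¹ ^ wordInv h else 0

lemma qSign_of_injective (q : F) {h : Fin N → Fin N} (hh : Injective h) :
    qSign q h = (-q)⁻¹ ^ wordInv h := if_pos hh

lemma qSign_of_not_injective (q : F) {h : Fin N → Fin N} (hh : ¬ Injective h) :
    qSign q h = 0 := if_neg hh

lemma qSign_id (q : F) : qSign q (id : Fin N → Fin N) = 1 := by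
  rw [qSign_of_injective q injective_id, wordInv_id, pow_zero]

lemma qSign_ne_zero {q : F} (hq : q ≠ 0) {h : Fin N → Fin N} (hh : Injective h) :
    qSign q h ≠ 0 := by
  rw [qSign_of_injective q hh]
  exact pow_ne_zero _ (inv_ne_zero (neg_ne_zero.2 hq))

lemma qAlt_qSign (q : F) {i j : Fin N} (hij : i.val + 1 = j.val) :
    QAlt q i j (qSign q) := by
  have hne : i ≠ j := by rintro rfl; omega
  intro h
  refine ⟨fun he => qSign_of_not_injective q fun hi => hne (hi he), fun hlt => ?_⟩
  by_cases hi : Injective h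
  · rw [qSign_of_injective q hi, qSign_of_injective q (hi.comp (Equiv.injective _)),
      wordInv_comp_swap hij hlt, pow_succ', smul_eq_mul]
  · rw [qSign_of_not_injective q hi, qSign_of_not_injective, smul_zero]
    intro hc
    apply hi
    have := hc.comp (Equiv.swap i j).injective
    rwa [comp_swap_comp_swap] at this

lemma QAlt.sub {q : F} {i j : Fin N} {φ ψ : (Fin N → Fin N) → V} (hφ : QAlt q i j φ)
    (hψ : QAlt q i j ψ) : QAlt q i j (φ - ψ) := fun h =>
  ⟨fun e => by simp [(hφ h).1 e, (hψ h).1 e],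
   fun e => by simp [(hφ h).2 e, (hψ h).2 e, smul_sub]⟩

lemma QAlt.swap_eq_zero {q : F} (hq : q ≠ 0) {i j : Fin N} {φ : (Fin N → Fin N) → V}
    (hφ : QAlt q i j φ) {h : Fin N → Fin N} (h0 : φ (h ∘ Equiv.swap i j) = 0) : φ h = 0 := by
  rcases lt_trichotomy (h i) (h j) with hlt | he | hgt
  · have := (hφ h).2 hlt
    rw [h0] at this
    exact (smul_eq_zero.1 this.symm).resolve_left (inv_ne_zero (neg_ne_zero.2 hq))
  · exact (hφ h).1 he
  · have := (hφ (h ∘ Equiv.swap i j)).2 (by simpa using hgt)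
    rw [comp_swap_comp_swap, h0, smul_zero] at this
    exact this

/-- A function that is `q`-alternating in the sites `≥ s` vanishes on words with two equal
letters at such sites. -/
lemma QAlt.eq_zero_of_eq {q : F} (hq : q ≠ 0) {s : ℕ} {φ : (Fin N → Fin N) → V}
    (hφ : ∀ i j : Fin N, s ≤ i.val → i.val + 1 = j.val → QAlt q i j φ) (d : ℕ) :
    ∀ (h : Fin N → Fin N) (a b : Fin N), s ≤ a.val → a.val + 1 + d = b.val → h a = h b →
      φ h = 0 := by
  induction d with
  | zero => exact fun h a b ha hab he => (hφ a b ha hab h).1 he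
  | succ d ih =>
    intro h a b ha hab he
    have hb := b.isLt
    have hab' : (⟨a.val + 1 + d, by omega⟩ : Fin N).val + 1 = b.val := by simp only; omega
    refine (hφ ⟨a.val + 1 + d, by omega⟩ b (by simp only; omega) hab').swap_eq_zero hq ?_
    refine ih _ a ⟨a.val + 1 + d, by omega⟩ ha rfl ?_
    rw [comp_apply, comp_apply, Equiv.swap_apply_left, Equiv.swap_apply_of_ne_of_ne, he]
    · simp only [ne_eq, Fin.ext_iff]; omega
    · simp only [ne_eq, Fin.ext_iff]; omega

/-- A `q`-alternating function is a multiple of the `q`-sign. -/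
lemma eq_qSign_smul {q : F} {φ : (Fin N → Fin N) → V}
    (hφ : ∀ i j : Fin N, i.val + 1 = j.val → QAlt q i j φ) (h : Fin N → Fin N) :
    φ h = qSign q h • φ id := by
  induction hn : wordInv h using Nat.strong_induction_on generalizing h with
  | _ n ih =>
    by_cases H : ∀ i j : Fin N, i.val + 1 = j.val → h i < h j
    · rw [eq_id_of_forall_adjacent_lt H, qSign_id, one_smul]
    · push Not at H
      obtain ⟨i, j, hij, hle⟩ := H
      have hne : i ≠ j := by rintro rfl; omega
      rcases hle.eq_or_lt with he | hlt
      · rw [((hφ i j hij) h).1 he.symm, qSign_of_not_injective q fun hi => hne (hi he.symm),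
          zero_smul]
      · have hlt' : (h ∘ Equiv.swap i j) i < (h ∘ Equiv.swap i j) j := by simpa using hlt
        have e1 := (hφ i j hij _).2 hlt'
        have e2 := (qAlt_qSign q hij _).2 hlt'
        have e3 := wordInv_comp_swap hij hlt'
        rw [comp_swap_comp_swap] at e1 e2 e3
        rw [e1, e2, ih _ (by omega) _ rfl, smul_assoc]

end Words

section QAntisymmetrizer

open Function

variable {N : ℕ} {F : Type} [Field F]

lemma sign_smul_Pq_id {q : F} {Pq : Equiv.Perm (Fin N) →
      Matrix (Fin N → Fin N) (Fin N → Fin N) F} (hP : PqExt F q N N Pq)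
    (σ : Equiv.Perm (Fin N)) (g : Fin N → Fin N) :
    ((Equiv.Perm.sign σ : ℤ) : F) * Pq σ id g = if (σ : Fin N → Fin N) = g then
      (-q)⁻¹ ^ wordInv σ else 0 := by
  induction hn : wordInv σ using Nat.strong_induction_on generalizing σ g with
  | _ n ih =>
    by_cases H : ∀ i j : Fin N, i.val + 1 = j.val → σ i < σ j
    · obtain rfl : σ = 1 := by
        ext x
        rw [eq_id_of_forall_adjacent_lt H]; rfl
      rw [hP.1, ← hn]
      simp only [Equiv.Perm.sign_one, Units.val_one, Int.cast_one, one_mul,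
        Equiv.Perm.coe_one, wordInv_id, pow_zero, Matrix.one_apply]
    · push Not at H
      obtain ⟨i, j, hij, hle⟩ := H
      have hne : i ≠ j := by rintro rfl; omega
      have hlt : σ j < σ i := lt_of_le_of_ne hle fun e => hne (σ.injective e.symm)
      set τ := σ * Equiv.swap i j with hτ
      have hστ : σ = τ * Equiv.swap i j := by simp [hτ]
      have hcomp : (σ : Fin N → Fin N) = (τ : Fin N → Fin N) ∘ Equiv.swap i j := by
        rw [hστ]; rfl
      have hlt' : τ i < τ j := by simpa [hτ] using hlt
      have hinv : wordInv σ = wordInv τ + 1 := by rw [hcomp, wordInv_comp_swap hij hlt']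
      have hlN : i.val + 1 < N := hij ▸ j.isLt
      have hi : i = ⟨i.val, Nat.lt_of_succ_lt hlN⟩ := rfl
      have hj : j = ⟨i.val + 1, hlN⟩ := Fin.ext hij.symm
      have hstep := hP.2 τ i.val hlN
      rw [← hj, ← hi, ← hστ] at hstep
      rw [hstep (by rw [invCount_eq_wordInv, invCount_eq_wordInv, hinv]), hστ,
        Equiv.Perm.sign_mul, Equiv.Perm.sign_swap hne, Matrix.mul_apply]
      have e1 : ∀ x, Pq τ id x = ((Equiv.Perm.sign τ : ℤ) : F) *
          (if (τ : Fin N → Fin N) = x then (-q)⁻¹ ^ wordInv τ else 0) := by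
        intro x
        rw [← ih _ (by omega) τ x rfl, ← mul_assoc, ← Int.cast_mul, ← Units.val_mul,
          Int.units_mul_self]
        simp
      simp only [e1, mul_ite, mul_zero, ite_mul, zero_mul, Finset.sum_ite_eq,
        Finset.mem_univ, if_true]
      have e2 : big2 F i j (PqSmall F q N) (τ : Fin N → Fin N) g =
          if (σ : Fin N → Fin N) = g then q⁻¹ else 0 := by
        have hnlt : ¬ τ j < τ i := not_lt.2 hlt'.le
        simp only [big2, PqSmall, Matrix.of_apply, hlt'.ne, hnlt, if_false]
        rw [← ite_and]
        refine if_congr ?_ rfl rfl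
        rw [hcomp]
        constructor
        · rintro ⟨h1, h2, h3⟩
          ext x
          by_cases hxi : x = i
          · subst hxi; simp [h2]
          · by_cases hxj : x = j
            · subst hxj; simp [h3]
            · simp [Equiv.swap_apply_of_ne_of_ne hxi hxj, h1 x hxi hxj]
        · rintro rfl
          refine ⟨fun x hxi hxj => ?_, by simp, by simp⟩
          simp [Equiv.swap_apply_of_ne_of_ne hxi hxj]
      rw [e2, ← hστ]
      split_ifs with hg
      · rw [← hn, hinv, pow_succ]
        have : ((Equiv.Perm.sign τ : ℤ) : F) * ((Equiv.Perm.sign τ : ℤ) : F) = 1 := by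
          rw [← Int.cast_mul, ← Units.val_mul, Int.units_mul_self]
          simp
        rw [Units.val_mul, Int.cast_mul]
        simp only [Units.val_neg, Units.val_one, Int.cast_neg, Int.cast_one]
        rw [inv_neg]
        linear_combination (-q⁻¹ * (-q⁻¹) ^ wordInv (τ : Fin N → Fin N)) * this
      · simp

lemma AqM_id_apply {q : F} {Pq : Equiv.Perm (Fin N) →
      Matrix (Fin N → Fin N) (Fin N → Fin N) F} (hP : PqExt F q N N Pq)
    (g : Fin N → Fin N) : AqM F Pq id g = qSign q g := by
  simp only [AqM, Matrix.sum_apply, Matrix.smul_apply, smul_eq_mul, sign_smul_Pq_id hP]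
  by_cases hg : Injective g
  · rw [qSign_of_injective q hg, Finset.sum_eq_single
      (Equiv.ofBijective g (Finite.injective_iff_bijective.1 hg))]
    · simp
    · intro σ _ hσ
      rw [if_neg]
      rintro rfl
      exact hσ (by ext; simp)
    · simp
  · rw [qSign_of_not_injective q hg]
    refine Finset.sum_eq_zero fun σ _ => if_neg ?_
    rintro rfl
    exact hg σ.injective

end QAntisymmetrizer

/-! ### Ordered products over pairs -/

section PairProducts

variable {α M : Type} [Monoid M]

/-- The product `∏_i c_i ∏_{j after i} R_ij` over a list of indices. -/
def pairProd (c : α → M) (R : α → α → M) : List α → M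
  | [] => 1
  | i :: t => c i * (t.map (R i)).prod * pairProd c R t

lemma commute_list_map_prod {β : Type} {x : M} {f : β → M} {l : List β}
    (h : ∀ b ∈ l, Commute x (f b)) : Commute x (l.map f).prod :=
  Commute.list_prod_right _ _ fun y hy => by
    obtain ⟨b, hb, rfl⟩ := List.mem_map.1 hy
    exact h b hb

lemma commute_pairProd {x : M} {c : α → M} {R : α → α → M} {l : List α} (hl : l.Nodup)
    (hc : ∀ i ∈ l, Commute x (c i))
    (hR : ∀ i ∈ l, ∀ j ∈ l, i ≠ j → Commute x (R i j)) : Commute x (pairProd c R l) := by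
  induction l with
  | nil => exact Commute.one_right x
  | cons i t ih =>
    rw [List.nodup_cons] at hl
    refine ((hc i (by simp)).mul_right (commute_list_map_prod fun j hj => ?_)).mul_right
      (ih hl.2 (fun k hk => hc k (by simp [hk])) fun a ha b hb => hR a (by simp [ha]) b
        (by simp [hb]))
    exact hR i (by simp) j (by simp [hj]) fun e => hl.1 (e ▸ hj)

lemma pairProd_concat {R : α → α → M}
    (hR : ∀ i j k l, i ≠ j → k ≠ l → i ≠ k → i ≠ l → j ≠ k → j ≠ l →
      Commute (R i j) (R k l)) (t : List α) (j : α) (hl : (t ++ [j]).Nodup) :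
    pairProd (fun _ => 1) R (t ++ [j]) =
      pairProd (fun _ => 1) R t * (t.map fun i => R i j).prod := by
  induction t with
  | nil => simp [pairProd]
  | cons i t ih =>
    simp only [List.cons_append, List.nodup_cons, List.mem_append, List.mem_singleton,
      not_or] at hl
    simp only [List.cons_append, pairProd, List.map_append, List.map_cons, List.map_nil,
      List.prod_append, List.prod_cons, List.prod_nil, mul_one, one_mul, ih hl.2]
    have hjt : j ∉ t := fun h => by
      have := List.nodup_append.1 hl.2
      exact this.2.2 j h j (by simp) rfl
    have hc : Commute (R i j) (pairProd (fun _ => 1) R t) := by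
      refine commute_pairProd (List.nodup_append.1 hl.2).1 (fun _ _ => Commute.one_right _)
        fun a ha b hb hab => hR i j a b hl.1.2 hab ?_ ?_ ?_ ?_
      · rintro rfl; exact hl.1.1 ha
      · rintro rfl; exact hl.1.1 hb
      · rintro rfl; exact hjt ha
      · rintro rfl; exact hjt hb
    simp only [mul_assoc]
    rw [← mul_assoc (R i j), hc.eq, mul_assoc]

lemma prod_mul_exchange_one {R : α → α → M} {y : α → M} (i : α) (t : List α)
    (hl : (i :: t).Nodup)
    (hR : ∀ i j, i ≠ j → R i j * y i * y j = y j * y i * R i j)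
    (hc : ∀ k i j, i ≠ j → k ≠ i → k ≠ j → Commute (y k) (R i j)) :
    (t.map (R i)).prod * y i * (t.reverse.map y).prod =
      (t.reverse.map y).prod * y i * (t.map (R i)).prod := by
  induction t with
  | nil => simp
  | cons j t ih =>
    simp only [List.nodup_cons, List.mem_cons, not_or] at hl
    have ih' := ih (List.nodup_cons.2 ⟨hl.1.2, hl.2.2⟩)
    simp only [List.reverse_cons, List.map_append, List.map_cons, List.map_nil,
      List.prod_append, List.prod_cons, List.prod_nil, mul_one]
    have h1 : Commute (R i j) (t.reverse.map y).prod := by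
      refine commute_list_map_prod fun k hk => (hc k i j hl.1.1 ?_ ?_).symm
      · rintro rfl; exact hl.1.2 (List.mem_reverse.1 hk)
      · rintro rfl; exact hl.2.1 (List.mem_reverse.1 hk)
    have h2 : Commute (y j) (t.map (R i)).prod := by
      refine commute_list_map_prod fun k hk => hc j i k ?_ (Ne.symm hl.1.1) ?_
      · rintro rfl; exact hl.1.2 hk
      · rintro rfl; exact hl.2.1 hk
    calc _ = R i j * ((t.map (R i)).prod * y i * (t.reverse.map y).prod) * y j := by
          simp only [mul_assoc]
      _ = (R i j * (t.reverse.map y).prod) * y i * ((t.map (R i)).prod * y j) := by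
          rw [ih']; simp only [mul_assoc]
      _ = (t.reverse.map y).prod * (R i j * y i * y j) * (t.map (R i)).prod := by
          rw [h1.eq, ← h2.eq]; simp only [mul_assoc]
      _ = _ := by rw [hR i j hl.1.1]; simp only [mul_assoc]

lemma pairProd_mul_exchange {R : α → α → M} {y : α → M} (l : List α) (hl : l.Nodup)
    (hR : ∀ i j, i ≠ j → R i j * y i * y j = y j * y i * R i j)
    (hc : ∀ k i j, i ≠ j → k ≠ i → k ≠ j → Commute (y k) (R i j)) :
    pairProd (fun _ => 1) R l * (l.map y).prod =
      (l.reverse.map y).prod * pairProd (fun _ => 1) R l := by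
  induction l with
  | nil => simp [pairProd]
  | cons i t ih =>
    have hl' := List.nodup_cons.1 hl
    simp only [pairProd, List.map_cons, List.prod_cons, one_mul, List.reverse_cons,
      List.map_append, List.map_nil, List.prod_append, List.prod_nil, mul_one]
    have h1 : Commute (y i) (pairProd (fun _ => 1) R t) := by
      refine commute_pairProd hl'.2 (fun _ _ => Commute.one_right _) fun a ha b hb hab =>
        hc i a b hab ?_ ?_
      · rintro rfl; exact hl'.1 ha
      · rintro rfl; exact hl'.1 hb
    calc _ = (t.map (R i)).prod * (pairProd (fun _ => 1) R t * y i) * (t.map y).prod := by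
          simp only [mul_assoc]
      _ = (t.map (R i)).prod * y i * (pairProd (fun _ => 1) R t * (t.map y).prod) := by
          rw [← h1.eq]; simp only [mul_assoc]
      _ = ((t.map (R i)).prod * y i * (t.reverse.map y).prod) *
            pairProd (fun _ => 1) R t := by
          rw [ih hl'.2]; simp only [mul_assoc]
      _ = _ := by rw [prod_mul_exchange_one i t hl hR hc]; simp only [mul_assoc]

lemma mul_prod_mul_prod_exchange {R : α → α → M} {T Tb : α → M} (i : α) (t : List α)
    (hl : (i :: t).Nodup)
    (hR : ∀ i j, i ≠ j → Tb i * R i j * T j = T j * R i j * Tb i)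
    (hT : ∀ k i j, i ≠ j → k ≠ i → k ≠ j → Commute (T k) (R i j)) :
    Tb i * (t.map (R i)).prod * (t.map T).prod =
      (t.map T).prod * (t.map (R i)).prod * Tb i := by
  induction t with
  | nil => simp
  | cons j t ih =>
    simp only [List.nodup_cons, List.mem_cons, not_or] at hl
    have ih' := ih (List.nodup_cons.2 ⟨hl.1.2, hl.2.2⟩)
    simp only [List.map_cons, List.prod_cons]
    have h1 : Commute (R i j) (t.map T).prod := by
      refine commute_list_map_prod fun k hk => (hT k i j hl.1.1 ?_ ?_).symm
      · rintro rfl; exact hl.1.2 hk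
      · rintro rfl; exact hl.2.1 hk
    have h2 : Commute (T j) (t.map (R i)).prod := by
      refine commute_list_map_prod fun k hk => hT j i k ?_ (Ne.symm hl.1.1) ?_
      · rintro rfl; exact hl.1.2 hk
      · rintro rfl; exact hl.2.1 hk
    calc _ = Tb i * R i j * ((t.map (R i)).prod * T j) * (t.map T).prod := by
          simp only [mul_assoc]
      _ = (Tb i * R i j * T j) * ((t.map (R i)).prod * (t.map T).prod) := by
          rw [← h2.eq]; simp only [mul_assoc]
      _ = T j * R i j * (Tb i * (t.map (R i)).prod * (t.map T).prod) := by
          rw [hR i j hl.1.1]; simp only [mul_assoc]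
      _ = T j * (R i j * (t.map T).prod) * (t.map (R i)).prod * Tb i := by
          rw [ih']; simp only [mul_assoc]
      _ = _ := by rw [h1.eq]; simp only [mul_assoc]

lemma pairProd_factor {R : α → α → M} {T Tb G : α → M} (l : List α) (hl : l.Nodup)
    (hR : ∀ i j, i ≠ j → Tb i * R i j * T j = T j * R i j * Tb i)
    (hT : ∀ k i j, i ≠ j → k ≠ i → k ≠ j → Commute (T k) (R i j))
    (hTb : ∀ k i j, i ≠ j → k ≠ i → k ≠ j → Commute (Tb k) (R i j))
    (hGT : ∀ i j, i ≠ j → Commute (G i) (T j))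
    (hGTb : ∀ i j, i ≠ j → Commute (Tb i) (G j)) :
    pairProd (fun i => T i * G i * Tb i) R l =
      (l.map T).prod * pairProd G R l * (l.map Tb).prod := by
  induction l with
  | nil => simp [pairProd]
  | cons i t ih =>
    have hl' := List.nodup_cons.1 hl
    have hne : ∀ j ∈ t, i ≠ j := by
      rintro j hj rfl; exact hl'.1 hj
    have h1 : Commute (G i) (t.map T).prod :=
      commute_list_map_prod fun j hj => hGT i j (hne j hj)
    have h2 : Commute (Tb i) (pairProd G R t) :=
      commute_pairProd hl'.2 (fun j hj => hGTb i j (hne j hj)) fun a ha b hb hab =>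
        hTb i a b hab (hne a ha) (hne b hb)
    simp only [pairProd, List.map_cons, List.prod_cons, ih hl'.2]
    calc _ = T i * G i * (Tb i * (t.map (R i)).prod * (t.map T).prod) * pairProd G R t *
            (t.map Tb).prod := by simp only [mul_assoc]
      _ = T i * (G i * (t.map T).prod) * (t.map (R i)).prod * (Tb i * pairProd G R t) *
            (t.map Tb).prod := by
          rw [mul_prod_mul_prod_exchange i t hl hR hT]; simp only [mul_assoc]
      _ = _ := by rw [h1.eq, h2.eq]; simp only [mul_assoc]

lemma map_pairProd {M' : Type} [Monoid M'] (f : M →* M') (c : α → M) (R : α → α → M)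
    (l : List α) :
    f (pairProd c R l) = pairProd (fun i => f (c i)) (fun i j => f (R i j)) l := by
  induction l with
  | nil => simp [pairProd]
  | cons i t ih =>
    simp only [pairProd, map_mul, ih, map_list_prod, List.map_map]
    rfl

/-- The ordered list of factors of `pairProd` over `Fin N`. -/
lemma flatMap_finRange_prod {N : ℕ} (c : Fin N → M) (R : Fin N → Fin N → M) :
    ((List.finRange N).flatMap fun i =>
      c i :: (((List.finRange N).filter fun j => i < j).map fun j => R i j)).prod =
      pairProd c R (List.finRange N) := by
  have key : ∀ (l pre : List (Fin N)), (pre ++ l).Pairwise (· < ·) →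
      (l.flatMap fun i =>
        c i :: (((pre ++ l).filter fun j => i < j).map fun j => R i j)).prod =
        pairProd c R l := by
    intro l
    induction l with
    | nil => simp [pairProd]
    | cons i t ih =>
      intro pre hp
      have hp' := hp
      rw [List.pairwise_append, List.pairwise_cons] at hp'
      obtain ⟨-, ⟨h2, -⟩, h3⟩ := hp'
      have e : (pre ++ i :: t).filter (fun j => i < j) = t := by
        rw [List.filter_append, List.filter_cons_of_neg (by simp),
          List.filter_eq_nil_iff.2, List.filter_eq_self.2, List.nil_append]
        · exact fun a ha => by simpa using h2 a ha
        · exact fun a ha => by simpa using (h3 a ha i (by simp)).le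
      have := ih (pre ++ [i]) (by simpa using hp)
      simp only [List.append_assoc, List.singleton_append] at this
      rw [List.flatMap_cons, List.prod_append, this, e, List.prod_cons]
      rfl
  simpa using key (List.finRange N) [] (by simpa using List.pairwise_lt_finRange N)

end PairProducts

/-! ### The `R`-matrix product and its antisymmetry -/

section RProduct

open Function Matrix

variable {N : ℕ} {F : Type} [Field F]

/-- The normalized `R`-matrix `R(u,v)/v` with `w = u/v`. -/
def rhoMat (q w : F) (N : ℕ) : Matrix (Fin N × Fin N) (Fin N × Fin N) F :=
  w • Rtil F q N - Rc F q N

lemma rhoMat_apply (q w : F) (a b c d : Fin N) :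
    rhoMat q w N (a, b) (c, d) =
      (if a = c then if b = d then (if c = d then q⁻¹ * w - q else w - 1) else 0 else 0) +
      (if a = d then if b = c then
        (q⁻¹ - q) * (if c < d then w else if d < c then 1 else 0) else 0 else 0) := by
  simp only [rhoMat, Rtil, Rc, Matrix.sub_apply, Matrix.smul_apply, Matrix.of_apply,
    Prod.mk.injEq, smul_eq_mul]
  by_cases h1 : a = c
  · subst h1
    by_cases h2 : b = d
    · subst h2
      rcases lt_trichotomy a b with h | rfl | h
      · simp [h.ne, h.ne']
      · simp; ring
      · simp [h.ne, h.ne']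
    · by_cases h3 : a = d
      · subst h3; simp [h2]
      · simp [h2, h3]
  · by_cases h2 : a = d
    · subst h2
      by_cases h4 : b = c
      · subst h4
        rcases lt_trichotomy a b with h | rfl | h
        · simp [h.ne, h.ne', h, h.not_gt]; try ring
        · exact absurd rfl h1
        · simp [h.ne, h.ne', h, h.not_gt]; ring
      · simp [h4, h1]
    · simp [h1, h2]

lemma update_update_eq_comp_swap {i j : Fin N} (hij : i ≠ j) (h : Fin N → Fin N) :
    update (update h i (h j)) j (h i) = h ∘ Equiv.swap i j := by
  ext x
  by_cases hj : x = j
  · subst hj; simp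
  · by_cases hi : x = i
    · subst hi; simp [hij]
    · simp [hi, hj, Equiv.swap_apply_of_ne_of_ne]

lemma vecMul_rhoMat (q w : F) (φ : (Fin N → Fin N) → F) {i j : Fin N} (hij : i ≠ j)
    (h : Fin N → Fin N) :
    (φ ᵥ* twoSite i j (rhoMat q w N)) h =
      if h i = h j then (q⁻¹ * w - q) * φ h
      else (w - 1) * φ h +
        (q⁻¹ - q) * (if h i < h j then w else 1) * φ (h ∘ Equiv.swap i j) := by
  rw [vecMul_twoSite _ hij]
  simp only [rhoMat_apply, mul_add, mul_ite, mul_zero, Finset.sum_add_distrib,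
    Finset.sum_ite_eq', Finset.mem_univ, if_true, Finset.sum_ite_irrel,
    Finset.sum_const_zero, update_eq_self, update_update_eq_comp_swap hij]
  rcases lt_trichotomy (h i) (h j) with hl | hl | hl
  · simp only [hl, hl.ne, if_true, if_false]; ring
  · simp only [hl, lt_irrefl, if_true, if_false]; ring
  · simp only [hl, hl.ne', hl.not_gt, if_true, if_false]; ring

variable {q : F} (hq : q ≠ 0)

include hq in
lemma qAlt_vecMul_rhoMat (φ : (Fin N → Fin N) → F) {i j : Fin N} (hij : i ≠ j) :
    QAlt q i j (φ ᵥ* twoSite i j (rhoMat q (q ^ 2) N)) := by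
  intro h
  refine ⟨fun he => ?_, fun hlt => ?_⟩
  · rw [vecMul_rhoMat _ _ _ hij, if_pos he]
    field_simp; ring
  · rw [vecMul_rhoMat _ _ _ hij, vecMul_rhoMat _ _ _ hij, comp_swap_comp_swap]
    simp only [Function.comp_apply, Equiv.swap_apply_left, Equiv.swap_apply_right, hlt, hlt.ne,
      hlt.ne', hlt.not_gt, if_true, if_false, smul_eq_mul]
    field_simp; ring

lemma QAlt.vecMul_twoSite {A : Type} [Ring A] [Algebra F A] {φ : (Fin N → Fin N) → A}
    {k k' i j : Fin N} (hij : i ≠ j)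
    (hki : k ≠ i) (hkj : k ≠ j) (hki' : k' ≠ i) (hkj' : k' ≠ j)
    (M : Matrix (Fin N × Fin N) (Fin N × Fin N) A) (hφ : QAlt q k k' φ) :
    QAlt q k k' (φ ᵥ* twoSite i j M) := by
  intro h
  refine ⟨fun he => ?_, fun hlt => ?_⟩
  · rw [_root_.vecMul_twoSite _ hij]
    refine Finset.sum_eq_zero fun a _ => Finset.sum_eq_zero fun b _ => ?_
    rw [(hφ _).1 (by simp [hki, hkj, hki', hkj', he]), zero_mul]
  · rw [_root_.vecMul_twoSite _ hij, _root_.vecMul_twoSite _ hij, Finset.smul_sum]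
    refine Finset.sum_congr rfl fun a _ => ?_
    rw [Finset.smul_sum]
    refine Finset.sum_congr rfl fun b _ => ?_
    have e : update (update (h ∘ Equiv.swap k k') i a) j b =
        update (update h i a) j b ∘ Equiv.swap k k' := by
      ext x
      by_cases hxk : x = k
      · subst hxk; simp [hki, hkj, hki', hkj']
      · by_cases hxk' : x = k'
        · subst hxk'; simp [hki, hkj, hki', hkj']
        · simp only [Function.comp_apply, Equiv.swap_apply_of_ne_of_ne hxk hxk', update_apply]
    rw [e, (hφ _).2 (by simpa [hki, hkj, hki', hkj'] using hlt)]
    simp [Equiv.swap_apply_of_ne_of_ne hki.symm hki'.symm,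
      Equiv.swap_apply_of_ne_of_ne hkj.symm hkj'.symm]

include hq in
/-- The fusion property: multiplication by `R_{km} R_{k'm}` at spectral parameters in the
ratio `q²` preserves `q`-alternation. -/
lemma QAlt.vecMul_rhoMat_rhoMat (w : F) {φ : (Fin N → Fin N) → F} {k k' m : Fin N}
    (hkk : k ≠ k') (hkm : k ≠ m) (hkm' : k' ≠ m) (hφ : QAlt q k k' φ) :
    QAlt q k k' (φ ᵥ* twoSite k m (rhoMat q (q ^ 2 * w) N) ᵥ*
      twoSite k' m (rhoMat q w N)) := by
  intro h
  set g : Fin N → Fin N → Fin N → F := fun x y z => φ (update (update (update h k x) k' y) m z)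
    with hg
  have hsw1 : ∀ x y z, update (update (update h k x) k' y) m z ∘ Equiv.swap k k' =
      update (update (update h k y) k' x) m z := by
    intro x y z; ext t
    by_cases h1 : t = k
    · subst h1; simp [hkk, hkm, hkm']
    · by_cases h2 : t = k'
      · subst h2; simp [hkk, hkm, hkm']
      · simp only [Function.comp_apply, Equiv.swap_apply_of_ne_of_ne h1 h2, update_apply, h1, h2,
          if_false]
  have hsw2 : ∀ x y z, update (update (update h k x) k' y) m z ∘ Equiv.swap k m =
      update (update (update h k z) k' y) m x := by
    intro x y z; ext t
    by_cases h1 : t = k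
    · subst h1; simp [hkk, hkm]
    · by_cases h2 : t = m
      · subst h2; simp [hkk, hkm]
      · simp only [Function.comp_apply, Equiv.swap_apply_of_ne_of_ne h1 h2, update_apply, h1, h2,
          if_false]
  have hsw3 : ∀ x y z, update (update (update h k x) k' y) m z ∘ Equiv.swap k' m =
      update (update (update h k x) k' z) m y := by
    intro x y z; ext t
    by_cases h1 : t = k'
    · subst h1; simp [hkm']
    · by_cases h2 : t = m
      · subst h2; simp [hkm']
      · simp only [Function.comp_apply, Equiv.swap_apply_of_ne_of_ne h1 h2, update_apply, h1, h2,
          if_false]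
  have hv : ∀ x y z, update (update (update h k x) k' y) m z k = x ∧
      update (update (update h k x) k' y) m z k' = y ∧
      update (update (update h k x) k' y) m z m = z := by
    intro x y z; simp [hkk, hkm, hkm']
  have hg0 : ∀ x z, g x x z = 0 := fun x z =>
    (hφ _).1 (by rw [(hv x x z).1, (hv x x z).2.1])
  have hg1 : ∀ x y z, x < y → g y x z = (-q)⁻¹ * g x y z := fun x y z hxy => by
    have := (hφ (update (update (update h k x) k' y) m z)).2
      (by rw [(hv x y z).1, (hv x y z).2.1]; exact hxy)
    rw [hsw1] at this
    exact this
  set G : Fin N → Fin N → Fin N → F := fun x y z =>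
    (φ ᵥ* twoSite k m (rhoMat q (q ^ 2 * w) N) ᵥ* twoSite k' m (rhoMat q w N))
      (update (update (update h k x) k' y) m z) with hG
  have hGf : ∀ x y z, G x y z =
      if y = z then (q⁻¹ * w - q) *
        (if x = z then (q⁻¹ * (q ^ 2 * w) - q) * g x y z
          else (q ^ 2 * w - 1) * g x y z + (q⁻¹ - q) * (if x < z then q ^ 2 * w else 1) *
            g z y x)
      else (w - 1) *
        (if x = z then (q⁻¹ * (q ^ 2 * w) - q) * g x y z
          else (q ^ 2 * w - 1) * g x y z + (q⁻¹ - q) * (if x < z then q ^ 2 * w else 1) *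
            g z y x) + (q⁻¹ - q) * (if y < z then w else 1) *
        (if x = y then (q⁻¹ * (q ^ 2 * w) - q) * g x z y
          else (q ^ 2 * w - 1) * g x z y + (q⁻¹ - q) * (if x < y then q ^ 2 * w else 1) *
            g y z x) := by
    intro x y z
    simp only [hG, hg]
    rw [vecMul_rhoMat _ _ _ hkm', hsw3, vecMul_rhoMat _ _ _ hkm, vecMul_rhoMat _ _ _ hkm,
      hsw2, hsw2]
    simp only [(hv _ _ _).1, (hv _ _ _).2.1, (hv _ _ _).2.2]
  have hh : h = update (update (update h k (h k)) k' (h k')) m (h m) := by simp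
  have hhs : h ∘ Equiv.swap k k' = update (update (update h k (h k')) k' (h k)) m (h m) := by
    rw [← hsw1, ← hh]
  constructor
  · intro he
    rw [hh]
    change G _ _ _ = 0
    rw [he, hGf]
    rcases lt_trichotomy (h k') (h m) with hl | hl | hl
    · simp only [hl, hl.ne, if_true, if_false, hg0, hg1 _ _ _ hl]
      field_simp; ring
    · simp [hl, hg0]
    · simp only [hl.ne', hl.not_gt, if_true, if_false, hg0, hg1 _ _ _ hl]
      field_simp; ring
  · intro hlt
    rw [hhs]
    conv_rhs => rw [hh]
    change G _ _ _ = (-q)⁻¹ • G _ _ _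
    generalize h k = x at *
    generalize h k' = y at *
    generalize h m = z at *
    rw [hGf, hGf, smul_eq_mul]
    rcases lt_trichotomy x z with h1 | rfl | h1
    · rcases lt_trichotomy y z with h2 | rfl | h2
      · simp only [hlt, hlt.ne, hlt.ne', hlt.not_gt, h1, h1.ne, h2, h2.ne, if_true, if_false,
          hg1 _ _ _ hlt, hg1 _ _ _ h1, hg1 _ _ _ h2]
        field_simp; ring
      · simp only [hlt, hlt.ne, hlt.ne', hlt.not_gt, if_true, if_false, hg1 _ _ _ hlt, hg0]
        field_simp; ring
      · simp only [hlt, hlt.ne, hlt.ne', hlt.not_gt, h1, h1.ne, h2.not_gt, h2.ne', if_true,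
          if_false, hg1 _ _ _ hlt, hg1 _ _ _ h1, hg1 _ _ _ h2]
        field_simp; ring
    · simp only [hlt, hlt.ne, hlt.ne', hlt.not_gt, if_true, if_false, hg1 _ _ _ hlt, hg0]
      field_simp; ring
    · have h2 := h1.trans hlt
      simp only [hlt, hlt.ne, hlt.ne', hlt.not_gt, h1.not_gt, h1.ne', h2.not_gt, h2.ne',
        if_true, if_false, hg1 _ _ _ hlt, hg1 _ _ _ h1, hg1 _ _ _ h2]
      field_simp; ring

end RProduct

section RProductAlternation

open Function Matrix

variable {N : ℕ} {F : Type} [Field F]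

/-- The normalized `R`-matrix `R(q^{-2i}u, q^{-2j}u)` acting at the sites `i` and `j`. -/
def rhoOp (q : F) (i j : Fin N) : Matrix (Fin N → Fin N) (Fin N → Fin N) F :=
  twoSite i j (rhoMat q (q ^ (2 * ((j.val : ℤ) - i.val))) N)

/-- The ordered product of all the `R`-matrices. -/
def rhoProd (q : F) (N : ℕ) : Matrix (Fin N → Fin N) (Fin N → Fin N) F :=
  pairProd (fun _ => 1) (rhoOp q) (List.finRange N)

lemma rhoOp_commute (q : F) (i j k l : Fin N) (hij : i ≠ j) (hkl : k ≠ l) (hik : i ≠ k)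
    (hil : i ≠ l) (hjk : j ≠ k) (hjl : j ≠ l) : Commute (rhoOp q i j) (rhoOp q k l) :=
  twoSite_commute_twoSite hij hkl hik hil hjk hjl _ _ fun _ _ _ _ => Commute.all _ _

lemma QAlt.vecMul_rhoOp_prod {q : F} {φ : (Fin N → Fin N) → F} {k k' : Fin N}
    (hφ : QAlt q k k' φ) (m : Fin N) (l : List (Fin N)) (hm : m ∉ l) (hkm : k ≠ m)
    (hkm' : k' ≠ m) (hk : k ∉ l) (hk' : k' ∉ l) :
    QAlt q k k' (φ ᵥ* (l.map fun j => rhoOp q j m).prod) := by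
  induction l generalizing φ with
  | nil => simpa using hφ
  | cons j l ih =>
    simp only [List.mem_cons, not_or] at hm hk hk'
    simp only [List.map_cons, List.prod_cons, ← vecMul_vecMul]
    exact ih (hφ.vecMul_twoSite (Ne.symm hm.1) hk.1 hkm hk'.1 hkm' _) hm.2 hk.2 hk'.2

variable {q : F} (hq : q ≠ 0)

include hq in
lemma qAlt_vecMul_pairProd_cons_cons {k k' : Fin N} (hkk : k.val + 1 = k'.val)
    (post : List (Fin N)) (hl : (k :: k' :: post).Nodup) (ψ : (Fin N → Fin N) → F) :
    QAlt q k k' (ψ ᵥ* pairProd (fun _ => 1) (rhoOp q) (k :: k' :: post)) := by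
  induction post using List.reverseRecOn with
  | nil =>
    have hne : k ≠ k' := by rintro rfl; omega
    have : (q ^ (2 * ((k'.val : ℤ) - k.val))) = q ^ 2 := by
      rw [← zpow_natCast]; congr 1; push_cast; omega
    simpa [pairProd, rhoOp, this] using qAlt_vecMul_rhoMat hq ψ hne
  | append_singleton post m ih =>
    have hsplit : k :: k' :: (post ++ [m]) = (k :: k' :: post) ++ [m] := rfl
    rw [hsplit] at hl ⊢
    have hl1 := (List.nodup_append.1 hl).1
    rw [pairProd_concat (rhoOp_commute q) _ _ hl, ← vecMul_vecMul]
    have hnot : ∀ a ∈ k :: k' :: post, a ≠ m := fun a ha => (List.nodup_append.1 hl).2.2 a ha m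
      (by simp)
    simp only [List.nodup_cons, List.mem_cons, not_or] at hl1
    simp only [List.map_cons, List.prod_cons, ← vecMul_vecMul]
    have hkm := hnot k (by simp)
    have hkm' := hnot k' (by simp)
    refine QAlt.vecMul_rhoOp_prod ?_ m post (fun h => hnot m (by simp [h]) rfl) hkm hkm'
      hl1.1.2 hl1.2.1
    have h2 : rhoOp q k m = twoSite k m (rhoMat q (q ^ 2 * q ^ (2 * ((m.val : ℤ) - k'.val))) N) := by
      unfold rhoOp
      congr 2
      rw [← zpow_natCast, ← zpow_add₀ hq]
      congr 1; push_cast; omega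
    rw [h2]
    exact (ih (List.nodup_append.1 hl).1).vecMul_rhoMat_rhoMat hq _ hl1.1.1 hkm hkm'

include hq in
lemma qAlt_vecMul_pairProd_append {k k' : Fin N} (hkk : k.val + 1 = k'.val)
    (pre post : List (Fin N)) (hl : (k :: k' :: post).Nodup) (ψ : (Fin N → Fin N) → F) :
    QAlt q k k' (ψ ᵥ* pairProd (fun _ => 1) (rhoOp q) (pre ++ k :: k' :: post)) := by
  induction pre generalizing ψ with
  | nil => exact qAlt_vecMul_pairProd_cons_cons hq hkk post hl ψ
  | cons i pre ih =>
    rw [List.cons_append, pairProd, ← vecMul_vecMul]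
    exact ih _

lemma finRange_split {k k' : Fin N} (hkk : k.val + 1 = k'.val) :
    ∃ pre post, List.finRange N = pre ++ k :: k' :: post := by
  have hk : k.val < (List.finRange N).length := by simp
  have hk' : k.val + 1 < (List.finRange N).length := by simp [hkk]
  refine ⟨(List.finRange N).take k.val, (List.finRange N).drop (k.val + 2), ?_⟩
  conv_lhs => rw [← List.take_append_drop k.val (List.finRange N)]
  rw [List.drop_eq_getElem_cons hk, List.drop_eq_getElem_cons hk']
  have h : (⟨k.val + 1, hkk ▸ k'.isLt⟩ : Fin N) = k' := Fin.ext hkk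
  simp [h]

include hq in
lemma qAlt_rhoProd {k k' : Fin N} (hkk : k.val + 1 = k'.val) (f : Fin N → Fin N) :
    QAlt q k k' (rhoProd q N f) := by
  obtain ⟨pre, post, h⟩ := finRange_split hkk
  have hnd := h ▸ List.nodup_finRange N
  have := qAlt_vecMul_pairProd_append hq hkk pre post (List.nodup_append.1 hnd).2.1
    (Pi.single f 1)
  rw [← h] at this
  simpa [rhoProd, Matrix.row] using this

lemma vecMul_twoSite_congr {φ φ' : (Fin N → Fin N) → F} {i j s : Fin N} (hij : i ≠ j)
    (hsi : s ≠ i) (hsj : s ≠ j) {c : Fin N} (h : ∀ g, g s = c → φ g = φ' g)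
    (M : Matrix (Fin N × Fin N) (Fin N × Fin N) F) (g : Fin N → Fin N) (hg : g s = c) :
    (φ ᵥ* twoSite i j M) g = (φ' ᵥ* twoSite i j M) g := by
  rw [vecMul_twoSite _ hij, vecMul_twoSite _ hij]
  refine Finset.sum_congr rfl fun a _ => Finset.sum_congr rfl fun b _ => ?_
  rw [h _ (by simp [hsi, hsj, hg])]

lemma vecMul_list_twoSite_congr {φ φ' : (Fin N → Fin N) → F} {s : Fin N} {c : Fin N}
    (h : ∀ g, g s = c → φ g = φ' g) {R : Fin N → Fin N → Matrix (Fin N × Fin N) (Fin N × Fin N) F}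
    (i : Fin N) (l : List (Fin N)) (hi : i ∉ l) (hsi : s ≠ i) (hs : s ∉ l)
    (g : Fin N → Fin N) (hg : g s = c) :
    (φ ᵥ* (l.map fun j => twoSite i j (R i j)).prod) g =
      (φ' ᵥ* (l.map fun j => twoSite i j (R i j)).prod) g := by
  induction l generalizing φ φ' with
  | nil => simpa using h g hg
  | cons j l ih =>
    simp only [List.mem_cons, not_or] at hi hs
    simp only [List.map_cons, List.prod_cons, ← vecMul_vecMul]
    exact ih (fun g' hg' => vecMul_twoSite_congr hi.1 hsi hs.1 h _ g' hg') hi.2 hs.2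

lemma vecMul_pairProd_congr {φ φ' : (Fin N → Fin N) → F} {s : Fin N} {c : Fin N}
    (h : ∀ g, g s = c → φ g = φ' g) {R : Fin N → Fin N → Matrix (Fin N × Fin N) (Fin N × Fin N) F}
    (l : List (Fin N)) (hl : l.Nodup) (hs : s ∉ l) (g : Fin N → Fin N) (hg : g s = c) :
    (φ ᵥ* pairProd (fun _ => 1) (fun i j => twoSite i j (R i j)) l) g =
      (φ' ᵥ* pairProd (fun _ => 1) (fun i j => twoSite i j (R i j)) l) g := by
  induction l generalizing φ φ' with
  | nil => simpa [pairProd] using h g hg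
  | cons i l ih =>
    simp only [List.mem_cons, not_or, List.nodup_cons] at hl hs
    simp only [pairProd, one_mul, ← vecMul_vecMul]
    exact ih (fun g' hg' => vecMul_list_twoSite_congr h i l hl.1 hs.1 hs.2 g' hg') hl.2 hs.2

lemma vecMul_rhoOp_row_prod (i : Fin N) (l : List (Fin N)) (hl : (i :: l).Nodup)
    {φ : (Fin N → Fin N) → F} (h : ∀ g, φ g ≠ 0 → ∀ j ∈ l, g j = j) (g : Fin N → Fin N)
    (hg : g i = i) :
    (φ ᵥ* (l.map (rhoOp q i)).prod) g =
      (l.map fun j => q ^ (2 * ((j.val : ℤ) - i.val)) - 1).prod * φ g := by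
  induction l generalizing φ with
  | nil => simp
  | cons j l ih =>
    simp only [List.nodup_cons, List.mem_cons, not_or] at hl
    have hz : ∀ g', ∀ k ∈ l, g' k ≠ k → (φ ᵥ* rhoOp q i j) g' = 0 := by
      intro g' k hk hgk
      have hki : k ≠ i := by rintro rfl; exact hl.1.2 hk
      have hkj : k ≠ j := by rintro rfl; exact hl.2.1 hk
      have h1 : φ g' = 0 := by
        by_contra hne; exact hgk (h g' hne k (by simp [hk]))
      have h2 : φ (g' ∘ Equiv.swap i j) = 0 := by
        by_contra hne
        have := h _ hne k (by simp [hk])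
        rw [Function.comp_apply, Equiv.swap_apply_of_ne_of_ne hki hkj] at this
        exact hgk this
      rw [rhoOp, vecMul_rhoMat _ _ _ hl.1.1, h1, h2]
      simp
    simp only [List.map_cons, List.prod_cons, ← vecMul_vecMul]
    rw [ih (List.nodup_cons.2 ⟨hl.1.2, hl.2.2⟩) (fun g' hne k hk => by
      by_contra hc; exact hne (hz g' k hk hc))]
    have hstep : (φ ᵥ* rhoOp q i j) g = (q ^ (2 * ((j.val : ℤ) - i.val)) - 1) * φ g := by
      rw [rhoOp, vecMul_rhoMat _ _ _ hl.1.1]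
      have h2 : φ (g ∘ Equiv.swap i j) = 0 := by
        by_contra hne
        have := h _ hne j (by simp)
        rw [Function.comp_apply, Equiv.swap_apply_right, hg] at this
        exact hl.1.1 this
      split_ifs with he
      · have h1 : φ g = 0 := by
          by_contra hne
          have := h _ hne j (by simp)
          exact hl.1.1 (by rw [← hg, he, this])
        simp [h1]
      · simp [h2]
      · simp [h2]
    rw [hstep]; ring

lemma vecMul_rhoOp_pairProd (l : List (Fin N)) (hl : l.Nodup)
    {φ : (Fin N → Fin N) → F} (h : ∀ g, φ g ≠ 0 → ∀ j ∈ l, g j = j) (g : Fin N → Fin N)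
    (hg : ∀ j ∈ l, g j = j) :
    (φ ᵥ* pairProd (fun _ => 1) (rhoOp q) l) g =
      pairProd (fun _ => 1) (fun i j : Fin N => q ^ (2 * ((j.val : ℤ) - i.val)) - 1) l * φ g := by
  induction l generalizing φ with
  | nil => simp [pairProd]
  | cons i l ih =>
    have hl' := List.nodup_cons.1 hl
    simp only [pairProd, one_mul, ← vecMul_vecMul]
    set ψ : (Fin N → Fin N) → F := fun g' => if g' i = i then
      (φ ᵥ* (l.map (rhoOp q i)).prod) g' else 0 with hψ
    have e1 : ∀ g', g' i = i → (φ ᵥ* (l.map (rhoOp q i)).prod) g' = ψ g' := fun g' hg' => by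
      simp [hψ, hg']
    have e2 := fun g' hg' => vecMul_rhoOp_row_prod (q := q) i l hl
      (fun g'' hne j hj => h g'' hne j (by simp [hj])) g' hg'
    have hgi := hg i (by simp)
    refine (vecMul_pairProd_congr (R := fun i j => rhoMat q (q ^ (2 * ((j.val : ℤ) - i.val))) N)
      e1 l hl'.2 hl'.1 g hgi).trans ?_
    change (ψ ᵥ* pairProd (fun _ => 1) (rhoOp q) l) g = _
    rw [ih hl'.2 (φ := ψ) ?_ fun j hj => hg j (by simp [hj])]
    · rw [← e1 g hgi, e2 g hgi]; ring
    · intro g' hne j hj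
      by_cases hgi' : g' i = i
      · rw [← e1 g' hgi', e2 g' hgi'] at hne
        exact h g' (right_ne_zero_of_mul hne) j (by simp [hj])
      · simp [hψ, hgi'] at hne

lemma pairProd_ne_zero {α : Type} {c : α → α → F} (l : List α) (hl : l.Nodup)
    (hc : ∀ i j, i ≠ j → c i j ≠ 0) : pairProd (fun _ => 1) c l ≠ 0 := by
  induction l with
  | nil => simp [pairProd]
  | cons i l ih =>
    rw [List.nodup_cons] at hl
    rw [pairProd, one_mul]
    refine mul_ne_zero (List.prod_ne_zero fun h => ?_) (ih hl.2)
    obtain ⟨j, hj, h0⟩ := List.mem_map.1 h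
    exact hc i j (by rintro rfl; exact hl.1 hj) h0

lemma rhoProd_id_id_ne_zero (hq1 : ∀ m : ℤ, m ≠ 0 → q ^ m ≠ 1) : rhoProd q N id id ≠ 0 := by
  have h := vecMul_rhoOp_pairProd (q := q) (List.finRange N) (List.nodup_finRange N)
    (φ := Pi.single id 1) (fun g hne j _ => by
      by_cases hg : g = id
      · rw [hg]; rfl
      · exact absurd (by simp [hg]) hne) id fun _ _ => rfl
  have e : (Pi.single id (1 : F) ᵥ* pairProd (fun _ => 1) (rhoOp q) (List.finRange N)) id =
      rhoProd q N id id := by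
    simp [rhoProd]
  rw [← e, h, Pi.single_eq_same, mul_one]
  refine pairProd_ne_zero _ (List.nodup_finRange N) fun i j hij => sub_ne_zero.2 (hq1 _ ?_)
  rw [Ne, Fin.ext_iff] at hij
  omega

/-- Transposition combined with the reversal of sites. -/
def flipOp (M : Matrix (Fin N → Fin N) (Fin N → Fin N) F) :
    Matrix (Fin N → Fin N) (Fin N → Fin N) F :=
  Matrix.of fun f g => M (g ∘ Fin.rev) (f ∘ Fin.rev)

lemma flipOp_mul (M M' : Matrix (Fin N → Fin N) (Fin N → Fin N) F) :
    flipOp (M * M') = flipOp M' * flipOp M := by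
  ext f g
  simp only [flipOp, Matrix.of_apply, Matrix.mul_apply]
  refine Fintype.sum_equiv (Equiv.arrowCongr Fin.revPerm (Equiv.refl _)) _ _ fun x => ?_
  have : (Equiv.arrowCongr Fin.revPerm (Equiv.refl (Fin N))) x ∘ Fin.rev = x := by
    ext t; simp [Equiv.arrowCongr]
  rw [this, mul_comm]

lemma flipOp_one : flipOp (1 : Matrix (Fin N → Fin N) (Fin N → Fin N) F) = 1 := by
  ext f g
  simp only [flipOp, Matrix.of_apply, Matrix.one_apply]
  refine if_congr ?_ rfl rfl
  rw [(Fin.rev_surjective (n := N)).injective_comp_right.eq_iff, eq_comm]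

lemma flipOp_rhoOp (i j : Fin N) : flipOp (rhoOp q i j) = rhoOp q j.rev i.rev := by
  have hexp : ((i.rev).val : ℤ) - j.rev.val = (j.val : ℤ) - i.val := by
    have := i.isLt; have := j.isLt
    simp only [Fin.val_rev]; omega
  ext f g
  simp only [flipOp, rhoOp, twoSite, Matrix.of_apply, Function.comp_apply, hexp]
  refine if_congr ?_ ?_ rfl
  · constructor
    · intro h k hk hk'
      have := h k.rev (fun e => hk' (by rw [← e, Fin.rev_rev])) fun e => hk (by rw [← e, Fin.rev_rev])
      simpa using this.symm
    · intro h k hk hk'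
      exact (h k.rev (fun e => hk' (Fin.rev_injective e)) fun e => hk (Fin.rev_injective e)).symm
  · rw [rhoMat_apply, rhoMat_apply]
    generalize f i.rev = a
    generalize f j.rev = b
    generalize g i.rev = c
    generalize g j.rev = d
    by_cases h1 : c = a
    · subst h1
      by_cases h2 : d = b
      · subst h2
        by_cases h3 : c = d
        · subst h3; simp
        · simp [h3, Ne.symm h3]
      · by_cases h3 : c = b
        · subst h3; simp [h2, Ne.symm h2]
        · simp [h2, Ne.symm h2, h3, Ne.symm h3]
    · by_cases h2 : c = b
      · subst h2
        by_cases h3 : d = a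
        · subst h3; simp [h1]
        · simp [h1, Ne.symm h1, h3, Ne.symm h3]
      · simp [h1, Ne.symm h1, h2, Ne.symm h2]

lemma flipOp_list_prod (l : List (Matrix (Fin N → Fin N) (Fin N → Fin N) F)) :
    flipOp l.prod = (l.reverse.map flipOp).prod := by
  induction l with
  | nil => simp [flipOp_one]
  | cons a l ih => simp [flipOp_mul, ih]

lemma flipOp_pairProd (l : List (Fin N)) (hl : l.Nodup) :
    flipOp (pairProd (fun _ => 1) (rhoOp q) l) =
      pairProd (fun _ => 1) (rhoOp q) (l.map Fin.rev).reverse := by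
  induction l with
  | nil => simp [pairProd, flipOp_one]
  | cons i l ih =>
    have hnd : ((l.map Fin.rev).reverse ++ [Fin.rev i]).Nodup := by
      have : ((i :: l).map Fin.rev).Nodup := hl.map Fin.rev_injective
      simpa using List.nodup_reverse.2 this
    rw [List.map_cons, List.reverse_cons, pairProd_concat (rhoOp_commute q) _ _ hnd, pairProd,
      one_mul, flipOp_mul, ih (List.nodup_cons.1 hl).2, flipOp_list_prod]
    congr 2
    rw [← List.map_reverse, ← List.map_reverse, List.map_map, List.map_map]
    refine List.map_congr_left fun j _ => ?_
    simp [flipOp_rhoOp]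

lemma flipOp_rhoProd : flipOp (rhoProd q N) = rhoProd q N := by
  have : ((List.finRange N).map Fin.rev).reverse = List.finRange N := by
    rw [← List.finRange_reverse, List.reverse_reverse]
  rw [rhoProd, flipOp_pairProd _ (List.nodup_finRange N), this]

include hq in
lemma rhoProd_apply (f g : Fin N → Fin N) :
    rhoProd q N f g = qSign q g * rhoProd q N f id :=
  eq_qSign_smul (fun _ _ h => qAlt_rhoProd hq h f) g

include hq in
lemma qSign_rev_mul_rhoProd_apply_id (f : Fin N → Fin N) :
    qSign q (Fin.rev : Fin N → Fin N) * rhoProd q N f id =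
      qSign q (f ∘ Fin.rev) * rhoProd q N id id := by
  have h1 : rhoProd q N f id = rhoProd q N Fin.rev (f ∘ Fin.rev) := by
    conv_lhs => rw [← flipOp_rhoProd]
    rfl
  have h2 : rhoProd q N id id = rhoProd q N Fin.rev Fin.rev := by
    conv_lhs => rw [← flipOp_rhoProd]
    rfl
  rw [h1, h2, rhoProd_apply hq, rhoProd_apply hq (g := Fin.rev)]
  ring

end RProductAlternation

section DetSystems

open Function Matrix

variable {F : Type} [Field F] {q : F} {N : ℕ} {L : Type} [Ring L] [Algebra F L]

lemma ampAt_list_prod_apply (M : Fin N → Matrix (Fin N) (Fin N) L) (l : List (Fin N))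
    (hl : l.Nodup) (f g : Fin N → Fin N) :
    (l.map fun k => ampAt k (M k)).prod f g =
      if ∀ k, k ∉ l → f k = g k then (l.map fun k => M k (f k) (g k)).prod else 0 := by
  induction l using List.reverseRecOn generalizing g with
  | nil => simp [Matrix.one_apply, funext_iff]
  | append_singleton l k ih =>
    obtain ⟨hl, -, hk⟩ := List.nodup_append.1 hl
    have hk : k ∉ l := fun h => hk k h k (by simp) rfl
    rw [List.map_append, List.prod_append, List.map_singleton, List.prod_singleton]
    change ((l.map fun k => ampAt k (M k)).prod f ᵥ* ampAt k (M k)) g = _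
    rw [vecMul_ampAt, Finset.sum_eq_single (f k)]
    · rw [ih hl, ite_mul, zero_mul]
      refine if_congr ⟨fun h m hm => ?_, fun h m hm => ?_⟩ ?_ rfl
      · simp only [List.mem_append, List.mem_singleton, not_or] at hm
        rw [h m hm.1, update_of_ne hm.2]
      · by_cases hmk : m = k
        · rw [hmk, update_self]
        · rw [update_of_ne hmk, h m (by simp [hm, hmk])]
      · rw [List.map_append, List.prod_append, List.map_singleton, List.prod_singleton]
        congr 2
        refine List.map_congr_left fun m hm => ?_
        rw [update_of_ne (ne_of_mem_of_not_mem hm hk)]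
    · intro a _ ha
      rw [ih hl, if_neg, zero_mul]
      intro h
      exact ha (by rw [h k hk, update_self])
    · simp

lemma ampAt_finRange_prod_apply (M : Fin N → Matrix (Fin N) (Fin N) L) (f g : Fin N → Fin N) :
    ((List.finRange N).map fun k => ampAt k (M k)).prod f g =
      ((List.finRange N).map fun k => M k (f k) (g k)).prod := by
  rw [ampAt_list_prod_apply M _ (List.nodup_finRange N), if_pos]
  exact fun k hk => absurd (List.mem_finRange k) hk

/-- The `q`-antisymmetric row vector, with values in an algebra. -/
def qSignA (q : F) (L : Type) [Ring L] [Algebra F L] (h : Fin N → Fin N) : L :=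
  algebraMap F L (qSign q h)

/-- The matrices `Y k` satisfy the exchange relations of a specialized `T`-matrix. -/
def IsRttSystem (q : F) (Y : Fin N → Matrix (Fin N) (Fin N) L) : Prop :=
  ∀ i j, i ≠ j → (rhoOp q i j).map (algebraMap F L) * ampAt i (Y i) * ampAt j (Y j) =
    ampAt j (Y j) * ampAt i (Y i) * (rhoOp q i j).map (algebraMap F L)

/-- The quantum determinant of a system of matrices. -/
def rttDet (q : F) (Y : Fin N → Matrix (Fin N) (Fin N) L) : L :=
  ∑ g : Fin N → Fin N, qSignA q L g * ((List.finRange N).map fun k => Y k (g k) k).prod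

lemma IsRttSystem.exchange {Y : Fin N → Matrix (Fin N) (Fin N) L} (hY : IsRttSystem q Y) :
    (rhoProd q N).map (algebraMap F L) * ((List.finRange N).map fun k => ampAt k (Y k)).prod =
      ((List.finRange N).reverse.map fun k => ampAt k (Y k)).prod *
        (rhoProd q N).map (algebraMap F L) := by
  have h : (rhoProd q N).map (algebraMap F L) =
      pairProd (fun _ => 1) (fun i j => (rhoOp q i j).map (algebraMap F L)) (List.finRange N) := by
    have := map_pairProd ((algebraMap F L).mapMatrix.toMonoidHom :
      Matrix (Fin N → Fin N) (Fin N → Fin N) F →* Matrix (Fin N → Fin N) (Fin N → Fin N) L)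
      (fun _ => 1) (rhoOp q) (List.finRange N)
    simpa [rhoProd] using this
  rw [h]
  refine pairProd_mul_exchange _ (List.nodup_finRange N) hY fun k i j hij hki hkj => ?_
  rw [rhoOp, map_twoSite]
  exact ampAt_commute_twoSite hij hki hkj _ _ fun _ _ _ _ => (Algebra.commutes _ _).symm

variable (hq : q ≠ 0) (hq1 : ∀ m : ℤ, m ≠ 0 → q ^ m ≠ 1)

include hq in
lemma rhoProd_mul_apply (P : Matrix (Fin N → Fin N) (Fin N → Fin N) L) (g : Fin N → Fin N) :
    ((rhoProd q N).map (algebraMap F L) * P) id g =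
      algebraMap F L (rhoProd q N id id) * (qSignA q L ᵥ* P) g := by
  simp only [Matrix.mul_apply, vecMul, dotProduct, Finset.mul_sum, Matrix.map_apply]
  refine Finset.sum_congr rfl fun h _ => ?_
  rw [rhoProd_apply hq id h, mul_comm, map_mul, mul_assoc, qSignA]

lemma vecMul_ampAt_prod_id (Y : Fin N → Matrix (Fin N) (Fin N) L) :
    (qSignA q L ᵥ* ((List.finRange N).map fun k => ampAt k (Y k)).prod) id = rttDet q Y := by
  simp only [vecMul, dotProduct, rttDet, ampAt_finRange_prod_apply, id]

include hq hq1 in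
lemma IsRttSystem.vecMul_prod {Y : Fin N → Matrix (Fin N) (Fin N) L} (hY : IsRttSystem q Y) :
    qSignA q L ᵥ* ((List.finRange N).map fun k => ampAt k (Y k)).prod =
      fun g => rttDet q Y * qSignA q L g := by
  have h0 := rhoProd_id_id_ne_zero (N := N) hq1
  have key : ∀ g, algebraMap F L (rhoProd q N id id) *
      (qSignA q L ᵥ* ((List.finRange N).map fun k => ampAt k (Y k)).prod) g =
      (∑ h, ((List.finRange N).reverse.map fun k => ampAt k (Y k)).prod id h *
        algebraMap F L (rhoProd q N h id)) * qSignA q L g := fun g => by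
    rw [← rhoProd_mul_apply hq, hY.exchange, Matrix.mul_apply, Finset.sum_mul]
    refine Finset.sum_congr rfl fun h _ => ?_
    rw [Matrix.map_apply, rhoProd_apply hq h g, mul_comm (qSign q g), map_mul, mul_assoc, qSignA]
  have hid : qSignA (N := N) q L id = 1 := by rw [qSignA, qSign_id, map_one]
  have hu : IsUnit (algebraMap F L (rhoProd q N id id)) := (IsUnit.mk0 _ h0).map _
  funext g
  refine hu.mul_left_cancel ?_
  rw [key, ← mul_assoc]
  congr 1
  rw [← vecMul_ampAt_prod_id, key, hid, mul_one]

include hq hq1 in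
lemma IsRttSystem.sum_reverse {Y : Fin N → Matrix (Fin N) (Fin N) L} (hY : IsRttSystem q Y) :
    ∑ f : Fin N → Fin N, qSignA q L f *
        ((List.finRange N).map fun k => Y k.rev k.rev (f k)).prod =
      rttDet q Y * qSignA q L (Fin.rev : Fin N → Fin N) := by
  have h0 := rhoProd_id_id_ne_zero (N := N) hq1
  have hu : IsUnit (algebraMap F L (rhoProd q N id id)) := (IsUnit.mk0 _ h0).map _
  refine hu.mul_left_cancel ?_
  rw [← vecMul_ampAt_prod_id, ← mul_assoc, ← rhoProd_mul_apply hq, hY.exchange, Matrix.mul_apply,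
    Finset.sum_mul, Finset.mul_sum]
  refine Fintype.sum_equiv (Equiv.arrowCongr Fin.revPerm (Equiv.refl _)) _ _ fun f => ?_
  have hr : (Equiv.arrowCongr Fin.revPerm (Equiv.refl _)) f = f ∘ Fin.rev := rfl
  rw [hr, Matrix.map_apply, ampAt_list_prod_apply _ _ (List.nodup_reverse.2 (List.nodup_finRange N)),
    if_pos (fun k hk => absurd (List.mem_reverse.2 (List.mem_finRange k)) hk),
    mul_assoc, qSignA, qSignA, ← map_mul, mul_comm (rhoProd q N _ _) (qSign q _),
    qSign_rev_mul_rhoProd_apply_id hq, List.finRange_reverse, List.map_map, ← mul_assoc, ← map_mul,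
    mul_comm (rhoProd q N _ _), Algebra.commutes]
  have hff : (f ∘ Fin.rev) ∘ Fin.rev = f := by funext k; simp
  rw [hff]
  congr 3
  funext k
  simp

end DetSystems

section SklyaninFactorization

open Function Matrix

variable {F : Type} [Field F] {q : F} {N : ℕ} {L : Type} [Ring L] [Algebra F L]

lemma ampAt_mul (k : Fin N) (X Y : Matrix (Fin N) (Fin N) L) :
    ampAt k (X * Y) = ampAt k X * ampAt k Y := by
  refine matrix_ext_vecMul fun φ => ?_
  ext h
  rw [← vecMul_vecMul, vecMul_ampAt, vecMul_ampAt]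
  simp only [vecMul_ampAt, update_idem, update_self, Matrix.mul_apply, Finset.mul_sum,
    Finset.sum_mul, mul_assoc]
  exact Finset.sum_comm

variable {C : Type} [CommRing C] [Algebra F C]

lemma map_pairProd_ampAt (ι : C →+* L) (G : Fin N → Matrix (Fin N) (Fin N) C)
    (R : Fin N → Fin N → Matrix (Fin N × Fin N) (Fin N × Fin N) C) (l : List (Fin N)) :
    (pairProd (fun i => ampAt i (G i)) (fun i j => twoSite i j (R i j)) l).map ι =
      pairProd (fun i => ampAt i ((G i).map ι)) (fun i j => twoSite i j ((R i j).map ι)) l := by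
  have := map_pairProd (ι.mapMatrix.toMonoidHom :
      Matrix (Fin N → Fin N) (Fin N → Fin N) C →* Matrix (Fin N → Fin N) (Fin N → Fin N) L)
      (fun i => ampAt i (G i)) (fun i j => twoSite i j (R i j)) l
  simpa [map_twoSite, map_ampAt] using this

/-- The row vector `η` times `T₁G₁T̄₁ᵗR₁₂ᵗ⋯` at the reversed word. -/
theorem vecMul_sklyanin_rev (hq : q ≠ 0) (hq1 : ∀ m : ℤ, m ≠ 0 → q ^ m ≠ 1)
    (ι : C →ₐ[F] L) (hι : ∀ c x, Commute (ι c) x)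
    {T Tb : Fin N → Matrix (Fin N) (Fin N) L} (G : Fin N → Matrix (Fin N) (Fin N) C)
    (R : Fin N → Fin N → Matrix (Fin N × Fin N) (Fin N × Fin N) C) (κ : C)
    (hT : IsRttSystem q T) (hTb : IsRttSystem q fun k => Tb k.rev)
    (hTbT : ∀ i j, i ≠ j → ampAt i (Tb i)ᵀ * twoSite i j ((R i j).map ι) * ampAt j (T j) =
      ampAt j (T j) * twoSite i j ((R i j).map ι) * ampAt i (Tb i)ᵀ)
    (hκ : ∀ h, (qSignA q C ᵥ* pairProd (fun i => ampAt i (G i)) (fun i j => twoSite i j (R i j))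
      (List.finRange N)) h = κ * qSignA q C h) :
    (qSignA q L ᵥ* pairProd (fun i => ampAt i (T i * (G i).map ι * (Tb i)ᵀ))
      (fun i j => twoSite i j ((R i j).map ι)) (List.finRange N)) Fin.rev =
      rttDet q T * ι κ * rttDet q (fun k => Tb k.rev) * qSignA q L (Fin.rev : Fin N → Fin N) := by
  have hfac : pairProd (fun i => ampAt i (T i * (G i).map ι * (Tb i)ᵀ))
      (fun i j => twoSite i j ((R i j).map ι)) (List.finRange N) =
      ((List.finRange N).map fun i => ampAt i (T i)).prod *
        (pairProd (fun i => ampAt i (G i)) (fun i j => twoSite i j (R i j))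
          (List.finRange N)).map ι *
        ((List.finRange N).map fun i => ampAt i (Tb i)ᵀ).prod := by
    have h1 := map_pairProd_ampAt ι.toRingHom G R (List.finRange N)
    simp only [AlgHom.toRingHom_eq_coe, RingHom.coe_coe] at h1
    rw [h1, ← pairProd_factor _ (List.nodup_finRange N) hTbT]
    · simp only [ampAt_mul]
    · exact fun k i j hij hki hkj => ampAt_commute_twoSite hij hki hkj _ _
        fun _ _ _ _ => (hι _ _).symm
    · exact fun k i j hij hki hkj => ampAt_commute_twoSite hij hki hkj _ _
        fun _ _ _ _ => (hι _ _).symm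
    · exact fun i j hij => ampAt_commute_ampAt hij _ _ fun _ _ _ _ => hι _ _
    · exact fun i j hij => ampAt_commute_ampAt hij _ _ fun _ _ _ _ => (hι _ _).symm
  have hηι : ∀ h : Fin N → Fin N, qSignA q L h = ι (qSignA q C h) := fun h => by
    simp [qSignA]
  have hK : ∀ h, (qSignA q L ᵥ* (pairProd (fun i => ampAt i (G i))
      (fun i j => twoSite i j (R i j)) (List.finRange N)).map ι) h = ι κ * qSignA q L h := by
    intro h
    rw [hηι, ← map_mul, ← hκ]
    simp [vecMul, dotProduct, hηι]
  rw [hfac, ← vecMul_vecMul, ← vecMul_vecMul, hT.vecMul_prod hq hq1]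
  have hK' : ((fun g => rttDet q T * qSignA q L g) ᵥ* (pairProd (fun i => ampAt i (G i))
      (fun i j => twoSite i j (R i j)) (List.finRange N)).map ι) =
      fun g => rttDet q T * ι κ * qSignA q L g := by
    funext g
    rw [mul_assoc, ← hK]
    simp only [vecMul, dotProduct, Finset.mul_sum, mul_assoc]
  rw [hK', mul_assoc _ (rttDet q _), ← hTb.sum_reverse hq hq1, Finset.mul_sum]
  simp only [vecMul, dotProduct, ampAt_finRange_prod_apply, Matrix.transpose_apply,
    Fin.rev_rev, mul_assoc]

end SklyaninFactorization

section TransposedRMatrix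

open Function Matrix

variable {F : Type} [Field F] {q : F} {N : ℕ} {C : Type} [CommRing C] [Algebra F C]

/-- The transposed `R`-matrix `x R̃ᵗ - v Rᵗ` over a commutative algebra. -/
def rtMat (q : F) (N : ℕ) (x v : C) : Matrix (Fin N × Fin N) (Fin N × Fin N) C :=
  x • (Rtilt F q N).map (algebraMap F C) - v • (Rct F q N).map (algebraMap F C)

/-- The coefficient of `e_d ⊗ e_d` in the image of `e_c ⊗ e_c` under `rtMat`. -/
def rtCoef (q : F) (x v : C) (c d : Fin N) : C :=
  if d = c then q⁻¹ • x - q • v else if d < c then (q⁻¹ - q) • x else (q⁻¹ - q) • v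

lemma rtMat_apply (x v : C) (a b c d : Fin N) :
    rtMat q N x v (a, b) (c, d) =
      if c = d then (if a = b then rtCoef q x v c a else 0)
      else if a = c ∧ b = d then x - v else 0 := by
  change x * algebraMap F C (Rtil F q N (c, b) (a, d)) -
    v * algebraMap F C (Rc F q N (c, b) (a, d)) = _
  simp only [Rtil, Rc, Matrix.of_apply, Prod.mk.injEq, rtCoef, Algebra.smul_def]
  by_cases hcd : c = d
  · subst hcd
    by_cases hab : a = b
    · subst hab
      rcases lt_trichotomy a c with h | h | h
      · simp [h, h.ne, h.ne', h.not_gt]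
        ring
      · subst h
        simp
        ring
      · simp [h, h.ne, h.ne', h.not_gt]
        ring
    · have h1 : ¬ (c = a ∧ b = c) := by rintro ⟨rfl, rfl⟩; exact hab rfl
      have h2 : ∀ P : Prop, ¬ (c = c ∧ b = a ∧ P) := fun P h => hab h.2.1.symm
      simp [h1, hab, Ne.symm hab]
  · by_cases hab : a = c ∧ b = d
    · obtain ⟨rfl, rfl⟩ := hab
      simp [hcd]
    · have h1 : ¬ (c = a ∧ b = d) := fun h => hab ⟨h.1.symm, h.2⟩
      simp [hcd, hab, h1]

lemma vecMul_rtMat (φ : (Fin N → Fin N) → C) {i j : Fin N} (hij : i ≠ j) (x v : C)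
    (h : Fin N → Fin N) :
    (φ ᵥ* twoSite i j (rtMat q N x v)) h =
      if h i = h j then ∑ d, rtCoef q x v (h i) d * φ (update (update h i d) j d)
      else (x - v) * φ h := by
  rw [vecMul_twoSite _ hij]
  simp only [rtMat_apply]
  split_ifs with he
  · simp [mul_comm]
  · rw [Finset.sum_eq_single (h i) _ (by simp), Finset.sum_eq_single (h j) _ (by simp)]
    · simp [mul_comm]
    · intro b _ hb
      simp [hb]
    · intro b _ hb
      simp [hb]

lemma vecMul_rtMat_of_ne (φ : (Fin N → Fin N) → C) {i j : Fin N} (x v : C)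
    {h : Fin N → Fin N} (hne : h i ≠ h j) :
    (φ ᵥ* twoSite i j (rtMat q N x v)) h = (x - v) * φ h := by
  rw [vecMul_rtMat _ (ne_of_apply_ne h hne), if_neg hne]

lemma QAlt.vecMul_ampAt {φ : (Fin N → Fin N) → C} {k k' i : Fin N}
    (hki : k ≠ i) (hki' : k' ≠ i) (M : Matrix (Fin N) (Fin N) C) (hφ : QAlt q k k' φ) :
    QAlt q k k' (φ ᵥ* ampAt i M) := by
  intro h
  refine ⟨fun he => ?_, fun hlt => ?_⟩
  · rw [_root_.vecMul_ampAt]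
    refine Finset.sum_eq_zero fun a _ => ?_
    rw [(hφ _).1 (by simp [hki, hki', he]), zero_mul]
  · rw [_root_.vecMul_ampAt, _root_.vecMul_ampAt, Finset.smul_sum]
    refine Finset.sum_congr rfl fun a _ => ?_
    have e : update (h ∘ Equiv.swap k k') i a = update h i a ∘ Equiv.swap k k' := by
      ext x
      by_cases hxk : x = k
      · subst hxk; simp [hki, hki']
      · by_cases hxk' : x = k'
        · subst hxk'; simp [hki, hki']
        · simp only [Function.comp_apply, Equiv.swap_apply_of_ne_of_ne hxk hxk', update_apply]
    rw [e, (hφ _).2 (by simpa [hki, hki'] using hlt)]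
    simp [Equiv.swap_apply_of_ne_of_ne hki.symm hki'.symm]

/-- The three-letter identity behind the fusion of transposed `R`-matrices. -/
lemma rtCoef_fusion (hq : q ≠ 0) (x v : C) (f : Fin N → Fin N → Fin N → C)
    (hf0 : ∀ c a, f c a a = 0) (hf : ∀ c a b, a < b → f c b a = (-q)⁻¹ • f c a b)
    (g : Fin N → Fin N → Fin N → C)
    (hg : ∀ c a b, g c a b = if c = a then ∑ d, rtCoef q x v c d * f d d b else (x - v) * f c a b)
    (k : Fin N → Fin N → Fin N → C)
    (hk : ∀ c a b, k c a b = if c = b then ∑ d, rtCoef q x ((q ^ 2)⁻¹ • v) c d * g d a d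
      else (x - (q ^ 2)⁻¹ • v) * g c a b) :
    (∀ c a, k c a a = 0) ∧ ∀ c a b, a < b → k c b a = (-q)⁻¹ • k c a b := by
  set p := algebraMap F C q with hp
  set p' := algebraMap F C q⁻¹ with hp'
  have hpp : p * p' = 1 := by rw [hp, hp', ← map_mul, mul_inv_cancel₀ hq, map_one]
  have hw : (q ^ 2)⁻¹ • v = p' ^ 2 * v := by
    rw [Algebra.smul_def, hp', ← map_pow, inv_pow]
  have hn : ∀ y : C, (-q)⁻¹ • y = -(p' * y) := fun y => by
    rw [Algebra.smul_def, inv_neg, map_neg, neg_mul]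
  have hco : ∀ (y z : C) (c d : Fin N), rtCoef q y z c d =
      if d = c then p' * y - p * z else if d < c then (p' - p) * y else (p' - p) * z := by
    intro y z c d
    simp only [rtCoef, Algebra.smul_def, hp, hp', map_sub]
  have hf' : ∀ c a b, a < b → f c b a = -(p' * f c a b) := fun c a b h => by rw [hf c a b h, hn]
  simp only [hw, hn] at hk ⊢
  -- the sums over the inner letters as single sums
  have hs : ∀ c a, ∑ d, rtCoef q x (p' ^ 2 * v) c d * g d a d =
      ∑ e, ((if e = a then 0 else rtCoef q x (p' ^ 2 * v) c e * ((x - v) * f e a e)) +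
        rtCoef q x (p' ^ 2 * v) c a * (rtCoef q x v a e * f e e a)) := by
    intro c a
    rw [Finset.sum_add_distrib, ← Finset.mul_sum]
    have h1 : ∑ e, rtCoef q x v a e * f e e a = g a a a := by rw [hg, if_pos rfl]
    rw [h1, ← Finset.sum_erase_add _ _ (Finset.mem_univ a)]
    congr 1
    rw [← Finset.sum_erase_add _ _ (Finset.mem_univ a), if_pos rfl, add_zero]
    refine Finset.sum_congr rfl fun e he => ?_
    have hea := Finset.ne_of_mem_erase he
    rw [if_neg hea, hg, if_neg hea]
  refine ⟨fun c a => ?_, fun c a b hab => ?_⟩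
  · rw [hk]
    split_ifs with hc
    · subst hc
      rw [hs]
      refine Finset.sum_eq_zero fun e _ => ?_
      rcases lt_trichotomy e c with h | h | h
      · have := hf' e e c h
        simp only [hco, h, h.ne, if_true, if_false]
        rw [this]
        grind
      · subst h; simp [hf0]
      · have := hf' e c e h
        simp only [hco, h.ne', h.not_gt, if_true, if_false]
        rw [this]
        grind
    · rw [hg, if_neg hc, hf0, mul_zero, mul_zero]
  · rw [hk c b a, hk c a b]
    by_cases hca : c = a
    · subst hca
      rw [if_pos rfl, if_neg hab.ne, hs, hg c c b, if_pos rfl, ← mul_assoc,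
        neg_mul_eq_neg_mul, Finset.mul_sum]
      refine Finset.sum_congr rfl fun e _ => ?_
      simp only [hco]
      rcases lt_trichotomy e b with h | h | h
      · have := hf' e e b h
        rcases lt_trichotomy e c with h' | h' | h'
        · simp only [h.ne, h', h'.ne, hab.ne', hab.not_gt, h, if_false, if_true]
          rw [this]
          grind
        · subst h'
          simp only [h.ne, hab.ne', hab.not_gt, h, if_false, if_true]
          rw [this]
          grind
        · simp only [h.ne, h'.ne', h'.not_gt, hab.ne', hab.not_gt, h, if_false, if_true]
          rw [this]
          grind
      · subst h; simp [hf0]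
      · have := hf' e b e h
        have h' := hab.trans h
        simp only [h.ne', h'.ne', h'.not_gt, h.not_gt, hab.ne', hab.not_gt, if_false]
        rw [this]
        grind
    · rw [if_neg hca]
      by_cases hcb : c = b
      · subst hcb
        rw [if_pos rfl, hs, hg c c a, if_pos rfl, neg_mul_eq_neg_mul, Finset.mul_sum,
          Finset.mul_sum]
        refine Finset.sum_congr rfl fun e _ => ?_
        simp only [hco]
        rcases lt_trichotomy e a with h | h | h
        · have := hf' e e a h
          have h' := h.trans hab
          simp only [h.ne, h', h'.ne, hab, hab.ne, h, if_false, if_true]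
          rw [this]
          grind
        · subst h; simp [hf0]
        · have := hf' e a e h
          rcases lt_trichotomy e c with h' | h' | h'
          · simp only [h.ne', h', h'.ne, h.not_gt, hab, hab.ne, if_false, if_true]
            rw [this]
            grind
          · subst h'
            simp only [h.ne', h.not_gt, hab, hab.ne, if_false, if_true]
            rw [this]
            grind
          · simp only [h.ne', h'.ne', h.not_gt, h'.not_gt, hab, hab.ne, if_false, if_true]
            rw [this]
            grind
      · rw [if_neg hcb, hg, if_neg hcb, hg, if_neg hca, hf' _ _ _ hab]
        ring

end TransposedRMatrix

section TransposedRowProducts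

open Function Matrix

variable {F : Type} [Field F] {q : F} {N : ℕ} {C : Type} [CommRing C] [Algebra F C]

lemma QAlt.vecMul_rtMat_rtMat (hq : q ≠ 0) (x v : C) {φ : (Fin N → Fin N) → C} {k k' m : Fin N}
    (hkk : k ≠ k') (hmk : m ≠ k) (hmk' : m ≠ k') (hφ : QAlt q k k' φ) :
    QAlt q k k' (φ ᵥ* twoSite m k (rtMat q N x v) ᵥ*
      twoSite m k' (rtMat q N x ((q ^ 2)⁻¹ • v))) := by
  intro h
  let U : Fin N → Fin N → Fin N → (Fin N → Fin N) := fun c a b =>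
    update (update (update h m c) k a) k' b
  have hUm : ∀ c a b, U c a b m = c := fun c a b => by simp [U, hmk, hmk']
  have hUk : ∀ c a b, U c a b k = a := fun c a b => by simp [U, hkk]
  have hUk' : ∀ c a b, U c a b k' = b := fun c a b => by simp [U]
  have hU1 : ∀ c a b d e, update (update (U c a b) m d) k e = U d e b := fun c a b d e => by
    funext s
    by_cases h1 : s = m
    · subst h1; simp [U, hmk, hmk']
    · by_cases h2 : s = k
      · subst h2; simp [U, hkk]
      · by_cases h3 : s = k'
        · subst h3; simp [U, h1, h2]
        · simp [U, h1, h2, h3]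
  have hU2 : ∀ c a b d e, update (update (U c a b) m d) k' e = U d a e := fun c a b d e => by
    funext s
    by_cases h1 : s = m
    · subst h1; simp [U, hmk, hmk']
    · by_cases h2 : s = k
      · subst h2; simp [U, hkk, h1]
      · by_cases h3 : s = k'
        · subst h3; simp [U]
        · simp [U, h1, h2, h3]
  have hUs : ∀ c a b, U c a b ∘ Equiv.swap k k' = U c b a := fun c a b => by
    funext s
    by_cases h2 : s = k
    · subst h2; simp [hUk', hUk]
    · by_cases h3 : s = k'
      · subst h3; simp [hUk', hUk]
      · simp [U, Equiv.swap_apply_of_ne_of_ne h2 h3, h2, h3, update_apply]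
  have hh : U (h m) (h k) (h k') = h := by simp [U]
  obtain ⟨h1, h2⟩ := rtCoef_fusion hq x v (fun c a b => φ (U c a b))
    (fun c a => (hφ _).1 (by rw [hUk, hUk']))
    (fun c a b hab => by
      rw [← hUs]
      exact (hφ _).2 (by rwa [hUk, hUk']))
    (fun c a b => (φ ᵥ* twoSite m k (rtMat q N x v)) (U c a b))
    (fun c a b => by simp only [vecMul_rtMat _ hmk, hUm, hUk, hU1])
    (fun c a b => (φ ᵥ* twoSite m k (rtMat q N x v) ᵥ*
      twoSite m k' (rtMat q N x ((q ^ 2)⁻¹ • v))) (U c a b))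
    (fun c a b => by simp only [vecMul_rtMat _ hmk', hUm, hUk', hU2])
  rw [← hh]
  simp only [hUk, hUk', hUs]
  exact ⟨fun he => by rw [he]; exact h1 _ _, fun hlt => h2 _ _ _ hlt⟩

/-- The row `R_{ij₁}ᵗ R_{ij₂}ᵗ ⋯` for the sites `j₁, j₂, …` of a list. -/
def rtRow (q : F) (x : C) (v : Fin N → C) (i : Fin N) (l : List (Fin N)) :
    Matrix (Fin N → Fin N) (Fin N → Fin N) C :=
  (l.map fun j => twoSite i j (rtMat q N x (v j))).prod

lemma vecMul_rtRow_of_ne (x : C) (v : Fin N → C) (i : Fin N) (l : List (Fin N))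
    (φ : (Fin N → Fin N) → C) {h : Fin N → Fin N} (hne : ∀ j ∈ l, h i ≠ h j) :
    (φ ᵥ* rtRow q x v i l) h = (l.map fun j => x - v j).prod * φ h := by
  induction l generalizing φ with
  | nil => simp [rtRow]
  | cons j l ih =>
    rw [rtRow, List.map_cons, List.prod_cons, ← vecMul_vecMul]
    change ((φ ᵥ* twoSite i j (rtMat q N x (v j))) ᵥ* rtRow q x v i l) h = _
    rw [ih _ (fun j hj => hne j (by simp [hj])), vecMul_rtMat_of_ne _ _ _ (hne j (by simp)),
      List.map_cons, List.prod_cons]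
    ring

lemma QAlt.vecMul_rtRow {φ : (Fin N → Fin N) → C} {k k' : Fin N} (hφ : QAlt q k k' φ)
    (x : C) (v : Fin N → C) (i : Fin N) (l : List (Fin N)) (hi : i ∉ l) (hk : k ≠ i)
    (hk' : k' ≠ i) (hkl : k ∉ l) (hkl' : k' ∉ l) : QAlt q k k' (φ ᵥ* rtRow q x v i l) := by
  induction l generalizing φ with
  | nil => simpa [rtRow] using hφ
  | cons j l ih =>
    simp only [List.mem_cons, not_or] at hi hkl hkl'
    rw [rtRow, List.map_cons, List.prod_cons, ← vecMul_vecMul]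
    exact ih (hφ.vecMul_twoSite hi.1 hk hkl.1 hk' hkl'.1 _) hi.2 hkl.2 hkl'.2

lemma QAlt.vecMul_rtRow_split (hq : q ≠ 0) {φ : (Fin N → Fin N) → C} {k k' : Fin N}
    (hφ : QAlt q k k' φ) (x : C) (v : Fin N → C) (hv : v k' = (q ^ 2)⁻¹ • v k) (i : Fin N)
    (pre post : List (Fin N)) (hl : (i :: (pre ++ k :: k' :: post)).Nodup) :
    QAlt q k k' (φ ᵥ* rtRow q x v i (pre ++ k :: k' :: post)) := by
  simp only [List.nodup_cons, List.nodup_append, List.mem_append, List.mem_cons, not_or] at hl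
  obtain ⟨⟨hi1, hik, hik', hi2⟩, -, ⟨⟨hkk, hk2⟩, hk2', -⟩, hd⟩ := hl
  have e : rtRow q x v i (pre ++ k :: k' :: post) = rtRow q x v i pre *
      (twoSite i k (rtMat q N x (v k)) * twoSite i k' (rtMat q N x ((q ^ 2)⁻¹ • v k)) *
        rtRow q x v i post) := by
    simp [rtRow, hv, mul_assoc]
  rw [e, ← vecMul_vecMul, ← vecMul_vecMul, ← vecMul_vecMul]
  exact ((hφ.vecMul_rtRow x v i pre hi1 (Ne.symm hik) (Ne.symm hik')
    (fun h => hd k h k (by simp) rfl) (fun h => hd k' h k' (by simp) rfl)).vecMul_rtMat_rtMat hq x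
      (v k) hkk hik hik').vecMul_rtRow x v i post hi2 (Ne.symm hik) (Ne.symm hik') hk2 hk2'

/-- The orthogonal case: on words without repetition every factor is a scalar. -/
lemma vecMul_pairProd_rtMat_of_injective (x v : Fin N → C) (l : List (Fin N)) (hl : l.Nodup)
    (φ : (Fin N → Fin N) → C) {h : Fin N → Fin N} (hh : Injective h) :
    (φ ᵥ* pairProd (fun _ => 1) (fun i j => twoSite i j (rtMat q N (x i) (v j))) l) h =
      pairProd (fun _ => 1) (fun i j => x i - v j) l * φ h := by
  induction l generalizing φ with
  | nil => simp [pairProd]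
  | cons i l ih =>
    have hl' := List.nodup_cons.1 hl
    rw [pairProd, one_mul, ← vecMul_vecMul, ih hl'.2, pairProd, one_mul]
    change _ * (φ ᵥ* rtRow q (x i) v i l) h = _
    rw [vecMul_rtRow_of_ne _ _ _ _ _ fun j hj => hh.ne (ne_of_mem_of_not_mem hj hl'.1).symm]
    ring

lemma mem_finRange_drop {s : ℕ} {j : Fin N} : j ∈ (List.finRange N).drop s ↔ s ≤ j.val := by
  rw [List.mem_drop_iff_getElem]
  constructor
  · rintro ⟨i, hi, rfl⟩
    simp
  · intro h
    refine ⟨j.val - s, by simp; omega, ?_⟩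
    ext
    simp only [List.getElem_finRange, Fin.val_cast]
    omega

lemma finRange_drop_eq_cons {s : ℕ} (hs : s < N) :
    (List.finRange N).drop s = ⟨s, hs⟩ :: (List.finRange N).drop (s + 1) := by
  rw [List.drop_eq_getElem_cons (by simpa using hs)]
  simp

lemma finRange_drop_split {s : ℕ} {k k' : Fin N} (hs : s ≤ k.val) (hkk : k.val + 1 = k'.val) :
    ∃ pre post, (List.finRange N).drop s = pre ++ k :: k' :: post := by
  refine ⟨((List.finRange N).drop s).take (k.val - s), (List.finRange N).drop (k'.val + 1), ?_⟩
  conv_lhs => rw [← List.take_append_drop (k.val - s) ((List.finRange N).drop s)]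
  rw [List.drop_drop, Nat.add_sub_cancel' hs, finRange_drop_eq_cons k.isLt]
  simp only [hkk, finRange_drop_eq_cons k'.isLt]

lemma QAlt.vecMul_rtRow_drop (hq : q ≠ 0) {φ : (Fin N → Fin N) → C} {s : ℕ} (hs : s < N)
    {k k' : Fin N} (hsk : s < k.val) (hkk : k.val + 1 = k'.val)
    (hφ : QAlt q k k' φ) (x : C) (v : Fin N → C) (hv : v k' = (q ^ 2)⁻¹ • v k) :
    QAlt q k k' (φ ᵥ* rtRow q x v ⟨s, hs⟩ ((List.finRange N).drop (s + 1))) := by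
  obtain ⟨pre, post, h⟩ := finRange_drop_split (s := s + 1) hsk hkk
  rw [h]
  refine hφ.vecMul_rtRow_split hq x v hv _ pre post ?_
  rw [← h, ← finRange_drop_eq_cons hs]
  exact (List.nodup_finRange N).sublist (List.drop_sublist _ _)

/-- A function alternating in the sites `≥ s` vanishes if it vanishes on all words in which
the letter `b` either does not occur at the sites `≥ s`, or occurs at the site `s` only. -/
lemma QAlt.eq_zero_of_front (hq : q ≠ 0) {s : ℕ} {D : (Fin N → Fin N) → C}
    (hD : ∀ i j : Fin N, s ≤ i.val → i.val + 1 = j.val → QAlt q i j D) (h₀ : Fin N → Fin N)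
    (b : Fin N)
    (h1 : ∀ g : Fin N → Fin N, (∀ k, k.val < s → g k = h₀ k) → (∀ k, s ≤ k.val → g k ≠ b) → D g = 0)
    (h2 : ∀ g : Fin N → Fin N, (∀ k, k.val < s → g k = h₀ k) → ∀ hs : s < N, g ⟨s, hs⟩ = b →
      (∀ k, s < k.val → g k ≠ b) → D g = 0)
    (g : Fin N → Fin N) (hg : ∀ k, k.val < s → g k = h₀ k) : D g = 0 := by
  by_cases hb : ∀ k, s ≤ k.val → g k ≠ b
  · exact h1 g hg hb
  · push Not at hb
    obtain ⟨m, hm, hmb⟩ := hb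
    by_cases hu : ∃ m', s ≤ m'.val ∧ m' ≠ m ∧ g m' = b
    · obtain ⟨m', hm', hne, hmb'⟩ := hu
      rcases lt_or_gt_of_ne hne with h | h
      · exact QAlt.eq_zero_of_eq hq hD (m.val - (m'.val + 1)) g m' m hm'
          (Nat.add_sub_cancel' h) (hmb'.trans hmb.symm)
      · exact QAlt.eq_zero_of_eq hq hD (m'.val - (m.val + 1)) g m m' hm
          (Nat.add_sub_cancel' h) (hmb.trans hmb'.symm)
    · push Not at hu
      obtain ⟨d, hd⟩ := Nat.exists_eq_add_of_le hm
      induction d generalizing g m with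
      | zero =>
        have hs : s < N := by have := m.isLt; omega
        have hms : m = ⟨s, hs⟩ := Fin.ext hd
        subst hms
        exact h2 g hg hs hmb fun k hk => hu k hk.le fun e => by simp [e] at hk
      | succ d ih =>
        have hmN := m.isLt
        set m' : Fin N := ⟨m.val - 1, by omega⟩ with hm'
        have hv : m'.val + 1 = m.val := by simp only [hm']; omega
        have hsm' : s ≤ m'.val := by omega
        have hne : m' ≠ m := fun e => by rw [e] at hv; omega
        refine (hD m' m hsm' hv).swap_eq_zero hq (ih _ ?_ m' hsm' ?_ ?_ ?_)
        · intro k hk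
          rw [Function.comp_apply, Equiv.swap_apply_of_ne_of_ne _ _, hg k hk]
          · rintro rfl; omega
          · rintro rfl; omega
        · simpa using hmb
        · intro k hk hkm'
          by_cases hkm : k = m
          · subst hkm
            simpa using hu m' hsm' hne
          · simpa [Equiv.swap_apply_of_ne_of_ne hkm' hkm] using hu k hk hkm
        · omega

end TransposedRowProducts

section SymplecticScalar

open Function Matrix

variable {F : Type} [Field F] {q : F} {n : ℕ} {C : Type} [CommRing C] [Algebra F C]

/-- The involution `2k ↔ 2k+1` of the letters. -/
def partner (a : Fin (2 * n)) : Fin (2 * n) :=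
  if h : a.val % 2 = 0 then ⟨a.val + 1, by have := a.isLt; omega⟩
  else ⟨a.val - 1, by have := a.isLt; omega⟩

lemma partner_val (a : Fin (2 * n)) :
    (partner a).val = if a.val % 2 = 0 then a.val + 1 else a.val - 1 := by
  unfold partner; split_ifs <;> rfl

lemma partner_partner (a : Fin (2 * n)) : partner (partner a) = a := by
  ext
  rw [partner_val, partner_val]
  split_ifs <;> omega

lemma partner_ne (a : Fin (2 * n)) : partner a ≠ a := by
  intro h
  have := congrArg Fin.val h
  rw [partner_val] at this
  split_ifs at this <;> omega

/-- The matrix `q Σ E_{2k,2k+1} − Σ E_{2k+1,2k}` (0-based indices). -/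
def skewMat (q : F) (n : ℕ) : Matrix (Fin (2 * n)) (Fin (2 * n)) F :=
  Matrix.of fun i j => if j = partner i then (if i.val % 2 = 0 then q else -1) else 0

lemma vecMul_ampAt_skewMat (φ : (Fin (2 * n) → Fin (2 * n)) → C) (i : Fin (2 * n))
    (h : Fin (2 * n) → Fin (2 * n)) :
    (φ ᵥ* ampAt i ((skewMat q n).map (algebraMap F C))) h =
      (if (h i).val % 2 = 0 then -1 else q) • φ (update h i (partner (h i))) := by
  rw [vecMul_ampAt, Finset.sum_eq_single (partner (h i))]
  · have hv := partner_val (h i)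
    rw [Matrix.map_apply, skewMat, Matrix.of_apply, if_pos (partner_partner _).symm, mul_comm,
      ← Algebra.smul_def]
    congr 1
    by_cases h1 : (h i).val % 2 = 0
    · rw [if_pos h1] at hv
      rw [if_pos h1, if_neg (by omega)]
    · rw [if_neg h1] at hv
      rw [if_neg h1, if_pos (by omega)]
  · intro b _ hb
    have : h i ≠ partner b := fun e => hb (by rw [e, partner_partner])
    simp [skewMat, this]
  · simp

/-- The word `1,3,…,2n-1,0,2,…,2n-2`. -/
def oddEvenWord (n : ℕ) (k : Fin (2 * n)) : Fin (2 * n) :=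
  if h : k.val < n then ⟨2 * k.val + 1, by omega⟩ else ⟨2 * (k.val - n), by omega⟩

lemma oddEvenWord_val (k : Fin (2 * n)) :
    (oddEvenWord n k).val = if k.val < n then 2 * k.val + 1 else 2 * (k.val - n) := by
  unfold oddEvenWord; split_ifs <;> rfl

lemma partner_oddEvenWord_val (k : Fin (2 * n)) :
    (partner (oddEvenWord n k)).val = if k.val < n then 2 * k.val else 2 * (k.val - n) + 1 := by
  rw [partner_val, oddEvenWord_val]
  split_ifs <;> omega

/-- Replacement of the first `s` letters by their partners. -/
def partnerUpTo (s : ℕ) (g : Fin (2 * n) → Fin (2 * n)) (k : Fin (2 * n)) : Fin (2 * n) :=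
  if k.val < s then partner (g k) else g k

lemma oddEvenWord_injective : Injective (oddEvenWord n) := by
  intro a b h
  have h := congrArg Fin.val h
  rw [oddEvenWord_val, oddEvenWord_val] at h
  ext
  split_ifs at h <;> omega

lemma partner_injective : Injective (partner (n := n)) :=
  Function.LeftInverse.injective partner_partner

lemma wordInv_oddEvenWord :
    wordInv (oddEvenWord n) = wordInv (partner ∘ oddEvenWord n) + n := by
  let e : Fin n → Fin (2 * n) × Fin (2 * n) := fun a => (⟨a.val, by omega⟩, ⟨n + a.val, by omega⟩)
  have he : Injective e := by
    intro a b h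
    simpa [e, Fin.ext_iff] using h
  have key : (Finset.univ.filter fun p : Fin (2 * n) × Fin (2 * n) =>
        p.1 < p.2 ∧ oddEvenWord n p.2 < oddEvenWord n p.1) =
      (Finset.univ.filter fun p : Fin (2 * n) × Fin (2 * n) =>
        p.1 < p.2 ∧ (partner ∘ oddEvenWord n) p.2 < (partner ∘ oddEvenWord n) p.1) ∪
      Finset.univ.image e := by
    ext ⟨a, b⟩
    simp only [Finset.mem_filter, Finset.mem_univ, true_and, Finset.mem_union, Finset.mem_image,
      Fin.lt_def, Function.comp_apply, oddEvenWord_val, partner_oddEvenWord_val, e, Prod.mk.injEq,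
      Fin.ext_iff]
    constructor
    · rintro ⟨h1, h2⟩
      by_cases hab : b.val = n + a.val
      · exact Or.inr ⟨⟨a.val, by omega⟩, rfl, hab.symm⟩
      · left
        refine ⟨h1, ?_⟩
        split_ifs at h2 ⊢ <;> omega
    · rintro (⟨h1, h2⟩ | ⟨c, h1, h2⟩)
      · refine ⟨h1, ?_⟩
        split_ifs at h2 ⊢ <;> omega
      · have := c.isLt
        refine ⟨by omega, ?_⟩
        split_ifs <;> omega
  unfold wordInv
  rw [key, Finset.card_union_of_disjoint, Finset.card_image_of_injective _ he, Finset.card_univ,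
    Fintype.card_fin]
  rw [Finset.disjoint_left]
  rintro ⟨a, b⟩ h1 h2
  simp only [Finset.mem_filter, Finset.mem_univ, true_and, Finset.mem_image, Fin.lt_def,
    Function.comp_apply, partner_oddEvenWord_val, e, Prod.mk.injEq, Fin.ext_iff] at h1 h2
  obtain ⟨c, h3, h4⟩ := h2
  have := c.isLt
  have h1 := h1.2
  split_ifs at h1 <;> omega

/-- The scalar contributed by the site `k` in the symplectic case. -/
def skewFactor (q : F) (n : ℕ) (x v : ℕ → C) (s : ℕ) : C :=
  if s < n then ((q ^ 2)⁻¹ • x s - q ^ 2 • v (s + 1)) *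
      (((List.finRange (2 * n)).drop (s + 2)).map fun j => x s - v j.val).prod
  else -(((List.finRange (2 * n)).drop (s + 1)).map fun j => x s - v j.val).prod

/-- The shape of the row vector after the first `s` sites have been treated. -/
def SkewState (q : F) (n s : ℕ) (c : C) (φ : (Fin (2 * n) → Fin (2 * n)) → C) : Prop :=
  (∀ k k' : Fin (2 * n), s ≤ k.val → k.val + 1 = k'.val → QAlt q k k' φ) ∧
    ∀ g : Fin (2 * n) → Fin (2 * n), (∀ k, k.val < s → g k = oddEvenWord n k) →
      φ g = qSign q (partnerUpTo s g) • c

lemma SkewState.step (hq : q ≠ 0) {x v : ℕ → C} (hv : ∀ k, v (k + 1) = (q ^ 2)⁻¹ • v k)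
    {s : ℕ} (hs : s < 2 * n) {c : C} {φ : (Fin (2 * n) → Fin (2 * n)) → C}
    (h : SkewState q n s c φ) :
    SkewState q n (s + 1) (c * skewFactor q n x v s)
      (φ ᵥ* ampAt ⟨s, hs⟩ ((skewMat q n).map (algebraMap F C)) ᵥ*
        rtRow q (x s) (fun j => v j.val) ⟨s, hs⟩ ((List.finRange (2 * n)).drop (s + 1))) := by
  obtain ⟨hA, hB⟩ := h
  set i : Fin (2 * n) := ⟨s, hs⟩ with hi
  set ψ := φ ᵥ* ampAt i ((skewMat q n).map (algebraMap F C)) with hψ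
  have hA' : ∀ k k' : Fin (2 * n), s + 1 ≤ k.val → k.val + 1 = k'.val → QAlt q k k'
      (ψ ᵥ* rtRow q (x s) (fun j => v j.val) i ((List.finRange (2 * n)).drop (s + 1))) := by
    intro k k' hk hkk
    refine QAlt.vecMul_rtRow_drop hq hs hk hkk ?_ _ _ (by rw [← hkk, hv])
    refine (hA k k' (by omega) hkk).vecMul_ampAt ?_ ?_ _
    · rintro rfl; simp [hi] at hk
    · rintro rfl; simp only [hi] at hkk; omega
  have hψg : ∀ g : Fin (2 * n) → Fin (2 * n), (∀ k, k.val < s → g k = oddEvenWord n k) →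
      ψ g = (if (g i).val % 2 = 0 then -1 else q) • qSign q (partnerUpTo (s + 1) g) • c := by
    intro g hg
    rw [hψ, vecMul_ampAt_skewMat, hB]
    · congr 3
      funext k
      rcases lt_trichotomy k.val s with hk | hk | hk
      · have : k ≠ i := by rintro rfl; simp [hi] at hk
        simp [partnerUpTo, hk, this, Nat.lt_succ_of_lt hk]
      · obtain rfl : k = i := Fin.ext hk
        simp [partnerUpTo, hi]
      · have : k ≠ i := by rintro rfl; simp [hi] at hk
        simp [partnerUpTo, hk.not_gt, this, show ¬ k.val < s + 1 by omega]
    · intro k hk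
      have : k ≠ i := by rintro rfl; simp [hi] at hk
      simp [this, hg k hk]
  refine ⟨hA', fun g hg => ?_⟩
  rw [← sub_eq_zero]
  refine QAlt.eq_zero_of_front (s := s + 1) hq (D := fun g =>
    (ψ ᵥ* rtRow q (x s) (fun j => v j.val) i ((List.finRange (2 * n)).drop (s + 1))) g -
      qSign q (partnerUpTo (s + 1) g) • (c * skewFactor q n x v s)) ?_ (oddEvenWord n)
      (oddEvenWord n i) ?_ ?_ g hg
  · intro k k' hk hkk
    refine (hA' k k' hk hkk).sub ?_
    intro w
    have h1 := qAlt_qSign q hkk (partnerUpTo (s + 1) w)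
    have e1 : partnerUpTo (s + 1) w k = w k := if_neg (by omega)
    have e2 : partnerUpTo (s + 1) w k' = w k' := if_neg (by omega)
    have e3 : partnerUpTo (s + 1) (w ∘ Equiv.swap k k') =
        partnerUpTo (s + 1) w ∘ Equiv.swap k k' := by
      funext m
      by_cases hm : m = k
      · subst hm
        simp [partnerUpTo, show ¬ m.val < s + 1 by omega, show ¬ k'.val < s + 1 by omega]
      · by_cases hm' : m = k'
        · subst hm'
          simp [partnerUpTo, show ¬ m.val < s + 1 by omega, show ¬ k.val < s + 1 by omega]
        · simp [partnerUpTo, Equiv.swap_apply_of_ne_of_ne hm hm']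
    rw [e1, e2] at h1
    refine ⟨fun he => ?_, fun hlt => ?_⟩
    · simp only [h1.1 he, zero_smul]
    · simp only [e3, h1.2 hlt, smul_assoc]
  · intro g hg hgb
    have hgi : g i = oddEvenWord n i := hg i (by simp [hi])
    rw [vecMul_rtRow_of_ne, hψg g fun k hk => hg k (by omega), hgi, oddEvenWord_val]
    · by_cases hsn : s < n
      · have h0 : qSign q (partnerUpTo (s + 1) g) = 0 := by
          refine qSign_of_not_injective q fun hinj => ?_
          obtain ⟨k, hk⟩ := (Finite.injective_iff_surjective.1 hinj) (oddEvenWord n i)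
          unfold partnerUpTo at hk
          split_ifs at hk with h1
          · rw [hg k h1] at hk
            have := congrArg Fin.val hk
            rw [partner_oddEvenWord_val, oddEvenWord_val] at this
            simp only [hi] at this
            split_ifs at this <;> omega
          · exact hgb k (by omega) hk
        simp [h0]
      · simp only [hi, hsn, if_false, skewFactor]
        simp only [Nat.mul_mod_right, if_true, mul_neg, neg_smul, one_smul, smul_neg, mul_smul_comm]
        rw [sub_eq_zero]
        simp only [Algebra.smul_def]
        ring
    · intro j hj
      rw [mem_finRange_drop] at hj
      rw [hgi]
      exact (hgb j hj).symm
  · intro g hg hs1 hgs hgb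
    have hgi : g i = oddEvenWord n i := hg i (by simp [hi])
    set i1 : Fin (2 * n) := ⟨s + 1, hs1⟩ with hi1
    have hii : i ≠ i1 := by simp [hi, hi1]
    set b := oddEvenWord n i with hb
    let w : Fin (2 * n) → Fin (2 * n) → Fin (2 * n) := fun d =>
      partnerUpTo (s + 1) (update (update g i d) i1 d)
    have hwlt : ∀ d (k : Fin (2 * n)), k.val < s → w d k = partner (oddEvenWord n k) := by
      intro d k hk
      have h1 : k ≠ i := by rintro rfl; simp [hi] at hk
      have h2 : k ≠ i1 := by rintro rfl; simp only [hi1] at hk; omega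
      simp [w, partnerUpTo, h1, h2, hg k (by omega), show k.val < s + 1 by omega]
    have hwi : ∀ d, w d i = partner d := by
      intro d
      simp [w, partnerUpTo, hii, show i.val = s from rfl]
    have hwi1 : ∀ d, w d i1 = d := by
      intro d
      simp [w, partnerUpTo, show i1.val = s + 1 from rfl]
    have hwgt : ∀ d (k : Fin (2 * n)), s + 1 < k.val → w d k = g k := by
      intro d k hk
      have h1 : k ≠ i := by rintro rfl; simp only [hi] at hk; omega
      have h2 : k ≠ i1 := by rintro rfl; simp [hi1] at hk
      simp [w, partnerUpTo, h1, h2, show ¬ k.val < s + 1 by omega]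
    have hwb : partnerUpTo (s + 1) g = w b := by
      simp only [w]
      congr 1
      rw [← hgi, update_eq_self, hgi, ← hgs, update_eq_self]
    have hsum : (ψ ᵥ* rtRow q (x s) (fun j => v j.val) i
        ((List.finRange (2 * n)).drop (s + 1))) g =
        (((List.finRange (2 * n)).drop (s + 2)).map fun j => x s - v j.val).prod *
          ∑ d, rtCoef q (x s) (v (s + 1)) b d *
            ((if d.val % 2 = 0 then -1 else q) • qSign q (w d) • c) := by
      rw [finRange_drop_eq_cons hs1, rtRow, List.map_cons, List.prod_cons, ← vecMul_vecMul]
      change ((ψ ᵥ* twoSite i i1 (rtMat q (2 * n) (x s) (v (s + 1)))) ᵥ*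
        rtRow q (x s) (fun j => v j.val) i ((List.finRange (2 * n)).drop (s + 2))) g = _
      rw [vecMul_rtRow_of_ne, vecMul_rtMat _ hii, if_pos (by rw [hgi, hgs]), hgi]
      · congr 1
        refine Finset.sum_congr rfl fun d _ => ?_
        rw [hψg]
        · simp [hii, w]
        · intro k hk
          have h1 : k ≠ i := by rintro rfl; simp [hi] at hk
          have h2 : k ≠ i1 := by rintro rfl; simp only [hi1] at hk; omega
          simp [h1, h2, hg k (by omega)]
      · intro j hj
        rw [mem_finRange_drop] at hj
        rw [hgi]
        exact (hgb j (by omega)).symm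
    rw [hsum, hwb]
    by_cases hsn : s < n
    · have hbv : b.val = 2 * s + 1 := by rw [hb, oddEvenWord_val]; simp [hi, hsn]
      have hbv' : (partner b).val = 2 * s := by
        rw [partner_val, if_neg (by omega), hbv]; rfl
      have h0 : ∀ d, d ≠ b → d ≠ partner b → qSign q (w d) = 0 := by
        intro d h1 h2
        refine qSign_of_not_injective q fun hinj => ?_
        obtain ⟨k, hk⟩ := (Finite.injective_iff_surjective.1 hinj) b
        rcases lt_trichotomy k.val s with hks | hks | hks
        · rw [hwlt d k hks] at hk
          have := congrArg Fin.val hk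
          rw [partner_oddEvenWord_val, if_pos (by omega)] at this
          omega
        · obtain rfl : k = i := Fin.ext hks
          rw [hwi] at hk
          exact h2 (by rw [← hk, partner_partner])
        · by_cases hk1 : k.val = s + 1
          · obtain rfl : k = i1 := Fin.ext hk1
            exact h1 (by rw [← hk, hwi1])
          · rw [hwgt d k (by omega)] at hk
            exact hgb k (by omega) hk
      have hsw : w (partner b) = w b ∘ Equiv.swap i i1 := by
        funext k
        rw [Function.comp_apply]
        rcases lt_trichotomy k.val s with hks | hks | hks
        · rw [Equiv.swap_apply_of_ne_of_ne _ _, hwlt _ _ hks, hwlt _ _ hks]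
          · rintro rfl; simp [hi] at hks
          · rintro rfl; simp only [hi1] at hks; omega
        · obtain rfl : k = i := Fin.ext hks
          rw [Equiv.swap_apply_left, hwi, hwi1, partner_partner]
        · by_cases hk1 : k.val = s + 1
          · obtain rfl : k = i1 := Fin.ext hk1
            rw [Equiv.swap_apply_right, hwi, hwi1]
          · rw [Equiv.swap_apply_of_ne_of_ne _ _, hwgt _ _ (by omega), hwgt _ _ (by omega)]
            · rintro rfl; simp [hi] at hks
            · rintro rfl; simp [hi1] at hk1
      have hη : qSign q (w (partner b)) = (-q)⁻¹ • qSign q (w b) := by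
        rw [hsw]
        refine ((qAlt_qSign q (i := i) (j := i1) rfl) (w b)).2 ?_
        rw [hwi, hwi1, Fin.lt_def]
        omega
      rw [Finset.sum_eq_add b (partner b) (partner_ne b).symm _ (by simp) (by simp)]
      · have hlt : partner b < b := by rw [Fin.lt_def]; omega
        rw [hη, rtCoef, if_pos rfl, rtCoef, if_neg hlt.ne, if_pos hlt, hbv, hbv',
          if_neg (by omega), if_pos (by omega), skewFactor, if_pos hsn, smul_eq_mul]
        simp only [Algebra.smul_def, map_mul, map_sub, map_neg, map_one, map_pow]
        set p := algebraMap F C q with hp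
        set p' := algebraMap F C q⁻¹ with hp'
        have hpp : p * p' = 1 := by rw [hp, hp', ← map_mul, mul_inv_cancel₀ hq, map_one]
        rw [inv_neg, map_neg, ← hp', ← inv_pow, map_pow, ← hp']
        set P := (((List.finRange (2 * n)).drop (s + 2)).map fun j => x s - v j.val).prod
        clear_value P p p'
        clear hwb hsum
        generalize (algebraMap F C) (qSign q (w b)) = e
        generalize x s = X
        generalize v (s + 1) = V
        grind
      · rintro d - ⟨h1, h2⟩
        rw [h0 d h1 h2]
        simp
    · have h0 : ∀ d, qSign q (w d) = 0 := by
        intro d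
        refine qSign_of_not_injective q fun hinj => ?_
        have hd := partner_val d
        by_cases hd2 : d.val % 2 = 0
        · have hm : d.val / 2 < s := by omega
          have : (⟨d.val / 2, by omega⟩ : Fin (2 * n)) = i1 := by
            refine hinj (Fin.ext ?_)
            rw [hwi1, hwlt _ _ hm, partner_oddEvenWord_val, if_pos (by simp; omega)]
            simp only
            omega
          simp [hi1, Fin.ext_iff] at this
          omega
        · rw [if_neg hd2] at hd
          by_cases hm : d.val / 2 < s
          · have : (⟨d.val / 2, by omega⟩ : Fin (2 * n)) = i := by
              refine hinj (Fin.ext ?_)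
              rw [hwi, hwlt _ _ hm, partner_oddEvenWord_val, if_pos (by simp; omega)]
              simp only
              omega
            simp [hi, Fin.ext_iff] at this
            omega
          · omega
      simp [h0]

lemma SkewState.pairProd (hq : q ≠ 0) {x v : ℕ → C} (hv : ∀ k, v (k + 1) = (q ^ 2)⁻¹ • v k)
    (d : ℕ) {s : ℕ} (hs : s + d = 2 * n) {c : C} {φ : (Fin (2 * n) → Fin (2 * n)) → C}
    (h : SkewState q n s c φ) :
    SkewState q n (2 * n) (c * (((List.finRange (2 * n)).drop s).map fun k =>
        skewFactor q n x v k.val).prod)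
      (φ ᵥ* _root_.pairProd (fun i => ampAt i ((skewMat q n).map (algebraMap F C)))
        (fun i j => twoSite i j (rtMat q (2 * n) (x i.val) (v j.val)))
        ((List.finRange (2 * n)).drop s)) := by
  induction d generalizing s c φ with
  | zero =>
    obtain rfl : s = 2 * n := by omega
    have e : (List.finRange (2 * n)).drop (2 * n) = [] := by simp
    rw [e]
    simpa [_root_.pairProd] using h
  | succ d ih =>
    have hs' : s < 2 * n := by omega
    have := ih (by omega) (h.step hq hv hs' (x := x))
    rw [finRange_drop_eq_cons hs', _root_.pairProd, List.map_cons, List.prod_cons,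
      ← vecMul_vecMul, ← vecMul_vecMul, ← mul_assoc]
    exact this

/-- The value of the row `qSign` times the symplectic scalar product at the word
`1,3,…,2n-1,0,2,…,2n-2`. -/
lemma qSign_vecMul_pairProd_skewMat (hq : q ≠ 0) {x v : ℕ → C}
    (hv : ∀ k, v (k + 1) = (q ^ 2)⁻¹ • v k) :
    ((fun h => algebraMap F C (qSign q h)) ᵥ*
      pairProd (fun i => ampAt i ((skewMat q n).map (algebraMap F C)))
        (fun i j => twoSite i j (rtMat q (2 * n) (x i.val) (v j.val)))
        (List.finRange (2 * n))) (oddEvenWord n) =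
      qSign q (oddEvenWord n) • (-q) ^ n • ((List.finRange (2 * n)).map fun k =>
        skewFactor q n x v k.val).prod := by
  have h0 : SkewState q n 0 (1 : C) (fun h => algebraMap F C (qSign q h)) := by
    refine ⟨fun k k' _ hkk h => ?_, fun g _ => ?_⟩
    · obtain ⟨h1, h2⟩ := qAlt_qSign q hkk h
      refine ⟨fun he => by simp only [h1 he, map_zero], fun hlt => ?_⟩
      simp only [h2 hlt, smul_eq_mul, map_mul, Algebra.smul_def]
    · exact Algebra.algebraMap_eq_smul_one _
  have := (h0.pairProd hq hv (x := x) (2 * n) (by omega)).2 (oddEvenWord n) (fun _ _ => rfl)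
  rw [List.drop_zero, one_mul] at this
  rw [this, smul_smul]
  congr 1
  have e : partnerUpTo (2 * n) (oddEvenWord n) = partner ∘ oddEvenWord n := by
    funext k
    simp [partnerUpTo, k.isLt]
  rw [e, qSign_of_injective q oddEvenWord_injective,
    qSign_of_injective q (partner_injective.comp oddEvenWord_injective), wordInv_oddEvenWord,
    pow_add, mul_assoc, ← mul_pow, inv_mul_cancel₀ (neg_ne_zero.2 hq), one_pow, mul_one]

end SymplecticScalar

section Telescoping

open PowerSeries

lemma pairProd_one_finRange_drop {M : Type} [Monoid M] {N : ℕ} (f : ℕ → ℕ → M) (d : ℕ) {s : ℕ}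
    (hs : s + d = N) :
    pairProd (fun _ : Fin N => (1 : M)) (fun i j => f i.val j.val) ((List.finRange N).drop s) =
      (((List.finRange N).drop s).map fun k =>
        (((List.finRange N).drop (k.val + 1)).map fun j => f k.val j.val).prod).prod := by
  induction d generalizing s with
  | zero =>
    have e : (List.finRange N).drop s = [] := by simp; omega
    rw [e]
    rfl
  | succ d ih =>
    have hs' : s < N := by omega
    rw [finRange_drop_eq_cons hs', pairProd, ih (by omega), one_mul, List.map_cons,
      List.prod_cons]

variable {F : Type} [Field F] {q : F}

/-- The spectral parameter `(q^{-2k}u)⁻²` (0-based `k`) as a power series in `u⁻¹`. -/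
def specX (q : F) (k : ℕ) : F⟦X⟧ := q ^ (2 * (k : ℤ)) • X ^ 2

def specV (q : F) (k : ℕ) : F⟦X⟧ := q ^ (-2 * (k : ℤ)) • 1

lemma specV_succ (hq : q ≠ 0) (k : ℕ) : specV q (k + 1) = (q ^ 2)⁻¹ • specV q k := by
  have : (q ^ 2)⁻¹ = q ^ (-2 : ℤ) := by rw [zpow_neg, zpow_ofNat]
  rw [specV, specV, smul_smul, this, ← zpow_add₀ hq]
  congr 2
  push_cast
  ring

/-- The polynomial part of `γ_N(u)` as a power series in `u⁻¹`. -/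
def gammaSeries (q : F) (N : ℕ) : F⟦X⟧ :=
  pairProd (fun _ => 1) (fun i j => specX q i.val - specV q j.val) (List.finRange N)

lemma prod_skewFactor_mul (hq : q ≠ 0) (n : ℕ) :
    ((-q) ^ n • ((List.finRange (2 * n)).map fun k =>
        skewFactor q n (specX q) (specV q) k.val).prod) *
      (q ^ (2 * (n : ℤ) - 2) • X ^ 2 - q ^ (-2 * (n : ℤ)) • 1) =
      gammaSeries q (2 * n) * (q ^ ((n : ℤ) - 2) • X ^ 2 - q ^ (n : ℤ) • 1) := by
  let rowProd : ℕ → F⟦X⟧ := fun s =>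
    (((List.finRange (2 * n)).drop (s + 1)).map fun j => specX q s - specV q j.val).prod
  let D : ℕ → F⟦X⟧ := fun m => q ^ (2 * (m : ℤ) - 2) • X ^ 2 - q ^ (-2 * (m : ℤ)) • 1
  have hγ : gammaSeries q (2 * n) = ∏ i ∈ Finset.range (2 * n), rowProd i := by
    have := pairProd_one_finRange_drop (N := 2 * n) (fun i j => specX q i - specV q j) (2 * n)
      (s := 0) (by omega)
    rw [List.drop_zero] at this
    rw [gammaSeries, this, ← Fin.prod_univ_def, ← Fin.prod_univ_eq_prod_range]
  have hstep : ∀ s < n, skewFactor q n (specX q) (specV q) s * D (s + 1) = D s * rowProd s := by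
    intro s hs
    have h1 : D (s + 1) = specX q s - specV q (s + 1) := by
      simp only [D, specX, specV]
      congr 3
      push_cast
      ring
    have h2 : D s = (q ^ 2)⁻¹ • specX q s - q ^ 2 • specV q (s + 1) := by
      have e1 : (q ^ 2)⁻¹ = q ^ (-2 : ℤ) := by rw [zpow_neg, zpow_ofNat]
      have e2 : q ^ 2 = q ^ (2 : ℤ) := (zpow_ofNat q 2).symm
      simp only [D, specX, specV, smul_smul]
      rw [e1, e2, ← zpow_add₀ hq, ← zpow_add₀ hq]
      congr 3
      push_cast
      ring
    simp only [rowProd]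
    rw [skewFactor, if_pos hs, h2, h1, finRange_drop_eq_cons (show s + 1 < 2 * n by omega),
      List.map_cons, List.prod_cons]
    ring
  have htel : ∀ m ≤ n, (∏ i ∈ Finset.range m, skewFactor q n (specX q) (specV q) i) * D m =
      D 0 * ∏ i ∈ Finset.range m, rowProd i := by
    intro m hm
    induction m with
    | zero => simp
    | succ m ih =>
      rw [Finset.prod_range_succ, Finset.prod_range_succ, mul_assoc, hstep m (by omega),
        ← mul_assoc, ih (by omega), mul_assoc]
  have hneg : ∏ i ∈ Finset.range n, skewFactor q n (specX q) (specV q) (n + i) =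
      (-1) ^ n * ∏ i ∈ Finset.range n, rowProd (n + i) := by
    have e : ((-1 : F⟦X⟧)) ^ n = ∏ _i ∈ Finset.range n, (-1 : F⟦X⟧) := by simp
    rw [e, ← Finset.prod_mul_distrib]
    refine Finset.prod_congr rfl fun i _ => ?_
    rw [skewFactor, if_neg (by omega), neg_one_mul]
  have hs : ((List.finRange (2 * n)).map fun k =>
      skewFactor q n (specX q) (specV q) k.val).prod =
      ∏ i ∈ Finset.range (2 * n), skewFactor q n (specX q) (specV q) i := by
    rw [← Fin.prod_univ_def, ← Fin.prod_univ_eq_prod_range]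
  have hD0 : q ^ n • D 0 = q ^ ((n : ℤ) - 2) • X ^ 2 - q ^ (n : ℤ) • 1 := by
    simp only [D, smul_sub, smul_smul]
    rw [← zpow_natCast, ← zpow_add₀ hq, ← zpow_add₀ hq]
    congr 3
  have hsgn : (-q) ^ n = q ^ n * (-1) ^ n := by rw [← mul_pow, mul_neg_one]
  change _ * D n = _
  rw [hs, hγ, ← hD0, two_mul, Finset.prod_range_add, Finset.prod_range_add, hneg, hsgn]
  have h11 : ((-1 : F) ^ n) • ((-1 : F⟦X⟧) ^ n) = 1 := by
    rw [Algebra.smul_def, map_pow, map_neg, map_one, ← mul_pow]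
    simp
  calc _ = q ^ n • (((-1 : F) ^ n) • ((-1 : F⟦X⟧) ^ n)) *
        ((∏ i ∈ Finset.range n, skewFactor q n (specX q) (specV q) i) * D n) *
          ∏ i ∈ Finset.range n, rowProd (n + i) := by
        simp only [Algebra.smul_def, map_mul]
        ring
    _ = _ := by
        rw [htel n le_rfl, h11]
        simp only [Algebra.smul_def]
        ring

end Telescoping

section SeriesProducts

open PowerSeries

variable {M : Type} [Ring M]

/-- A series supported in degrees `≤ 1`, divided by `u`, as a power series in `u⁻¹`. -/
def toPS (c : ℤ → M) : M⟦X⟧ := PowerSeries.mk fun k => c (1 - k)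

lemma coeff_toPS (c : ℤ → M) (k : ℕ) : coeff k (toPS c) = c (1 - k) := coeff_mk _ _

lemma seriesProdCoeff_length_sub (L : List (ℤ → M)) (k : ℕ) :
    seriesProdCoeff L (L.length - k) = coeff k (L.map toPS).prod := by
  induction L generalizing k with
  | nil =>
    rcases Nat.eq_zero_or_pos k with rfl | hk
    · simp [seriesProdCoeff]
    · simp [seriesProdCoeff, coeff_one, hk.ne']
  | cons c t ih =>
    rw [seriesProdCoeff, List.map_cons, List.prod_cons, PowerSeries.coeff_mul,
      Finset.Nat.sum_antidiagonal_eq_sum_range_succ_mk]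
    symm
    refine Finset.sum_bij (fun i _ => (1 - i : ℤ)) ?_ ?_ ?_ ?_
    · intro i hi
      simp only [Finset.mem_range] at hi
      simp only [Finset.mem_Icc, List.length_cons]
      push_cast
      omega
    · intro i _ j _ h
      omega
    · intro b hb
      simp only [Finset.mem_Icc, List.length_cons] at hb
      push_cast at hb
      refine ⟨(1 - b).toNat, ?_, by omega⟩
      simp only [Finset.mem_range]
      omega
    · intro i hi
      simp only [Finset.mem_range] at hi
      rw [coeff_toPS, ← ih]
      congr 2
      simp only [List.length_cons]
      push_cast [Nat.le_of_lt_succ hi]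
      ring

lemma seriesProdCoeff_of_length_lt (L : List (ℤ → M)) {m : ℤ} (hm : L.length < m) :
    seriesProdCoeff L m = 0 := by
  cases L with
  | nil => exact if_neg (by simp at hm; omega)
  | cons c t =>
    simp only [List.length_cons] at hm
    push_cast at hm
    rw [seriesProdCoeff, Finset.Icc_eq_empty (by omega), Finset.sum_empty]

lemma eq_seriesProdCoeff {s : ℤ → M} {l : ℕ} {L : List (ℤ → M)} {P : M⟦X⟧}
    (hs : ∀ m : ℤ, l < m → s m = 0) (hP : ∀ k : ℕ, coeff k P = s (l - k))
    (h : X ^ L.length * P = X ^ l * (L.map toPS).prod) (m : ℤ) : s m = seriesProdCoeff L m := by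
  rcases le_or_gt m (l + L.length : ℤ) with hm | hm
  · obtain ⟨k, hk⟩ := Int.eq_ofNat_of_zero_le (sub_nonneg.2 hm)
    have h := congrArg (coeff k) h
    rw [coeff_X_pow_mul', coeff_X_pow_mul'] at h
    have h1 : (if L.length ≤ k then coeff (k - L.length) P else 0) = s m := by
      split_ifs with hc
      · rw [hP]
        congr 1
        push_cast [hc]
        omega
      · rw [hs _ (by omega)]
    have h2 : (if l ≤ k then coeff (k - l) (L.map toPS).prod else 0) = seriesProdCoeff L m := by
      split_ifs with hc
      · rw [← seriesProdCoeff_length_sub]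
        congr 1
        push_cast [hc]
        omega
      · rw [seriesProdCoeff_of_length_lt _ (by omega)]
    rw [← h1, ← h2, h]
  · rw [hs _ (by omega), seriesProdCoeff_of_length_lt _ (by omega)]

variable {W : Type} [Fintype W] [DecidableEq W]

/-- Power series with matrix coefficients as matrices of power series. -/
def matrixSeries : (Matrix W W M)⟦X⟧ →+* Matrix W W M⟦X⟧ where
  toFun f := Matrix.of fun i j => PowerSeries.mk fun k => coeff k f i j
  map_zero' := by ext; simp
  map_add' _ _ := by ext; simp
  map_one' := by
    ext i j k
    by_cases hij : i = j
    · subst hij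
      by_cases hk : k = 0 <;> simp [coeff_one, hk]
    · by_cases hk : k = 0 <;> simp [coeff_one, hk, hij]
  map_mul' f g := by
    ext i j k
    simp only [Matrix.of_apply, coeff_mk, PowerSeries.coeff_mul, Matrix.mul_apply, map_sum,
      Matrix.sum_apply]
    exact Finset.sum_comm

lemma coeff_matrixSeries (f : (Matrix W W M)⟦X⟧) (i j : W) (k : ℕ) :
    coeff k (matrixSeries f i j) = coeff k f i j := by
  simp [matrixSeries]

variable {F : Type} [Field F] [Algebra F M]

/-- The inclusion of scalar power series. -/
def scalarSeries (F M : Type) [Field F] [Ring M] [Algebra F M] : F⟦X⟧ →ₐ[F] M⟦X⟧ where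
  toRingHom := PowerSeries.map (algebraMap F M)
  commutes' r := by
    ext k
    simp [PowerSeries.algebraMap_apply, coeff_C]

lemma coeff_scalarSeries (f : F⟦X⟧) (k : ℕ) :
    coeff k (scalarSeries F M f) = algebraMap F M (coeff k f) :=
  PowerSeries.coeff_map _ _ _

lemma scalarSeries_commute (f : F⟦X⟧) (g : M⟦X⟧) : Commute (scalarSeries F M f) g := by
  ext k
  rw [PowerSeries.coeff_mul, PowerSeries.coeff_mul, ← Finset.Nat.sum_antidiagonal_swap]
  refine Finset.sum_congr rfl fun p _ => ?_
  simp only [coeff_scalarSeries, Prod.fst_swap, Prod.snd_swap]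
  exact Algebra.commutes _ _

end SeriesProducts

section AffineRelations

variable {F : Type} [Field F] {q : F} {N : ℕ} {A B : Type} [Ring A] [Algebra F A] [Ring B]
  [Algebra F B]

lemma map_amp1 (f : A →+* B) (M : Matrix (Fin N) (Fin N) A) : (amp1 M).map f = amp1 (M.map f) := by
  ext p r
  simp only [amp1, Matrix.map_apply, Matrix.of_apply]
  split_ifs <;> simp

lemma map_amp2 (f : A →+* B) (M : Matrix (Fin N) (Fin N) A) : (amp2 M).map f = amp2 (M.map f) := by
  ext p r
  simp only [amp2, Matrix.map_apply, Matrix.of_apply]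
  split_ifs <;> simp

lemma mapMatrix_z1 (f : A →ₐ[F] B) (X : ℕ → Matrix (Fin N) (Fin N) A) (a : ℤ) :
    f.mapMatrix (z1 X a) = z1 (fun r => (X r).map f) a := by
  unfold z1
  split_ifs
  · exact map_amp1 (f : A →+* B) _
  · exact map_zero _

lemma mapMatrix_z2 (f : A →ₐ[F] B) (X : ℕ → Matrix (Fin N) (Fin N) A) (a : ℤ) :
    f.mapMatrix (z2 X a) = z2 (fun r => (X r).map f) a := by
  unfold z2
  split_ifs
  · exact map_amp2 (f : A →+* B) _
  · exact map_zero _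

lemma mapMatrix_liftF {m : Type} [Fintype m] [DecidableEq m] (f : A →ₐ[F] B) (M : Matrix m m F) :
    f.mapMatrix (liftF F M) = liftF F M := by
  ext p r
  exact f.commutes _

lemma map_affRttL (f : A →ₐ[F] B) (X Y : ℕ → Matrix (Fin N) (Fin N) A) (a b a' b' : ℤ) :
    (affRttL F q X Y a b a' b').map f =
      affRttL F q (fun r => (X r).map f) (fun r => (Y r).map f) a b a' b' := by
  change f.mapMatrix _ = _
  simp only [affRttL, map_sub, map_mul, mapMatrix_z1, mapMatrix_z2, mapMatrix_liftF]

lemma map_affRttR (f : A →ₐ[F] B) (X Y : ℕ → Matrix (Fin N) (Fin N) A) (a b a' b' : ℤ) :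
    (affRttR F q X Y a b a' b').map f =
      affRttR F q (fun r => (X r).map f) (fun r => (Y r).map f) a b a' b' := by
  change f.mapMatrix _ = _
  simp only [affRttR, map_sub, map_mul, mapMatrix_z1, mapMatrix_z2, mapMatrix_liftF]

/-- The matrix of coefficients of `u^{-r}` in `T(u)`. -/
def tMat (F : Type) [Field F] (q : F) (N r : ℕ) : Matrix (Fin N) (Fin N) (UqAff F q N) :=
  Matrix.of (tA F q N r)

/-- The matrix of coefficients of `u^r` in `T̄(u)`. -/
def tbMat (F : Type) [Field F] (q : F) (N r : ℕ) : Matrix (Fin N) (Fin N) (UqAff F q N) :=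
  Matrix.of (tbA F q N r)

lemma affRttL_tMat_tMat (a b : ℤ) :
    affRttL F q (tMat F q N) (tMat F q N) (1 - a) (-b) (-a) (1 - b) =
      affRttR F q (tMat F q N) (tMat F q N) (1 - a) (-b) (-a) (1 - b) := by
  have h1 := map_affRttL (q := q) (RingQuot.mkAlgHom F (AffGlRel F q N)) (TfA F N) (TfA F N)
    (1 - a) (-b) (-a) (1 - b)
  have h2 := map_affRttR (q := q) (RingQuot.mkAlgHom F (AffGlRel F q N)) (TfA F N) (TfA F N)
    (1 - a) (-b) (-a) (1 - b)
  change _ = affRttL F q (tMat F q N) (tMat F q N) _ _ _ _ at h1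
  change _ = affRttR F q (tMat F q N) (tMat F q N) _ _ _ _ at h2
  rw [← h1, ← h2]
  ext p r
  exact RingQuot.mkAlgHom_rel F (AffGlRel.rtt a b p r)

lemma affRttL_tbMat_tbMat (a b : ℤ) :
    affRttL F q (tbMat F q N) (tbMat F q N) (a - 1) b a (b - 1) =
      affRttR F q (tbMat F q N) (tbMat F q N) (a - 1) b a (b - 1) := by
  have h1 := map_affRttL (q := q) (RingQuot.mkAlgHom F (AffGlRel F q N)) (TbfA F N) (TbfA F N)
    (a - 1) b a (b - 1)
  have h2 := map_affRttR (q := q) (RingQuot.mkAlgHom F (AffGlRel F q N)) (TbfA F N) (TbfA F N)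
    (a - 1) b a (b - 1)
  change _ = affRttL F q (tbMat F q N) (tbMat F q N) _ _ _ _ at h1
  change _ = affRttR F q (tbMat F q N) (tbMat F q N) _ _ _ _ at h2
  rw [← h1, ← h2]
  ext p r
  exact RingQuot.mkAlgHom_rel F (AffGlRel.rtbtb a b p r)

lemma affRttL_tbMat_tMat (a b : ℤ) :
    affRttL F q (tbMat F q N) (tMat F q N) (a - 1) (-b) a (1 - b) =
      affRttR F q (tbMat F q N) (tMat F q N) (a - 1) (-b) a (1 - b) := by
  have h1 := map_affRttL (q := q) (RingQuot.mkAlgHom F (AffGlRel F q N)) (TbfA F N) (TfA F N)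
    (a - 1) (-b) a (1 - b)
  have h2 := map_affRttR (q := q) (RingQuot.mkAlgHom F (AffGlRel F q N)) (TbfA F N) (TfA F N)
    (a - 1) (-b) a (1 - b)
  change _ = affRttL F q (tbMat F q N) (tMat F q N) _ _ _ _ at h1
  change _ = affRttR F q (tbMat F q N) (tMat F q N) _ _ _ _ at h2
  rw [← h1, ← h2]
  ext p r
  exact RingQuot.mkAlgHom_rel F (AffGlRel.rtbt a b p r)

/-- The commutator-like coefficient `R X₁^{(r)} Y₂^{(s)} − Y₂^{(s)} X₁^{(r)} R`. -/
def rttDefect (R : Matrix (Fin N × Fin N) (Fin N × Fin N) F)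
    (X Y : ℕ → Matrix (Fin N) (Fin N) A) (r s : ℕ) :
    Matrix (Fin N × Fin N) (Fin N × Fin N) A :=
  liftF F R * amp1 (X r) * amp2 (Y s) - amp2 (Y s) * amp1 (X r) * liftF F R

lemma z1_natCast (X : ℕ → Matrix (Fin N) (Fin N) A) (r : ℕ) : z1 X r = amp1 (X r) := by
  simp [z1]

lemma z2_natCast (X : ℕ → Matrix (Fin N) (Fin N) A) (r : ℕ) : z2 X r = amp2 (X r) := by
  simp [z2]

lemma z1_neg_one (X : ℕ → Matrix (Fin N) (Fin N) A) : z1 X (-1) = 0 := by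
  simp [z1]

lemma z2_neg_one (X : ℕ → Matrix (Fin N) (Fin N) A) : z2 X (-1) = 0 := by
  simp [z2]

lemma rttDefect_tMat (r s : ℕ) :
    rttDefect (Rtil F q N) (tMat F q N) (tMat F q N) (r + 1) s =
        rttDefect (Rc F q N) (tMat F q N) (tMat F q N) r (s + 1) ∧
      rttDefect (Rtil F q N) (tMat F q N) (tMat F q N) 0 s = 0 ∧
      rttDefect (Rc F q N) (tMat F q N) (tMat F q N) r 0 = 0 := by
  refine ⟨?_, ?_, ?_⟩
  · have h := affRttL_tMat_tMat (F := F) (q := q) (N := N) (-r) (-s)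
    have e1 : (1 - -(r : ℤ)) = ((r + 1 : ℕ) : ℤ) := by push_cast; ring
    have e2 : (1 - -(s : ℤ)) = ((s + 1 : ℕ) : ℤ) := by push_cast; ring
    rw [e1, e2, neg_neg, neg_neg] at h
    simp only [affRttL, affRttR, z1_natCast, z2_natCast] at h
    exact sub_eq_sub_iff_sub_eq_sub.1 h
  · have h := affRttL_tMat_tMat (F := F) (q := q) (N := N) 1 (-s)
    have e1 : (1 - 1 : ℤ) = ((0 : ℕ) : ℤ) := rfl
    rw [e1, neg_neg] at h
    simp only [affRttL, affRttR, z1_natCast, z2_natCast, z1_neg_one] at h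
    simpa [rttDefect, sub_eq_zero] using h
  · have h := affRttL_tMat_tMat (F := F) (q := q) (N := N) (-r) 1
    have e1 : (1 - 1 : ℤ) = ((0 : ℕ) : ℤ) := rfl
    rw [e1, neg_neg] at h
    simp only [affRttL, affRttR, z1_natCast, z2_natCast, z2_neg_one] at h
    simpa [rttDefect, sub_eq_zero] using h

lemma rttDefect_tbMat (r s : ℕ) :
    rttDefect (Rc F q N) (tbMat F q N) (tbMat F q N) (r + 1) s =
        rttDefect (Rtil F q N) (tbMat F q N) (tbMat F q N) r (s + 1) ∧
      rttDefect (Rc F q N) (tbMat F q N) (tbMat F q N) 0 s = 0 ∧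
      rttDefect (Rtil F q N) (tbMat F q N) (tbMat F q N) r 0 = 0 := by
  refine ⟨?_, ?_, ?_⟩
  · have h := affRttL_tbMat_tbMat (F := F) (q := q) (N := N) (r + 1 : ℕ) (s + 1 : ℕ)
    have e1 : (((r + 1 : ℕ) : ℤ) - 1) = r := by push_cast; ring
    have e2 : (((s + 1 : ℕ) : ℤ) - 1) = s := by push_cast; ring
    rw [e1, e2] at h
    simp only [affRttL, affRttR, z1_natCast, z2_natCast] at h
    exact (sub_eq_sub_iff_sub_eq_sub.1 h).symm
  · have h := affRttL_tbMat_tbMat (F := F) (q := q) (N := N) (0 : ℕ) (s + 1 : ℕ)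
    have e1 : (((0 : ℕ) : ℤ) - 1) = -1 := rfl
    have e2 : (((s + 1 : ℕ) : ℤ) - 1) = s := by push_cast; ring
    rw [e1, e2] at h
    simp only [affRttL, affRttR, z1_natCast, z2_natCast, z1_neg_one] at h
    simpa [rttDefect, sub_eq_zero] using h
  · have h := affRttL_tbMat_tbMat (F := F) (q := q) (N := N) (r + 1 : ℕ) (0 : ℕ)
    have e1 : (((r + 1 : ℕ) : ℤ) - 1) = r := by push_cast; ring
    have e2 : (((0 : ℕ) : ℤ) - 1) = -1 := rfl
    rw [e1, e2] at h
    simp only [affRttL, affRttR, z1_natCast, z2_natCast, z2_neg_one] at h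
    simpa [rttDefect, sub_eq_zero] using h

lemma rttDefect_tbMat_tMat (r s : ℕ) :
    rttDefect (Rtil F q N) (tbMat F q N) (tMat F q N) r s =
        rttDefect (Rc F q N) (tbMat F q N) (tMat F q N) (r + 1) (s + 1) ∧
      rttDefect (Rc F q N) (tbMat F q N) (tMat F q N) 0 s = 0 ∧
      rttDefect (Rc F q N) (tbMat F q N) (tMat F q N) r 0 = 0 := by
  refine ⟨?_, ?_, ?_⟩
  · have h := affRttL_tbMat_tMat (F := F) (q := q) (N := N) (r + 1 : ℕ) (-s)
    have e1 : (((r + 1 : ℕ) : ℤ) - 1) = r := by push_cast; ring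
    have e2 : (1 - -(s : ℤ)) = ((s + 1 : ℕ) : ℤ) := by push_cast; ring
    rw [e1, e2, neg_neg] at h
    simp only [affRttL, affRttR, z1_natCast, z2_natCast] at h
    exact sub_eq_sub_iff_sub_eq_sub.1 h
  · have h := affRttL_tbMat_tMat (F := F) (q := q) (N := N) (0 : ℕ) (1 - s)
    have e1 : (((0 : ℕ) : ℤ) - 1) = -1 := rfl
    have e2 : (1 - (1 - s) : ℤ) = s := by ring
    rw [e1, e2] at h
    simp only [affRttL, affRttR, z1_natCast, z2_natCast, z1_neg_one] at h
    simpa [rttDefect, sub_eq_zero] using h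
  · have h := affRttL_tbMat_tMat (F := F) (q := q) (N := N) (r : ℕ) 1
    have e1 : (1 - 1 : ℤ) = ((0 : ℕ) : ℤ) := rfl
    rw [e1] at h
    simp only [affRttL, affRttR, z1_natCast, z2_natCast, z2_neg_one] at h
    simpa [rttDefect, sub_eq_zero] using h

end AffineRelations

section SeriesRelations

open PowerSeries

variable {F : Type} [Field F] {q : F} {N : ℕ} {A : Type} [Ring A] [Algebra F A]

/-- The matrix of series `∑ r, α ^ r • Y r * X ^ r`. -/
def dilatedSeries (Y : ℕ → Matrix (Fin N) (Fin N) A) (α : F) : Matrix (Fin N) (Fin N) A⟦X⟧ :=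
  matrixSeries (PowerSeries.mk fun r => α ^ r • Y r)

lemma coeff_dilatedSeries (Y : ℕ → Matrix (Fin N) (Fin N) A) (α : F) (i j : Fin N) (r : ℕ) :
    coeff r (dilatedSeries Y α i j) = α ^ r • Y r i j := by
  simp [dilatedSeries, coeff_matrixSeries]

lemma amp1_dilatedSeries (Y : ℕ → Matrix (Fin N) (Fin N) A) (α : F) :
    amp1 (dilatedSeries Y α) = matrixSeries (PowerSeries.mk fun r => α ^ r • amp1 (Y r)) := by
  ext p r k
  simp only [coeff_matrixSeries, amp1, Matrix.of_apply, coeff_mk, Matrix.smul_apply]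
  split_ifs
  · exact coeff_dilatedSeries ..
  · simp

lemma amp2_dilatedSeries (Y : ℕ → Matrix (Fin N) (Fin N) A) (α : F) :
    amp2 (dilatedSeries Y α) = matrixSeries (PowerSeries.mk fun r => α ^ r • amp2 (Y r)) := by
  ext p r k
  simp only [coeff_matrixSeries, amp2, Matrix.of_apply, coeff_mk, Matrix.smul_apply]
  split_ifs
  · exact coeff_dilatedSeries ..
  · simp

lemma matrixSeries_C {W : Type} [Fintype W] [DecidableEq W] (R : Matrix W W F) :
    matrixSeries (C (R.map (algebraMap F A))) = R.map (algebraMap F A⟦X⟧) := by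
  ext p r k
  simp only [coeff_matrixSeries, coeff_C, Matrix.map_apply, PowerSeries.algebraMap_apply]
  split_ifs <;> simp

/-- The series version of `rttDefect`. -/
def seriesDefect (R : Matrix (Fin N × Fin N) (Fin N × Fin N) A)
    (S S' : Matrix (Fin N) (Fin N) A) : Matrix (Fin N × Fin N) (Fin N × Fin N) A :=
  R * amp1 S * amp2 S' - amp2 S' * amp1 S * R

lemma seriesDefect_dilatedSeries (R : Matrix (Fin N × Fin N) (Fin N × Fin N) F)
    (Y Z : ℕ → Matrix (Fin N) (Fin N) A) (α β : F) :
    seriesDefect (R.map (algebraMap F A⟦X⟧)) (dilatedSeries Y α) (dilatedSeries Z β) =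
      matrixSeries (PowerSeries.mk fun k => ∑ p ∈ Finset.HasAntidiagonal.antidiagonal k,
        (α ^ p.1 * β ^ p.2) • rttDefect R Y Z p.1 p.2) := by
  rw [seriesDefect, amp1_dilatedSeries, amp2_dilatedSeries, ← matrixSeries_C]
  simp only [← map_mul, ← map_sub]
  congr 1
  ext1 k
  rw [map_sub, coeff_mk, PowerSeries.coeff_mul, coeff_mul_C, PowerSeries.coeff_mul,
    Finset.sum_mul]
  nth_rewrite 2 [← Finset.Nat.sum_antidiagonal_swap]
  rw [← Finset.sum_sub_distrib]
  refine Finset.sum_congr rfl fun p _ => ?_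
  simp only [coeff_C_mul, coeff_mk, rttDefect, liftF, Prod.fst_swap, Prod.snd_swap, smul_sub,
    Matrix.mul_smul, Matrix.smul_mul, smul_smul, mul_comm (β ^ p.2)]

lemma smul_sum_antidiagonal_shift {V : Type} [AddCommGroup V] [Module F V] {D D' : ℕ → ℕ → V}
    (h : ∀ r s, D (r + 1) s = D' r (s + 1)) (h0 : ∀ s, D 0 s = 0) (h0' : ∀ r, D' r 0 = 0)
    (α β : F) (k : ℕ) :
    β • ∑ p ∈ Finset.HasAntidiagonal.antidiagonal k, (α ^ p.1 * β ^ p.2) • D p.1 p.2 =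
      α • ∑ p ∈ Finset.HasAntidiagonal.antidiagonal k, (α ^ p.1 * β ^ p.2) • D' p.1 p.2 := by
  cases k with
  | zero => simp [h0, h0']
  | succ k =>
    rw [Finset.Nat.sum_antidiagonal_succ, Finset.Nat.sum_antidiagonal_succ']
    simp only [h0, h0', h, smul_zero, zero_add, Finset.smul_sum, smul_smul]
    refine Finset.sum_congr rfl fun p _ => ?_
    congr 1
    ring

lemma sum_antidiagonal_shift_both {V : Type} [AddCommGroup V] [Module F V] {D D' : ℕ → ℕ → V}
    (h : ∀ r s, D r s = D' (r + 1) (s + 1)) (h0 : ∀ s, D' 0 s = 0) (h0' : ∀ r, D' r 0 = 0)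
    (α β : F) (k : ℕ) :
    ∑ p ∈ Finset.HasAntidiagonal.antidiagonal (k + 2), (α ^ p.1 * β ^ p.2) • D' p.1 p.2 =
      (α * β) • ∑ p ∈ Finset.HasAntidiagonal.antidiagonal k, (α ^ p.1 * β ^ p.2) • D p.1 p.2 := by
  rw [Finset.Nat.sum_antidiagonal_succ, Finset.Nat.sum_antidiagonal_succ']
  simp only [h0, h0', h, smul_zero, zero_add, Finset.smul_sum, smul_smul]
  refine Finset.sum_congr rfl fun p _ => ?_
  congr 1
  ring

lemma seriesDefect_smul_sub (R R' : Matrix (Fin N × Fin N) (Fin N × Fin N) A) (w w' : F)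
    (S S' : Matrix (Fin N) (Fin N) A) :
    seriesDefect (w • R - w' • R') S S' = w • seriesDefect R S S' - w' • seriesDefect R' S S' := by
  simp only [seriesDefect, sub_mul, mul_sub, smul_sub, Matrix.smul_mul, Matrix.mul_smul]
  abel

lemma map_rhoMat (w : F) :
    (rhoMat q w N).map (algebraMap F A) =
      w • (Rtil F q N).map (algebraMap F A) - (Rc F q N).map (algebraMap F A) := by
  ext p r
  simp only [rhoMat, Matrix.map_apply, Matrix.sub_apply, Matrix.smul_apply, smul_eq_mul, map_sub,
    map_mul]
  rw [Algebra.smul_def]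

lemma matrixSeries_smul {W : Type} [Fintype W] [DecidableEq W] (c : F)
    (f : (Matrix W W A)⟦X⟧) : matrixSeries (c • f) = c • matrixSeries f := by
  ext p r k
  simp [coeff_matrixSeries]

lemma seriesDefect_tMat (α β : F) (hα : α ≠ 0) :
    seriesDefect ((rhoMat q (α⁻¹ * β) N).map (algebraMap F (UqAff F q N)⟦X⟧))
      (dilatedSeries (tMat F q N) α) (dilatedSeries (tMat F q N) β) = 0 := by
  rw [map_rhoMat, ← one_smul F ((Rc F q N).map _), seriesDefect_smul_sub, one_smul, sub_eq_zero,
    mul_smul, inv_smul_eq_iff₀ hα,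
    seriesDefect_dilatedSeries, seriesDefect_dilatedSeries, ← matrixSeries_smul,
    ← matrixSeries_smul]
  congr 1
  ext1 k
  simp only [PowerSeries.coeff_smul, coeff_mk]
  exact smul_sum_antidiagonal_shift (fun r s => (rttDefect_tMat r s).1)
    (fun s => (rttDefect_tMat 0 s).2.1) (fun r => (rttDefect_tMat r 0).2.2) α β k

lemma seriesDefect_tbMat (α β : F) (hβ : β ≠ 0) :
    seriesDefect ((rhoMat q (β⁻¹ * α) N).map (algebraMap F (UqAff F q N)⟦X⟧))
      (dilatedSeries (tbMat F q N) α) (dilatedSeries (tbMat F q N) β) = 0 := by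
  rw [map_rhoMat, ← one_smul F ((Rc F q N).map _), seriesDefect_smul_sub, one_smul, sub_eq_zero,
    mul_smul, inv_smul_eq_iff₀ hβ,
    seriesDefect_dilatedSeries, seriesDefect_dilatedSeries, ← matrixSeries_smul,
    ← matrixSeries_smul]
  congr 1
  ext1 k
  simp only [PowerSeries.coeff_smul, coeff_mk]
  exact (smul_sum_antidiagonal_shift (fun r s => (rttDefect_tbMat r s).1)
    (fun s => (rttDefect_tbMat 0 s).2.1) (fun r => (rttDefect_tbMat r 0).2.2) α β k).symm

lemma seriesDefect_tbMat_tMat (α β : F) :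
    seriesDefect ((Rc F q N).map (algebraMap F (UqAff F q N)⟦X⟧))
        (dilatedSeries (tbMat F q N) α) (dilatedSeries (tMat F q N) β) =
      (α * β) • (X ^ 2 : (UqAff F q N)⟦X⟧) •
        seriesDefect ((Rtil F q N).map (algebraMap F (UqAff F q N)⟦X⟧))
          (dilatedSeries (tbMat F q N) α) (dilatedSeries (tMat F q N) β) := by
  rw [seriesDefect_dilatedSeries, seriesDefect_dilatedSeries]
  ext p r k
  rw [Matrix.smul_apply, Matrix.smul_apply, PowerSeries.coeff_smul, smul_eq_mul, coeff_X_pow_mul',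
    coeff_matrixSeries, coeff_mk]
  have h0 := fun s => (rttDefect_tbMat_tMat (F := F) (q := q) (N := N) 0 s).2.1
  have h0' := fun r => (rttDefect_tbMat_tMat (F := F) (q := q) (N := N) r 0).2.2
  match k with
  | 0 => simp [h0]
  | 1 => simp [Finset.Nat.antidiagonal_succ, h0, h0']
  | k + 2 =>
    rw [if_pos (by omega), coeff_matrixSeries, coeff_mk, Nat.add_sub_cancel,
      sum_antidiagonal_shift_both (fun r s => (rttDefect_tbMat_tMat r s).1) h0 h0',
      Matrix.smul_apply]

end SeriesRelations

section SpecializedSystems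

open PowerSeries
open scoped Matrix

variable {F : Type} [Field F] {q : F} {N : ℕ} {A : Type} [Ring A] [Algebra F A]

/-- The matrices `T(q^{-2k} u)` as series in `u⁻¹`. -/
def tSystem (F : Type) [Field F] (q : F) (N : ℕ) (k : Fin N) :
    Matrix (Fin N) (Fin N) (UqAff F q N)⟦X⟧ :=
  dilatedSeries (tMat F q N) (q ^ (2 * (k.val : ℤ)))

/-- The matrices `T̄(q^{2k} u⁻¹)` as series in `u⁻¹`. -/
def tbSystem (F : Type) [Field F] (q : F) (N : ℕ) (k : Fin N) :
    Matrix (Fin N) (Fin N) (UqAff F q N)⟦X⟧ :=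
  dilatedSeries (tbMat F q N) (q ^ (2 * (k.val : ℤ)))

lemma twoSite_exchange {i j : Fin N} (hij : i ≠ j) {R : Matrix (Fin N × Fin N) (Fin N × Fin N) A}
    {S S' : Matrix (Fin N) (Fin N) A} (h : seriesDefect R S S' = 0) :
    twoSite i j R * ampAt i S * ampAt j S' = ampAt j S' * ampAt i S * twoSite i j R := by
  rw [ampAt_eq_twoSite_left hij, ampAt_eq_twoSite_right hij]
  simp only [← twoSite_mul hij]
  rw [sub_eq_zero.1 h]

lemma isRttSystem_tSystem (hq : q ≠ 0) : IsRttSystem q (tSystem F q N) := by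
  intro i j hij
  have h := seriesDefect_tMat (q := q) (N := N) (q ^ (2 * (i.val : ℤ))) (q ^ (2 * (j.val : ℤ)))
    (zpow_ne_zero _ hq)
  rw [← zpow_neg, ← zpow_add₀ hq,
    show -(2 * (i.val : ℤ)) + 2 * (j.val : ℤ) = 2 * ((j.val : ℤ) - i.val) by ring] at h
  rw [rhoOp, map_twoSite]
  exact twoSite_exchange hij h

lemma isRttSystem_tbSystem_rev (hq : q ≠ 0) : IsRttSystem q fun k => tbSystem F q N k.rev := by
  intro i j hij
  have h := seriesDefect_tbMat (q := q) (N := N) (q ^ (2 * (i.rev.val : ℤ)))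
    (q ^ (2 * (j.rev.val : ℤ))) (zpow_ne_zero _ hq)
  have e : -(2 * (j.rev.val : ℤ)) + 2 * (i.rev.val : ℤ) = 2 * ((j.val : ℤ) - i.val) := by
    simp only [Fin.val_rev]
    omega
  rw [← zpow_neg, ← zpow_add₀ hq, e] at h
  rw [rhoOp, map_twoSite]
  exact twoSite_exchange hij h

lemma amp_transpose_exchange {R R' : Matrix (Fin N × Fin N) (Fin N × Fin N) A}
    (hR : ∀ p r x, Commute (R p r) x) (hR' : ∀ p r, R' p r = R (r.1, p.2) (p.1, r.2))
    {S S' : Matrix (Fin N) (Fin N) A} (h : seriesDefect R S S' = 0) :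
    amp1 Sᵀ * R' * amp2 S' = amp2 S' * R' * amp1 Sᵀ := by
  ext ⟨c, b⟩ ⟨a, d⟩
  have h := congrFun (congrFun (sub_eq_zero.1 h) (a, b)) (c, d)
  simp only [Matrix.mul_apply, Fintype.sum_prod_type, amp1, amp2, Matrix.of_apply, ite_mul,
    mul_ite, zero_mul, mul_zero, Finset.sum_ite_eq, Finset.sum_ite_eq', Finset.mem_univ, if_true,
    Finset.sum_ite_irrel, Finset.sum_const_zero] at h
  simp only [Matrix.mul_apply, Fintype.sum_prod_type, amp1, amp2, Matrix.of_apply, ite_mul,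
    mul_ite, zero_mul, mul_zero, Finset.sum_ite_eq, Finset.sum_ite_eq', Finset.mem_univ, if_true,
    Finset.sum_ite_irrel, Finset.sum_const_zero, Matrix.transpose_apply, hR']
  simp only [← (hR _ _ _).eq]
  rw [h, Finset.sum_comm]
  simp only [Finset.sum_mul]
  rw [Finset.sum_comm]
  refine Finset.sum_congr rfl fun x _ => Finset.sum_congr rfl fun y _ => ?_
  rw [mul_assoc, ← (hR _ _ _).eq, ← mul_assoc, (hR _ _ _).eq]

lemma scalarSeries_X : scalarSeries F A X = X := by
  ext m
  by_cases hm : m = 1 <;> simp [coeff_scalarSeries, coeff_X, hm]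

lemma scalarSeries_specX (k : ℕ) :
    scalarSeries F A (specX q k) = q ^ (2 * (k : ℤ)) • X ^ 2 := by
  rw [specX, map_smul, map_pow, scalarSeries_X]

lemma scalarSeries_specV (k : ℕ) :
    scalarSeries F A (specV q k) = q ^ (-2 * (k : ℤ)) • 1 := by
  rw [specV, map_smul, map_one]

lemma seriesDefect_central_smul (R : Matrix (Fin N × Fin N) (Fin N × Fin N) A) {x : A}
    (hx : ∀ y, Commute x y) (S S' : Matrix (Fin N) (Fin N) A) :
    seriesDefect (x • R) S S' = x • seriesDefect R S S' := by
  have h : Commute (Matrix.scalar (Fin N × Fin N) x) (amp2 S' * amp1 S) :=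
    Matrix.scalar_commute _ hx _
  simp only [seriesDefect, smul_sub, Matrix.smul_eq_diagonal_mul]
  rw [Matrix.scalar_apply] at h
  rw [← mul_assoc _ _ R, ← h.eq]
  simp only [mul_assoc]

lemma tbSystem_transpose_exchange (hq : q ≠ 0) {i j : Fin N} (hij : i ≠ j) :
    ampAt i (tbSystem F q N i)ᵀ *
        twoSite i j ((rtMat q N (specX q i.val) (specV q j.val)).map
          (scalarSeries F (UqAff F q N))) * ampAt j (tSystem F q N j) =
      ampAt j (tSystem F q N j) *
        twoSite i j ((rtMat q N (specX q i.val) (specV q j.val)).map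
          (scalarSeries F (UqAff F q N))) * ampAt i (tbSystem F q N i)ᵀ := by
  set ι := scalarSeries F (UqAff F q N)
  set α := q ^ (2 * (i.val : ℤ))
  set β := q ^ (2 * (j.val : ℤ)) with hβ
  have hβ0 : β ≠ 0 := zpow_ne_zero _ hq
  set R : Matrix (Fin N × Fin N) (Fin N × Fin N) (UqAff F q N)⟦X⟧ :=
    Matrix.of fun p r => ι (algebraMap F F⟦X⟧ (Rtil F q N p r) * specX q i.val -
      algebraMap F F⟦X⟧ (Rc F q N p r) * specV q j.val) with hR
  rw [ampAt_eq_twoSite_left hij, ampAt_eq_twoSite_right hij]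
  simp only [← twoSite_mul hij]
  rw [amp_transpose_exchange (R := R)]
  · intro p r x
    exact scalarSeries_commute (F := F) _ _
  · intro p r
    simp only [hR, rtMat, Rtilt, Rct, Matrix.map_apply, Matrix.sub_apply, Matrix.smul_apply,
      Matrix.of_apply, smul_eq_mul, mul_comm]
  · have e : R = α • ((X ^ 2 : (UqAff F q N)⟦X⟧) •
          (Rtil F q N).map (algebraMap F (UqAff F q N)⟦X⟧)) -
        β⁻¹ • (Rc F q N).map (algebraMap F (UqAff F q N)⟦X⟧) := by
      ext1 p r
      simp only [hR, Matrix.of_apply, map_sub, map_mul, ι, scalarSeries_specX, scalarSeries_specV,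
        Matrix.sub_apply, Matrix.smul_apply, Matrix.map_apply, AlgHom.commutes, smul_eq_mul]
      rw [mul_smul_comm, mul_smul_comm, mul_one, Algebra.commutes, neg_mul, _root_.zpow_neg]
    have h := seriesDefect_tbMat_tMat (F := F) (q := q) (N := N) α β
    have hX : ∀ y, Commute (X ^ 2 : (UqAff F q N)⟦X⟧) y := fun y => (commute_X y).symm.pow_left 2
    change seriesDefect R (dilatedSeries (tbMat F q N) α) (dilatedSeries (tMat F q N) β) = 0
    rw [e, seriesDefect_smul_sub, seriesDefect_central_smul _ hX, h, smul_smul, mul_comm α β,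
      inv_mul_cancel_left₀ hβ0, sub_self]

end SpecializedSystems

section QuantumDeterminants

open PowerSeries

variable {F : Type} [Field F] {q : F} {N : ℕ} {A : Type} [Ring A] [Algebra F A]

lemma sum_antidiagonalTuple_succ {V : Type} [AddCommMonoid V] (k n : ℕ)
    (f : (Fin (k + 1) → ℕ) → V) :
    ∑ r ∈ Finset.Nat.antidiagonalTuple (k + 1) n, f r =
      ∑ p ∈ Finset.HasAntidiagonal.antidiagonal n,
        ∑ r ∈ Finset.Nat.antidiagonalTuple k p.2, f (Fin.cons p.1 r) := by
  rw [Finset.sum_sigma']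
  refine Finset.sum_bij' (fun r _ => ⟨(r 0, ∑ i, Fin.tail r i), Fin.tail r⟩)
    (fun x _ => Fin.cons x.1.1 x.2) ?_ ?_ ?_ ?_ ?_
  · intro r hr
    rw [Finset.Nat.mem_antidiagonalTuple, Fin.sum_univ_succ] at hr
    simp only [Finset.mem_sigma, Finset.HasAntidiagonal.mem_antidiagonal, Finset.Nat.mem_antidiagonalTuple,
      and_true]
    exact hr
  · rintro ⟨⟨a, b⟩, r⟩ h
    simp only [Finset.mem_sigma, Finset.HasAntidiagonal.mem_antidiagonal, Finset.Nat.mem_antidiagonalTuple] at h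
    simp only [Finset.Nat.mem_antidiagonalTuple, Fin.sum_univ_succ, Fin.cons_zero, Fin.cons_succ]
    omega
  · intro r _
    exact Fin.cons_self_tail r
  · rintro ⟨⟨a, b⟩, r⟩ h
    simp only [Finset.mem_sigma, Finset.HasAntidiagonal.mem_antidiagonal, Finset.Nat.mem_antidiagonalTuple] at h
    simp [h.2]
  · intro r _
    rw [Fin.cons_self_tail]

lemma coeff_finRange_prod (f : Fin N → A⟦X⟧) (m : ℕ) :
    coeff m ((List.finRange N).map f).prod =
      ∑ r ∈ Finset.Nat.antidiagonalTuple N m,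
        ((List.finRange N).map fun k => coeff (r k) (f k)).prod := by
  induction N generalizing m with
  | zero => cases m <;> simp [coeff_one]
  | succ N ih =>
    rw [List.finRange_succ, List.map_cons, List.map_map, List.prod_cons, PowerSeries.coeff_mul,
      sum_antidiagonalTuple_succ]
    refine Finset.sum_congr rfl fun p _ => ?_
    rw [ih, Finset.mul_sum]
    refine Finset.sum_congr rfl fun r _ => ?_
    simp [Function.comp_def]

lemma list_prod_map_smul {I : Type} (c : I → F) (x : I → A) (l : List I) :
    (l.map fun k => c k • x k).prod = (l.map c).prod • (l.map x).prod := by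
  induction l with
  | nil => simp
  | cons a l ih => simp [ih, smul_smul, mul_comm]

lemma coeff_rttDet_dilatedSeries (Y : ℕ → Matrix (Fin N) (Fin N) A) (α : Fin N → F) (m : ℕ) :
    coeff m (rttDet q fun k => dilatedSeries Y (α k)) =
      ∑ σ : Equiv.Perm (Fin N), ∑ r ∈ Finset.Nat.antidiagonalTuple N m,
        ((-q)⁻¹ ^ invCount σ * ∏ k, α k ^ r k) •
          ((List.finRange N).map fun k => Y (r k) (σ k) k).prod := by
  have h : ∀ g : Fin N → Fin N, coeff m (qSignA q A⟦X⟧ g *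
      ((List.finRange N).map fun k => dilatedSeries Y (α k) (g k) k).prod) =
      qSign q g • ∑ r ∈ Finset.Nat.antidiagonalTuple N m,
        (∏ k, α k ^ r k) • ((List.finRange N).map fun k => Y (r k) (g k) k).prod := by
    intro g
    rw [qSignA, ← Algebra.smul_def, PowerSeries.coeff_smul, coeff_finRange_prod]
    simp only [coeff_dilatedSeries, list_prod_map_smul, Fin.prod_univ_def]
  rw [rttDet, map_sum, Finset.sum_congr rfl fun g _ => h g]
  symm
  refine Finset.sum_of_injOn (fun σ : Equiv.Perm (Fin N) => (σ : Fin N → Fin N)) ?_ ?_ ?_ ?_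
  · exact DFunLike.coe_injective.injOn
  · intro _ _
    simp
  · intro g _ hg
    rw [qSign_of_not_injective, zero_smul]
    intro hi
    exact hg ⟨Equiv.ofBijective g (Finite.injective_iff_bijective.1 hi), by simp, by ext; simp⟩
  · intro σ _
    rw [qSign_of_injective q σ.injective, Finset.smul_sum, invCount_eq_wordInv]
    simp only [smul_smul]

lemma toPS_eq_X_mul {c : ℤ → A} {f : A⟦X⟧} (h1 : c 1 = 0) (h : ∀ k : ℕ, c (-k) = coeff k f) :
    toPS c = X * f := by
  ext k
  rw [coeff_toPS]
  cases k with
  | zero => simpa using h1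
  | succ k =>
    rw [coeff_succ_X_mul, ← h]
    congr 1
    push_cast
    ring

lemma toPS_qdetTc : toPS (qdetTc F q N) = X * rttDet q (tSystem F q N) := by
  refine toPS_eq_X_mul (if_neg (by norm_num)) fun k => ?_
  rw [qdetTc, if_pos (by omega), neg_neg, Int.toNat_natCast]
  refine Eq.trans ?_ (coeff_rttDet_dilatedSeries _ _ _).symm
  refine Finset.sum_congr rfl fun σ _ => Finset.sum_congr rfl fun r _ => ?_
  congr 2
  refine Finset.prod_congr rfl fun i _ => ?_
  rw [zpow_mul, zpow_natCast]

lemma toPS_qdetTbc :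
    toPS (qdetTbc F q N) = X * rttDet q (fun k => tbSystem F q N k.rev) := by
  refine toPS_eq_X_mul (if_neg (by norm_num)) fun k => ?_
  rw [qdetTbc, if_pos (by omega), neg_neg, Int.toNat_natCast]
  refine Eq.trans ?_ (coeff_rttDet_dilatedSeries _ _ _).symm
  refine Finset.sum_congr rfl fun σ _ => Finset.sum_congr rfl fun r _ => ?_
  congr 2
  refine Finset.prod_congr rfl fun i _ => ?_
  rw [zpow_mul, zpow_natCast]
  congr 2
  simp only [Fin.val_rev]
  omega

end QuantumDeterminants

section SklyaninSeries

open PowerSeries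
open scoped Matrix

variable {F : Type} [Field F] {q : F} {N : ℕ} {A : Type} [Ring A] [Algebra F A]

/-- The coefficient of `u^{-r}` in `T(u) G T̄(u⁻¹)ᵗ`. -/
def sMat (F : Type) [Field F] (q : F) (N : ℕ) (G : Matrix (Fin N) (Fin N) F) (r : ℕ) :
    Matrix (Fin N) (Fin N) (UqAff F q N) :=
  ∑ p ∈ Finset.HasAntidiagonal.antidiagonal r,
    tMat F q N p.1 * G.map (algebraMap F _) * (tbMat F q N p.2)ᵀ

/-- The coefficients of the series `S_k(q^{-2k} u)` acting in the `k`-th tensor factor. -/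
def siteFactor (q : F) (S : ℕ → Matrix (Fin N) (Fin N) A) (k : Fin N) (m : ℤ) :
    Matrix (Fin N → Fin N) (Fin N → Fin N) A :=
  if m ≤ 0 then q ^ (2 * (k.val : ℤ) * (-m)) • ampAt k (S (-m).toNat) else 0

lemma dilatedSeries_sMat (G : Matrix (Fin N) (Fin N) F) (α : F) :
    dilatedSeries (sMat F q N G) α =
      dilatedSeries (tMat F q N) α * G.map (algebraMap F _) * (dilatedSeries (tbMat F q N) α)ᵀ := by
  have h : (dilatedSeries (tbMat F q N) α)ᵀ =
      matrixSeries (PowerSeries.mk fun r => α ^ r • (tbMat F q N r)ᵀ) := by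
    ext i j r
    simp [coeff_dilatedSeries, coeff_matrixSeries]
  rw [h, ← matrixSeries_C, dilatedSeries, dilatedSeries, ← map_mul, ← map_mul]
  congr 1
  ext1 r
  rw [coeff_mk, PowerSeries.coeff_mul, sMat, Finset.smul_sum]
  refine Finset.sum_congr rfl fun p hp => ?_
  rw [coeff_mul_C, coeff_mk, coeff_mk, ← Finset.HasAntidiagonal.mem_antidiagonal.1 hp, pow_add]
  simp only [Matrix.smul_mul, Matrix.mul_smul, smul_smul]
  rw [mul_comm]

lemma toPS_siteFactor (S : ℕ → Matrix (Fin N) (Fin N) A) (k : Fin N) :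
    toPS (siteFactor q S k) =
      X * PowerSeries.mk fun r => (q ^ (2 * (k.val : ℤ))) ^ r • ampAt k (S r) := by
  refine toPS_eq_X_mul (if_neg (by norm_num)) fun r => ?_
  rw [siteFactor, if_pos (by omega), neg_neg, Int.toNat_natCast, coeff_mk, zpow_mul, zpow_natCast]

lemma ampAt_dilatedSeries (Y : ℕ → Matrix (Fin N) (Fin N) A) (α : F) (k : Fin N) :
    ampAt k (dilatedSeries Y α) =
      matrixSeries (PowerSeries.mk fun r => α ^ r • ampAt k (Y r)) := by
  ext f g r
  simp only [coeff_matrixSeries, ampAt, Matrix.of_apply, coeff_mk, Matrix.smul_apply]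
  split_ifs
  · exact coeff_dilatedSeries ..
  · simp

lemma coeff_scalarSeries_specX_mul_sub (a b : F) (i j k : ℕ) :
    coeff k (scalarSeries F A (specX q i * algebraMap F _ a - specV q j * algebraMap F _ b)) =
      if (1 - k : ℤ) = -1 then algebraMap F A (q ^ (2 * (i : ℤ)) * a)
      else if (1 - k : ℤ) = 1 then algebraMap F A (-(q ^ (-2 * (j : ℤ))) * b) else 0 := by
  have h1 : (1 - k : ℤ) = -1 ↔ k = 2 := by omega
  have h2 : (1 - k : ℤ) = 1 ↔ k = 0 := by omega
  simp only [h1, h2]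
  rw [coeff_scalarSeries, map_sub, mul_comm, ← Algebra.smul_def, mul_comm _ (algebraMap F _ b),
    ← Algebra.smul_def, specX, specV, PowerSeries.coeff_smul, PowerSeries.coeff_smul,
    PowerSeries.coeff_smul, PowerSeries.coeff_smul, coeff_X_pow, coeff_one]
  by_cases h : k = 2
  · simp [h, mul_comm]
  · by_cases h' : k = 0
    · simp [h', mul_comm]
    · simp [h, h']

lemma matrixSeries_toPS_RtfacO (i j : Fin N) :
    matrixSeries (toPS (RtfacO F q N i j)) =
      twoSite i j ((rtMat q N (specX q i.val) (specV q j.val)).map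
        (scalarSeries F (UqAff F q N))) := by
  ext f g k
  rw [coeff_matrixSeries, coeff_toPS, RtfacO]
  simp only [twoSite, rtMat, Matrix.of_apply, Matrix.map_apply, Matrix.sub_apply,
    Matrix.smul_apply, smul_eq_mul]
  by_cases h : ∀ l, l ≠ i → l ≠ j → f l = g l
  · rw [if_pos h, coeff_scalarSeries_specX_mul_sub]
    split_ifs
    · simp only [Matrix.smul_apply, big2A, big2, Matrix.map_apply, Matrix.of_apply, if_pos h]
      rw [Algebra.smul_def, map_mul]
    · simp only [Matrix.smul_apply, big2A, big2, Matrix.map_apply, Matrix.of_apply, if_pos h]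
      rw [Algebra.smul_def, map_mul]
    · rfl
  · rw [if_neg h, map_zero]
    split_ifs
    · simp only [Matrix.smul_apply, big2A, big2, Matrix.map_apply, Matrix.of_apply, if_neg h,
        map_zero, smul_zero]
    · simp only [Matrix.smul_apply, big2A, big2, Matrix.map_apply, Matrix.of_apply, if_neg h,
        map_zero, smul_zero]
    · rfl

lemma toPS_gamFac (p : Fin N × Fin N) :
    toPS (gamFac F q N p) =
      scalarSeries F (UqAff F q N) (specX q p.1.val - specV q p.2.val) := by
  ext k
  have h := coeff_scalarSeries_specX_mul_sub (q := q) (A := UqAff F q N) 1 1 p.1.val p.2.val k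
  simp only [map_one, mul_one] at h
  rw [coeff_toPS, gamFac, h]

lemma map_flatMap_cons {α β γ : Type} (f : β → γ) (c : α → β) (t : α → List β) (l : List α) :
    (l.flatMap fun i => c i :: t i).map f = l.flatMap fun i => f (c i) :: (t i).map f := by
  simp [List.map_flatMap]

lemma length_flatMap_cons {α β : Type} (c : α → β) (t : α → List β) (l : List α) :
    (l.flatMap fun i => c i :: t i).length = l.length + (l.flatMap t).length := by
  induction l with
  | nil => rfl
  | cons a l ih =>
    simp only [List.flatMap_cons, List.length_append, List.length_cons, ih]
    omega

lemma prod_flatMap_one_cons {α M : Type} [Monoid M] (t : α → List M) (l : List α) :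
    (l.flatMap fun i => 1 :: t i).prod = (l.flatMap t).prod := by
  induction l with
  | nil => rfl
  | cons a l ih => simp [List.flatMap_cons, ih]

lemma pairProd_central_mul {α M : Type} [Monoid M] {x : M} (hx : ∀ y, Commute x y) (c : α → M)
    (R : α → α → M) (l : List α) :
    pairProd (fun i => x * c i) R l = x ^ l.length * pairProd c R l := by
  induction l with
  | nil => simp [pairProd]
  | cons i t ih =>
    have h := ((hx (c i * (t.map (R i)).prod)).pow_left t.length).eq
    simp only [pairProd, List.length_cons, ih, pow_succ', mul_assoc] at h ⊢
    rw [← mul_assoc _ (x ^ _), ← mul_assoc (c i), ← h]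
    simp only [mul_assoc]

lemma prod_map_toPS_gamFac :
    (((pairsLex N).map fun p => gamFac F q N p).map toPS).prod =
      scalarSeries F (UqAff F q N) (gammaSeries q N) := by
  rw [gammaSeries, ← flatMap_finRange_prod, prod_flatMap_one_cons, map_list_prod, List.map_map,
    pairsLex, List.map_flatMap, List.map_flatMap]
  simp only [List.map_map, Function.comp_def, toPS_gamFac]

lemma matrixSeries_prod_sdetFacs (B : Matrix (Fin N → Fin N) (Fin N → Fin N) F)
    (G : Matrix (Fin N) (Fin N) F) :
    matrixSeries (((fun m : ℤ => if m = 0 then B.map (algebraMap F (UqAff F q N)) else 0) ::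
        (List.finRange N).flatMap fun i => siteFactor q (sMat F q N G) i ::
          (((List.finRange N).filter fun j => i < j).map fun j => RtfacO F q N i j)).map
          toPS).prod =
      (X ^ (N + 1) : (UqAff F q N)⟦X⟧) • (B.map (algebraMap F _) *
        pairProd (fun i => ampAt i (tSystem F q N i * (G.map (algebraMap F F⟦X⟧)).map
            (scalarSeries F (UqAff F q N)) * (tbSystem F q N i)ᵀ))
          (fun i j => twoSite i j ((rtMat q N (specX q i.val) (specV q j.val)).map
            (scalarSeries F (UqAff F q N)))) (List.finRange N)) := by
  have hG : (G.map (algebraMap F F⟦X⟧)).map (scalarSeries F (UqAff F q N)) =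
      G.map (algebraMap F (UqAff F q N)⟦X⟧) := by
    ext1 i j
    exact (scalarSeries F (UqAff F q N)).commutes _
  have hB : toPS (fun m : ℤ => if m = 0 then B.map (algebraMap F (UqAff F q N)) else 0) =
      X * C (B.map (algebraMap F (UqAff F q N))) := by
    refine toPS_eq_X_mul (if_neg (by norm_num)) fun k => ?_
    rw [coeff_C]
    simp
  have hX : ∀ (m : ℕ) (f : (Matrix (Fin N → Fin N) (Fin N → Fin N) (UqAff F q N))⟦X⟧),
      matrixSeries (X ^ m * f) = (X ^ m : (UqAff F q N)⟦X⟧) • matrixSeries f := by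
    intro m f
    ext i j k
    rw [coeff_matrixSeries, Matrix.smul_apply, smul_eq_mul, coeff_X_pow_mul', coeff_X_pow_mul']
    split_ifs
    · rw [coeff_matrixSeries]
    · rfl
  rw [List.map_cons, List.prod_cons, map_flatMap_cons, hB]
  simp only [toPS_siteFactor, List.map_map]
  rw [flatMap_finRange_prod, pairProd_central_mul (fun y => (commute_X y).symm),
    List.length_finRange, mul_assoc, ← mul_assoc (C _), (commute_X_pow (C _) N).eq,
    mul_assoc, ← mul_assoc X, ← pow_succ', hX, map_mul, matrixSeries_C]
  congr 2
  refine (map_pairProd (matrixSeries (W := Fin N → Fin N) (M := UqAff F q N)).toMonoidHom _ _ _).trans ?_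
  change pairProd (fun i => matrixSeries (PowerSeries.mk fun r =>
    (q ^ (2 * (i.val : ℤ))) ^ r • ampAt i (sMat F q N G r)))
    (fun i j => matrixSeries (toPS (RtfacO F q N i j))) _ = _
  simp only [matrixSeries_toPS_RtfacO, ← ampAt_dilatedSeries, dilatedSeries_sMat, hG]
  rfl

end SklyaninSeries

section Counit

open PowerSeries
open scoped Matrix

variable {F : Type} [Field F] {q : F} {N : ℕ}

/-- The coefficients of the constant series with value the identity matrix. -/
def unitCoeff (F : Type) [Field F] (N r : ℕ) : Matrix (Fin N) (Fin N) F := if r = 0 then 1 else 0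

lemma amp1_one {A : Type} [Ring A] : amp1 (1 : Matrix (Fin N) (Fin N) A) = 1 := by
  ext p r
  obtain ⟨a, b⟩ := p
  obtain ⟨c, d⟩ := r
  simp only [amp1, Matrix.of_apply, Matrix.one_apply, Prod.mk.injEq]
  split_ifs <;> simp_all

lemma amp2_one {A : Type} [Ring A] : amp2 (1 : Matrix (Fin N) (Fin N) A) = 1 := by
  ext p r
  obtain ⟨a, b⟩ := p
  obtain ⟨c, d⟩ := r
  simp only [amp2, Matrix.of_apply, Matrix.one_apply, Prod.mk.injEq]
  split_ifs <;> simp_all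

lemma amp1_zero {A : Type} [Ring A] : amp1 (0 : Matrix (Fin N) (Fin N) A) = 0 := by
  ext p r
  simp [amp1]

lemma amp2_zero {A : Type} [Ring A] : amp2 (0 : Matrix (Fin N) (Fin N) A) = 0 := by
  ext p r
  simp [amp2]

lemma z1_unitCoeff (a : ℤ) : z1 (unitCoeff F N) a = if a = 0 then 1 else 0 := by
  rw [z1, unitCoeff]
  split_ifs <;> first | omega | simp [amp1_one, amp1_zero]

lemma z2_unitCoeff (a : ℤ) : z2 (unitCoeff F N) a = if a = 0 then 1 else 0 := by
  rw [z2, unitCoeff]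
  split_ifs <;> first | omega | simp [amp2_one, amp2_zero]

lemma affRttL_unitCoeff (a b a' b' : ℤ) :
    affRttL F q (unitCoeff F N) (unitCoeff F N) a b a' b' =
      affRttR F q (unitCoeff F N) (unitCoeff F N) a b a' b' := by
  simp only [affRttL, affRttR, z1_unitCoeff, z2_unitCoeff]
  split_ifs <;> simp

/-- The values of the counit on the generators. -/
def freeCounit (F : Type) [Field F] (N : ℕ) : FreeAlgebra F (AffGen N) →ₐ[F] F :=
  FreeAlgebra.lift F (Sum.elim (fun p => unitCoeff F N p.1 p.2.1 p.2.2)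
    fun p => unitCoeff F N p.1 p.2.1 p.2.2)

lemma map_freeCounit_TfA : (fun r => (TfA F N r).map (freeCounit F N)) = unitCoeff F N := by
  ext r i j
  simp [TfA, freeCounit]

lemma map_freeCounit_TbfA : (fun r => (TbfA F N r).map (freeCounit F N)) = unitCoeff F N := by
  ext r i j
  simp [TbfA, freeCounit]

lemma freeCounit_affRtt {X Y : ℕ → Matrix (Fin N) (Fin N) (FreeAlgebra F (AffGen N))}
    (hX : (fun r => (X r).map (freeCounit F N)) = unitCoeff F N)
    (hY : (fun r => (Y r).map (freeCounit F N)) = unitCoeff F N) (a b a' b' : ℤ)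
    (p r : Fin N × Fin N) :
    freeCounit F N (affRttL F q X Y a b a' b' p r) =
      freeCounit F N (affRttR F q X Y a b a' b' p r) := by
  have hL := map_affRttL (q := q) (freeCounit F N) X Y a b a' b'
  have hR := map_affRttR (q := q) (freeCounit F N) X Y a b a' b'
  rw [hX, hY] at hL hR
  rw [affRttL_unitCoeff, ← hR] at hL
  exact congrFun (congrFun hL p) r

lemma freeCounit_rel ⦃x y : FreeAlgebra F (AffGen N)⦄ (h : AffGlRel F q N x y) :
    freeCounit F N x = freeCounit F N y := by
  have hT := fun r i j => congrFun (congrFun (congrFun (map_freeCounit_TfA (F := F) (N := N)) r) i) j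
  have hTb := fun r i j =>
    congrFun (congrFun (congrFun (map_freeCounit_TbfA (F := F) (N := N)) r) i) j
  simp only [Matrix.map_apply] at hT hTb
  cases h with
  | t0_tri i j h => rw [hT, map_zero, unitCoeff, if_pos rfl, Matrix.one_apply_ne h.ne]
  | tb0_tri i j h => rw [hTb, map_zero, unitCoeff, if_pos rfl, Matrix.one_apply_ne h.ne']
  | t_tb i => simp [hT, hTb, unitCoeff]
  | tb_t i => simp [hT, hTb, unitCoeff]
  | rtt a b p r => exact freeCounit_affRtt map_freeCounit_TfA map_freeCounit_TfA ..
  | rtbtb a b p r => exact freeCounit_affRtt map_freeCounit_TbfA map_freeCounit_TbfA ..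
  | rtbt a b p r => exact freeCounit_affRtt map_freeCounit_TbfA map_freeCounit_TfA ..

/-- The counit of `U_q(ĝl_N)`. -/
def affCounit (F : Type) [Field F] (q : F) (N : ℕ) : UqAff F q N →ₐ[F] F :=
  RingQuot.liftAlgHom F ⟨freeCounit F N, freeCounit_rel⟩

lemma affCounit_tMat (r : ℕ) : (tMat F q N r).map (affCounit F q N) = unitCoeff F N r := by
  ext i j
  simp [tMat, tA, affCounit, freeCounit]

lemma affCounit_tbMat (r : ℕ) : (tbMat F q N r).map (affCounit F q N) = unitCoeff F N r := by
  ext i j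
  simp [tbMat, tbA, affCounit, freeCounit]

/-- The counit applied to the coefficients of a series. -/
def seriesCounit (F : Type) [Field F] (q : F) (N : ℕ) : (UqAff F q N)⟦X⟧ →+* F⟦X⟧ :=
  PowerSeries.map (affCounit F q N : UqAff F q N →+* F)

lemma seriesCounit_scalarSeries (f : F⟦X⟧) :
    seriesCounit F q N (scalarSeries F (UqAff F q N) f) = f := by
  ext k
  rw [seriesCounit, PowerSeries.coeff_map, coeff_scalarSeries]
  exact (affCounit F q N).commutes _

lemma map_seriesCounit_dilatedSeries {Y : ℕ → Matrix (Fin N) (Fin N) (UqAff F q N)}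
    (hY : ∀ r, (Y r).map (affCounit F q N) = unitCoeff F N r) (α : F) :
    (dilatedSeries Y α).map (seriesCounit F q N) = 1 := by
  ext i j k
  have h := congrFun (congrFun (hY k) i) j
  rw [Matrix.map_apply] at h
  rw [Matrix.map_apply, seriesCounit, PowerSeries.coeff_map, coeff_dilatedSeries]
  change affCounit F q N _ = _
  rw [map_smul, h, unitCoeff]
  by_cases hk : k = 0
  · subst hk
    simp [Matrix.one_apply, apply_ite (coeff 0)]
  · by_cases hij : i = j <;> simp [hk, hij, Matrix.one_apply, coeff_one]

lemma map_seriesCounit_sklyanin (G : Matrix (Fin N) (Fin N) F⟦X⟧)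
    (R : Fin N → Fin N → Matrix (Fin N × Fin N) (Fin N × Fin N) F⟦X⟧) (l : List (Fin N)) :
    (pairProd (fun i => ampAt i (tSystem F q N i * G.map (scalarSeries F (UqAff F q N)) *
        (tbSystem F q N i)ᵀ))
      (fun i j => twoSite i j ((R i j).map (scalarSeries F (UqAff F q N)))) l).map
        (seriesCounit F q N) =
      pairProd (fun i => ampAt i G) (fun i j => twoSite i j (R i j)) l := by
  refine (map_pairProd ((seriesCounit F q N).mapMatrix (m := Fin N → Fin N)).toMonoidHom _ _ _).trans ?_
  change pairProd (fun i => (ampAt i _).map _) (fun i j => (twoSite i j _).map _) _ = _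
  congr 1
  · funext i
    rw [map_ampAt, Matrix.map_mul, Matrix.map_mul, Matrix.transpose_map, tSystem, tbSystem,
      map_seriesCounit_dilatedSeries affCounit_tMat, map_seriesCounit_dilatedSeries affCounit_tbMat]
    simp [Matrix.map_map, Function.comp_def, seriesCounit_scalarSeries]
  · funext i j
    rw [map_twoSite]
    simp [Matrix.map_map, Function.comp_def, seriesCounit_scalarSeries]

end Counit

section SklyaninDeterminant

open PowerSeries
open scoped Matrix

variable {F : Type} [Field F] {q : F} {N : ℕ}

/-- The scalar matrix `∏ᵢ (Gᵢ ∏_{j>i} Rᵢⱼᵗ)` as a power series in `u⁻¹`. -/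
def constSklyanin (q : F) (G : Matrix (Fin N) (Fin N) F) :
    Matrix (Fin N → Fin N) (Fin N → Fin N) F⟦X⟧ :=
  pairProd (fun i => ampAt i (G.map (algebraMap F F⟦X⟧)))
    (fun i j => twoSite i j (rtMat q N (specX q i.val) (specV q j.val))) (List.finRange N)

/-- The list of factors `S₁(u) R₁₂ᵗ ⋯ S_N(q^{-2N+2}u)` with `S(u) = T(u) G T̄(u⁻¹)ᵗ`. -/
def sklyaninFactors (q : F) (G : Matrix (Fin N) (Fin N) F) :
    List (ℤ → Matrix (Fin N → Fin N) (Fin N → Fin N) (UqAff F q N)) :=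
  (List.finRange N).flatMap fun i => siteFactor q (sMat F q N G) i ::
    (((List.finRange N).filter fun j => i < j).map fun j => RtfacO F q N i j)

lemma length_sklyaninFactors (G : Matrix (Fin N) (Fin N) F) :
    (sklyaninFactors q G).length = N + (pairsLex N).length := by
  rw [sklyaninFactors, length_flatMap_cons, List.length_finRange, pairsLex, List.length_flatMap,
    List.length_flatMap]
  simp only [List.length_map]

variable {Pq : Equiv.Perm (Fin N) → Matrix (Fin N → Fin N) (Fin N → Fin N) F}
  {G : Matrix (Fin N) (Fin N) F} {sd : ℤ → UqAff F q N}

/-- The first row of the defining identity of the Sklyanin determinant. -/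
lemma sklyanin_row (hP : PqExt F q N N Pq)
    (hsd : ∀ m : ℤ, seriesProdCoeff ((fun m' : ℤ => if m' = 0 then
      (AqM F Pq).map (algebraMap F (UqAff F q N)) else 0) :: sklyaninFactors q G) m =
        sd m • (AqM F Pq).map (algebraMap F (UqAff F q N))) (g : Fin N → Fin N) :
    X ^ (N + 1) * (qSignA q (UqAff F q N)⟦X⟧ ᵥ*
      pairProd (fun i => ampAt i (tSystem F q N i * (G.map (algebraMap F F⟦X⟧)).map
            (scalarSeries F (UqAff F q N)) * (tbSystem F q N i)ᵀ))
          (fun i j => twoSite i j ((rtMat q N (specX q i.val) (specV q j.val)).map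
            (scalarSeries F (UqAff F q N)))) (List.finRange N)) g =
      (PowerSeries.mk fun k => sd (((sklyaninFactors q G).length + 1 : ℕ) - k)) *
        qSignA q (UqAff F q N)⟦X⟧ g := by
  have h := congrFun (congrFun (matrixSeries_prod_sdetFacs (q := q) (AqM F Pq) G) id) g
  rw [Matrix.smul_apply, smul_eq_mul, Matrix.mul_apply] at h
  simp only [Matrix.map_apply, AqM_id_apply hP] at h
  refine h.symm.trans ?_
  ext k
  rw [coeff_matrixSeries, ← seriesProdCoeff_length_sub]
  refine (congrFun (congrFun (hsd _) id) g).trans ?_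
  rw [Matrix.smul_apply, Matrix.map_apply, AqM_id_apply hP, qSignA, PowerSeries.algebraMap_apply,
    coeff_mul_C, coeff_mk]
  rfl

lemma seriesCounit_qSignA (g : Fin N → Fin N) :
    seriesCounit F q N (qSignA q (UqAff F q N)⟦X⟧ g) = qSignA q F⟦X⟧ g := by
  rw [qSignA, ← (scalarSeries F (UqAff F q N)).commutes, seriesCounit_scalarSeries, qSignA]

lemma seriesCounit_qSignA_vecMul
    (M : Matrix (Fin N → Fin N) (Fin N → Fin N) (UqAff F q N)⟦X⟧) (g : Fin N → Fin N) :
    seriesCounit F q N ((qSignA q (UqAff F q N)⟦X⟧ ᵥ* M) g) =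
      (qSignA q F⟦X⟧ ᵥ* M.map (seriesCounit F q N)) g := by
  rw [Matrix.vecMul, dotProduct, map_sum]
  refine Finset.sum_congr rfl fun h _ => ?_
  rw [map_mul, seriesCounit_qSignA]
  rfl

lemma qSignA_vecMul_constSklyanin (hq : q ≠ 0) (hP : PqExt F q N N Pq)
    (hsd : ∀ m : ℤ, seriesProdCoeff ((fun m' : ℤ => if m' = 0 then
      (AqM F Pq).map (algebraMap F (UqAff F q N)) else 0) :: sklyaninFactors q G) m =
        sd m • (AqM F Pq).map (algebraMap F (UqAff F q N)))
    {h₀ : Fin N → Fin N} (hh₀ : Function.Injective h₀) {κ : F⟦X⟧}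
    (hκ : (qSignA q F⟦X⟧ ᵥ* constSklyanin q G) h₀ = κ * qSignA q F⟦X⟧ h₀) (h : Fin N → Fin N) :
    (qSignA q F⟦X⟧ ᵥ* constSklyanin q G) h = κ * qSignA q F⟦X⟧ h := by
  set s := seriesCounit F q N
    (PowerSeries.mk fun k => sd (((sklyaninFactors q G).length + 1 : ℕ) - k))
  have key (g : Fin N → Fin N) :
      X ^ (N + 1) * (qSignA q F⟦X⟧ ᵥ* constSklyanin q G) g = s * qSignA q F⟦X⟧ g := by
    have hr := congrArg (seriesCounit F q N) (sklyanin_row hP hsd g)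
    rw [map_mul, map_mul, seriesCounit_qSignA, map_pow] at hr
    have hX : seriesCounit F q N X = X := PowerSeries.map_X _
    rw [hX] at hr
    rw [seriesCounit_qSignA_vecMul, map_seriesCounit_sklyanin] at hr
    exact hr
  have hη : qSignA q F⟦X⟧ h₀ ≠ 0 := by
    rw [qSignA]
    exact (map_ne_zero_iff _ (algebraMap F F⟦X⟧).injective).2 (qSign_ne_zero hq hh₀)
  have hs : s = X ^ (N + 1) * κ := by
    refine mul_right_cancel₀ hη ?_
    rw [← key, hκ, mul_assoc]
  refine mul_left_cancel₀ (pow_ne_zero (N + 1) X_ne_zero) ?_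
  rw [key, hs, mul_assoc]

/-- The factorization of the Sklyanin determinant, up to the computation of the scalar `κ`. -/
theorem sklyanin_factorization (hq : q ≠ 0) (hq1 : ∀ m : ℤ, m ≠ 0 → q ^ m ≠ 1)
    (hP : PqExt F q N N Pq)
    (hsd : ∀ m : ℤ, seriesProdCoeff ((fun m' : ℤ => if m' = 0 then
      (AqM F Pq).map (algebraMap F (UqAff F q N)) else 0) :: sklyaninFactors q G) m =
        sd m • (AqM F Pq).map (algebraMap F (UqAff F q N)))
    {h₀ : Fin N → Fin N} (hh₀ : Function.Injective h₀) {κ : F⟦X⟧}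
    (hκ : (qSignA q F⟦X⟧ ᵥ* constSklyanin q G) h₀ = κ * qSignA q F⟦X⟧ h₀)
    {L : List (ℤ → UqAff F q N)} {e : ℕ} (hL : L.length = (pairsLex N).length + e)
    (hLP : (L.map toPS).prod = scalarSeries F (UqAff F q N) (X ^ e * κ)) (m : ℤ) :
    sd m = seriesProdCoeff (L ++ [qdetTc F q N, qdetTbc F q N]) m := by
  have hrow := sklyanin_row hP hsd Fin.rev
  rw [vecMul_sklyanin_rev hq hq1 (scalarSeries F (UqAff F q N)) scalarSeries_commute
    (fun _ => G.map (algebraMap F F⟦X⟧)) (fun i j => rtMat q N (specX q i.val) (specV q j.val)) κ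
    (isRttSystem_tSystem hq) (isRttSystem_tbSystem_rev hq)
    (fun i j hij => tbSystem_transpose_exchange hq hij)
    (qSignA_vecMul_constSklyanin hq hP hsd hh₀ hκ), ← mul_assoc] at hrow
  have hη : IsUnit (qSignA q (UqAff F q N)⟦X⟧ (Fin.rev : Fin N → Fin N)) :=
    (qSign_ne_zero hq Fin.rev_injective).isUnit.map (algebraMap F _)
  have hS := hη.mul_right_cancel hrow
  have hXc : ∀ f : (UqAff F q N)⟦X⟧, f * X = X * f := fun f => (commute_X f).eq
  have hι : ∀ f : (UqAff F q N)⟦X⟧, Commute (scalarSeries F (UqAff F q N) κ) f :=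
    scalarSeries_commute κ
  refine eq_seriesProdCoeff (l := (sklyaninFactors q G).length + 1) (fun m hm => ?_)
    (fun k => coeff_mk _ _) ?_ m
  · have h := congrFun (congrFun (hsd m) id) id
    rw [seriesProdCoeff_of_length_lt _ (by simpa using hm), Matrix.smul_apply, Matrix.map_apply,
      AqM_id_apply hP, qSign_id, map_one, smul_eq_mul, mul_one] at h
    exact h.symm
  · rw [← hS, List.map_append, List.prod_append, hLP, List.map_cons, List.map_cons, List.map_nil,
      List.prod_cons, List.prod_cons, List.prod_nil, toPS_qdetTc, toPS_qdetTbc, mul_one,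
      List.length_append, hL, length_sklyaninFactors, map_mul, map_pow, scalarSeries_X]
    set a := rttDet q (tSystem F q N)
    set b := rttDet q fun k => tbSystem F q N k.rev
    set k := scalarSeries F (UqAff F q N) κ
    have h1 : X * a * (X * b) = X ^ 2 * (a * b) := by
      rw [mul_assoc, ← mul_assoc a, hXc a, pow_two]
      simp only [mul_assoc]
    rw [h1, ← (hι a).eq, mul_assoc k, mul_assoc (X ^ e), ← mul_assoc k (X ^ 2),
      (commute_X_pow k 2).eq]
    simp only [← mul_assoc, ← pow_add]
    congr 4
    simp only [List.length_cons, List.length_nil]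
    ring

end SklyaninDeterminant

section Specializations

open PowerSeries
open scoped Matrix

variable {F : Type} [Field F] {q : F} {N n : ℕ}

lemma SmatA_eq_sMat : SmatA F q N = sMat F q N 1 := by
  funext r
  ext i j
  simp only [SmatA, Scoef, sMat, Matrix.of_apply, Matrix.sum_apply]
  rw [Finset.sum_comm, Finset.Nat.sum_antidiagonal_eq_sum_range_succ_mk]
  refine Finset.sum_congr rfl fun p _ => ?_
  simp [Matrix.mul_apply, tMat, tbMat]

lemma sum_fin_two_mul {M : Type} [AddCommMonoid M] (f : Fin (2 * n) → M) :
    ∑ a, f a = ∑ k : Fin n, (f (fe n k) + f (fo n k)) := by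
  rw [← (finProdFinEquiv.trans (finCongr (mul_comm n 2))).sum_comp f, Fintype.sum_prod_type]
  refine Finset.sum_congr rfl fun k _ => ?_
  rw [Fin.sum_univ_two]
  congr 2
  · ext
    simp [fe]
  · ext
    simp [fo, add_comm]

lemma partner_fe (k : Fin n) : partner (fe n k) = fo n k := by
  ext
  simp [partner_val, fe, fo]

lemma partner_fo (k : Fin n) : partner (fo n k) = fe n k := by
  rw [← partner_fe, partner_partner]

lemma mul_skewMat_apply {A : Type} [Ring A] [Algebra F A]
    (M M' : Matrix (Fin (2 * n)) (Fin (2 * n)) A) (i j : Fin (2 * n)) :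
    (M * (skewMat q n).map (algebraMap F A) * M'ᵀ) i j =
      ∑ a : Fin n, (algebraMap F A q * (M i (fe n a) * M' j (fo n a)) -
        M i (fo n a) * M' j (fe n a)) := by
  have h : ∀ b, (M * (skewMat q n).map (algebraMap F A)) i b =
      M i (partner b) * algebraMap F A (skewMat q n (partner b) b) := fun b => by
    rw [Matrix.mul_apply, Finset.sum_eq_single (partner b)]
    · rfl
    · intro c _ hc
      have hcb : b ≠ partner c := fun hb => hc (by rw [hb, partner_partner])
      rw [Matrix.map_apply, skewMat, Matrix.of_apply, if_neg hcb, map_zero, mul_zero]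
    · simp
  have he (k : Fin n) : skewMat q n (fo n k) (fe n k) = -1 := by
    rw [skewMat, Matrix.of_apply, if_pos (partner_fo k).symm, if_neg (by simp [fo])]
  have ho (k : Fin n) : skewMat q n (fe n k) (fo n k) = q := by
    rw [skewMat, Matrix.of_apply, if_pos (partner_fe k).symm, if_pos (by simp [fe])]
  rw [Matrix.mul_apply, sum_fin_two_mul]
  refine Finset.sum_congr rfl fun k _ => ?_
  rw [h, h, partner_fe, partner_fo, he, ho, Matrix.transpose_apply, Matrix.transpose_apply,
    map_neg, map_one, mul_neg_one, neg_mul, ← Algebra.commutes q, mul_assoc]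
  abel

lemma SmatASp_eq_sMat : SmatASp F q n = sMat F q (2 * n) (skewMat q n) := by
  funext r
  ext i j
  simp only [SmatASp, ScoefSp, sMat, Matrix.of_apply, Matrix.sum_apply]
  rw [Finset.sum_comm, Finset.Nat.sum_antidiagonal_eq_sum_range_succ_mk]
  refine Finset.sum_congr rfl fun p _ => ?_
  rw [mul_skewMat_apply]
  rfl

lemma ampAt_one {A : Type} [Ring A] (k : Fin N) : ampAt k (1 : Matrix (Fin N) (Fin N) A) = 1 := by
  ext f g
  simp only [ampAt, Matrix.of_apply, Matrix.one_apply]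
  by_cases h : f = g
  · simp [h]
  · rw [if_neg h]
    split_ifs with h1 h2
    · refine absurd (funext fun l => ?_) h
      by_cases hl : l = k
      · rw [hl, h2]
      · exact h1 l hl
    · rfl
    · rfl

lemma qSignA_vecMul_constSklyanin_one :
    (qSignA q F⟦X⟧ ᵥ* constSklyanin q (1 : Matrix (Fin N) (Fin N) F)) id =
      gammaSeries q N * qSignA q F⟦X⟧ (id : Fin N → Fin N) := by
  rw [constSklyanin, Matrix.map_one _ (map_zero _) (map_one _)]
  simp only [ampAt_one]
  exact vecMul_pairProd_rtMat_of_injective (fun i => specX q i.val) (fun i => specV q i.val) _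
    (List.nodup_finRange N) _ Function.injective_id

lemma qSignA_vecMul_constSklyanin_skewMat (hq : q ≠ 0) :
    (qSignA q F⟦X⟧ ᵥ* constSklyanin q (skewMat q n)) (oddEvenWord n) =
      ((-q) ^ n • ((List.finRange (2 * n)).map fun k =>
        skewFactor q n (specX q) (specV q) k.val).prod) * qSignA q F⟦X⟧ (oddEvenWord n) := by
  refine (qSign_vecMul_pairProd_skewMat hq (specV_succ hq)).trans ?_
  rw [Algebra.smul_def, mul_comm]
  rfl

/-- The recursion determining the expansion of `(q^{n-2} - qⁿu²)/(q^{2n-2} - q^{-2n}u²)`. -/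
lemma toPS_skewQuotient {g : ℤ → F} (hg : ∀ m : ℤ, 1 < m → g m = 0)
    (hrec : ∀ m : ℤ, q ^ (2 * (n : ℤ) - 2) * g m - q ^ (-2 * (n : ℤ)) * g (m - 2) =
      if m = 0 then q ^ ((n : ℤ) - 2) else if m = 2 then -(q ^ (n : ℤ)) else 0) :
    (q ^ (2 * (n : ℤ) - 2) • X ^ 2 - q ^ (-2 * (n : ℤ)) • 1) * toPS g =
      X * (q ^ ((n : ℤ) - 2) • X ^ 2 - q ^ (n : ℤ) • 1) := by
  ext k
  have h1 : coeff k ((X : F⟦X⟧) ^ 2 * toPS g) = g (3 - k) := by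
    rw [coeff_X_pow_mul']
    split_ifs with h
    · rw [coeff_toPS]
      congr 1
      omega
    · rw [hg _ (by omega)]
  have h := hrec (3 - k)
  rw [show (3 - k - 2 : ℤ) = 1 - k by ring] at h
  rw [sub_mul, smul_mul_assoc, smul_mul_assoc, one_mul, map_sub, PowerSeries.coeff_smul,
    PowerSeries.coeff_smul, h1, coeff_toPS, smul_eq_mul, smul_eq_mul, h, mul_sub, mul_smul_comm,
    mul_smul_comm, ← pow_succ', mul_one, map_sub, PowerSeries.coeff_smul, PowerSeries.coeff_smul,
    coeff_X_pow, coeff_X]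
  have e1 : (3 - k : ℤ) = 0 ↔ k = 3 := by omega
  have e2 : (3 - k : ℤ) = 2 ↔ k = 1 := by omega
  simp only [e1, e2]
  by_cases h3 : k = 3
  · simp [h3]
  · by_cases h4 : k = 1 <;> simp [h3, h4]

lemma gammaSeries_mul_toPS (hq : q ≠ 0) {g : ℤ → F} (hg : ∀ m : ℤ, 1 < m → g m = 0)
    (hrec : ∀ m : ℤ, q ^ (2 * (n : ℤ) - 2) * g m - q ^ (-2 * (n : ℤ)) * g (m - 2) =
      if m = 0 then q ^ ((n : ℤ) - 2) else if m = 2 then -(q ^ (n : ℤ)) else 0) :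
    gammaSeries q (2 * n) * toPS g = X * ((-q) ^ n • ((List.finRange (2 * n)).map fun k =>
      skewFactor q n (specX q) (specV q) k.val).prod) := by
  have hD : (q ^ (2 * (n : ℤ) - 2) • X ^ 2 - q ^ (-2 * (n : ℤ)) • 1 : F⟦X⟧) ≠ 0 := by
    intro h
    have h := congrArg (coeff 0) h
    simp at h
    exact zpow_ne_zero _ hq h
  refine mul_right_cancel₀ hD ?_
  rw [mul_assoc X, prod_skewFactor_mul hq, mul_assoc, mul_comm (toPS g), toPS_skewQuotient hg hrec]
  ring

lemma scalarSeries_toPS (A : Type) [Ring A] [Algebra F A] (g : ℤ → F) :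
    toPS (fun m => algebraMap F A (g m)) = scalarSeries F A (toPS g) := by
  ext k
  rw [coeff_toPS, coeff_scalarSeries, coeff_toPS]

lemma qq_ne_zero : qq ≠ 0 := RatFunc.X_ne_zero

lemma qq_zpow_ne_one {m : ℤ} (hm : m ≠ 0) : qq ^ m ≠ 1 := by
  have hX : ∀ k : ℕ, k ≠ 0 → qq ^ k ≠ 1 := by
    intro k hk h
    rw [qq, ← RatFunc.algebraMap_X, ← map_pow, ← map_one (algebraMap (Polynomial ℂ) (RatFunc ℂ))] at h
    have h := congrArg Polynomial.natDegree (RatFunc.algebraMap_injective ℂ h)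
    simp [hk] at h
  intro h
  refine hX m.natAbs (Int.natAbs_ne_zero.2 hm) ?_
  rcases Int.natAbs_eq m with h' | h'
  · rw [h', zpow_natCast] at h
    exact h
  · rw [h', zpow_neg, inv_eq_one, zpow_natCast] at h
    exact h

end Specializations

set_option synthInstance.maxHeartbeats 1000000 in
set_option maxHeartbeats 1000000 in
/-- the Sklyanin determinant factorizes as
`sdet S(u) = γ_N(u) qdet T(u) qdet T̄(q^{2N-2}u⁻¹)`.  All series are handled
coefficientwise; `sd` is the Sklyanin determinant, defined by
`A^q_N S₁(u) R₁₂ᵗ ⋯ R_{N-1,N}ᵗ S_N(q^{-2N+2}u) = sdet S(u) · A^q_N`;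
in the symplectic case the series `g` is the expansion (in powers of `u⁻¹`) of the
rational function `(q^{n-2} - qⁿu²)/(q^{2n-2} - q^{-2n}u²)` entering `γ_{2n}(u)`. -/
theorem stmt18 :
    (∀ (N : ℕ) (Pq : Equiv.Perm (Fin N) → Matrix (Fin N → Fin N) (Fin N → Fin N) FF),
      PqExt FF qq N N Pq →
      ∀ sd : ℤ → UqAff FF qq N,
        (∀ m : ℤ, seriesProdCoeff
            ((fun m' : ℤ => if m' = 0 then
                (AqM FF Pq).map (algebraMap FF (UqAff FF qq N)) else 0)
              :: sdetFacsO FF qq N) m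
          = sd m • (AqM FF Pq).map (algebraMap FF (UqAff FF qq N))) →
        ∀ m : ℤ, sd m = seriesProdCoeff (rhsO FF qq N) m) ∧
    (∀ (n : ℕ)
        (Pq : Equiv.Perm (Fin (2 * n)) →
          Matrix (Fin (2 * n) → Fin (2 * n)) (Fin (2 * n) → Fin (2 * n)) FF),
      PqExt FF qq (2 * n) (2 * n) Pq →
      ∀ g : ℤ → FF, (∀ m : ℤ, 1 < m → g m = 0) →
        (∀ m : ℤ, qq ^ (2 * (n : ℤ) - 2) * g m - qq ^ (-2 * (n : ℤ)) * g (m - 2)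
          = if m = 0 then qq ^ ((n : ℤ) - 2) else if m = 2 then -(qq ^ (n : ℤ)) else 0) →
      ∀ sd : ℤ → UqAff FF qq (2 * n),
        (∀ m : ℤ, seriesProdCoeff
            ((fun m' : ℤ => if m' = 0 then
                (AqM FF Pq).map (algebraMap FF (UqAff FF qq (2 * n))) else 0)
              :: sdetFacsSp FF qq n) m
          = sd m • (AqM FF Pq).map (algebraMap FF (UqAff FF qq (2 * n)))) →
        ∀ m : ℤ, sd m = seriesProdCoeff
          (((pairsLex (2 * n)).map fun p => gamFac FF qq (2 * n) p)
            ++ ((fun m' : ℤ => algebraMap FF (UqAff FF qq (2 * n)) (g m'))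
                :: [qdetTc FF qq (2 * n), qdetTbc FF qq (2 * n)])) m) := by
  refine ⟨fun N Pq hP sd hsd => ?_, fun n Pq hP g hg hrec sd hsd => ?_⟩
  · have hfac : sdetFacsO FF qq N = sklyaninFactors qq 1 := by
      rw [sklyaninFactors, ← SmatA_eq_sMat]
      rfl
    rw [hfac] at hsd
    refine sklyanin_factorization (e := 0) qq_ne_zero (fun _ => qq_zpow_ne_one) hP hsd
      Function.injective_id qSignA_vecMul_constSklyanin_one (List.length_map _) ?_
    rw [prod_map_toPS_gamFac, pow_zero, one_mul]
  · have hfac : sdetFacsSp FF qq n = sklyaninFactors qq (skewMat qq n) := by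
      rw [sklyaninFactors, ← SmatASp_eq_sMat]
      rfl
    rw [hfac] at hsd
    rw [List.append_cons]
    refine sklyanin_factorization (e := 1) qq_ne_zero (fun _ => qq_zpow_ne_one) hP hsd
      oddEvenWord_injective (qSignA_vecMul_constSklyanin_skewMat qq_ne_zero) (by simp) ?_
    rw [List.map_append, List.prod_append, prod_map_toPS_gamFac, List.map_singleton,
      List.prod_singleton, scalarSeries_toPS, ← map_mul, pow_one,
      gammaSeries_mul_toPS qq_ne_zero hg hrec]
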